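/- Let n ≥ 2 be an integer and set p = 2(n+1)/(n-1). For every ε > 0 there is a constant C_ε (depending only on n and ε) such that the following holds for every 0 < δ < 1. For each θ in the family of √δ-caps of P^{n-1}, let Λ_θ be a finite set of points of P^{n-1} lying in θ, and let Λ = ⋃_θ Λ_θ (a disjoint union). Then for every a : Λ → ℂ, every R ≥ δ^{-1} and every Euclidean ball B_R ⊂ ℝⁿ of radius R centered at a point c, one has ‖ Σ_{ξ ∈ Λ} a_ξ e(x·ξ) ‖_{L^p(B_R)} ≤ C_ε · δ^{-ε} · ( Σ_θ ‖ Σ_{ξ ∈ Λ_θ} a_ξ e(x·ξ) ‖²_{L^p(w_{B_R})} )^{1/2}, where w_{B_R}(x) = (1 + |x − c|/R)^{−10n} and ‖F‖_{L^p(w_{B_R})} = (∫_{ℝⁿ} |F(x)|^p w_{B_R}(x) dx)^{1/p}. -/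

import Mathlib

open MeasureTheory Real
open scoped RealInnerProductSpace ENNReal

noncomputable section

abbrev Rsp (m : ℕ) : Type := EuclideanSpace ℝ (Fin m ⊕ Unit)

/-- `e(t) = e^{2πit}`. -/
def ee (t : ℝ) : ℂ := Complex.exp (2 * Real.pi * Complex.I * t)

/-- The `√δ`-cap of the truncated paraboloid `P^{n-1}` above the cube with center
`c = (√δ/2)·k`. -/
def parabCap (n : ℕ) (δ : ℝ) (k : Fin (n - 1) → ℤ) : Set (Rsp (n - 1)) :=
  {x | (∀ i, |x (Sum.inl i) - (k i : ℝ) * (Real.sqrt δ / 2)| ≤ Real.sqrt δ / 2) ∧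
    x (Sum.inr ()) = ∑ i, (x (Sum.inl i)) ^ 2}

/-- The admissible centers `c = (√δ/2)·k ∈ [-1/2,1/2]^{n-1}`. -/
def centerOK (n : ℕ) (δ : ℝ) (k : Fin (n - 1) → ℤ) : Prop :=
  ∀ i, |(k i : ℝ) * (Real.sqrt δ / 2)| ≤ 1 / 2

/-- The weighted `L^p(w_{B_R})` norm, with weight `w(x) = (1+|x-c|/R)^{-10n}`. -/
def wNorm (n : ℕ) (p : ℝ) (F : Rsp (n - 1) → ℂ) (c : Rsp (n - 1)) (R : ℝ) : ℝ≥0∞ :=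
  (∫⁻ x, (‖F x‖₊ : ℝ≥0∞) ^ p *
      ENNReal.ofReal ((1 + dist x c / R) ^ (-(10 * (n : ℝ))))) ^ (1 / p)

section
open MeasureTheory Real
open scoped RealInnerProductSpace ENNReal NNReal

set_option linter.all false
namespace Dcp

/-- bracket -/
def br (t : ℝ) : ℝ≥0∞ := ENNReal.ofReal (1 + t)

lemma br_mono {a b : ℝ} (h : a ≤ b) : br a ≤ br b := ENNReal.ofReal_le_ofReal (by linarith)
lemma br_ne_top (a : ℝ) : br a ≠ ∞ := ENNReal.ofReal_ne_top
lemma one_le_br {a : ℝ} (h : 0 ≤ a) : 1 ≤ br a := by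
  unfold br; rw [← ENNReal.ofReal_one]; exact ENNReal.ofReal_le_ofReal (by linarith)
lemma br_ne_zero {a : ℝ} (h : 0 ≤ a) : br a ≠ 0 := by
  have := one_le_br h; intro h0; simp [h0] at this
lemma br_add_le {a b : ℝ} (ha : 0 ≤ a) (hb : 0 ≤ b) : br (a + b) ≤ br a * br b := by
  unfold br; rw [← ENNReal.ofReal_mul (by linarith)]
  exact ENNReal.ofReal_le_ofReal (by nlinarith)
lemma br_mul_le {a b : ℝ} (hb : 0 ≤ b) : br (a * b) ≤ ENNReal.ofReal (max 1 a) * br b := by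
  unfold br; rw [← ENNReal.ofReal_mul (by positivity)]
  apply ENNReal.ofReal_le_ofReal
  have h1 := le_max_left 1 a
  have h2 := le_max_right 1 a
  nlinarith

section
variable {X : Type*} [NormedAddCommGroup X] [NormedSpace ℝ X] [FiniteDimensional ℝ X]
  [MeasureSpace X] [BorelSpace X] [(volume : Measure X).IsAddHaarMeasure]

def Phi (M : ℕ) (y : X) : ℝ≥0∞ := (br ‖y‖ ^ M)⁻¹


lemma brn_ne_zero (M : ℕ) (y : X) : br ‖y‖ ^ M ≠ 0 := pow_ne_zero _ (br_ne_zero (norm_nonneg _))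
lemma brn_ne_top (M : ℕ) (y : ℝ) : br y ^ M ≠ ∞ := ENNReal.pow_ne_top (br_ne_top _)
lemma Phi_ne_top (M : ℕ) (y : X) : Phi M y ≠ ∞ := ENNReal.inv_ne_top.2 (brn_ne_zero M y)
lemma Phi_ne_zero (M : ℕ) (y : X) : Phi M y ≠ 0 := ENNReal.inv_ne_zero.2 (brn_ne_top M _)
lemma Phi_mul (M : ℕ) (y : X) : br ‖y‖ ^ M * Phi M y = 1 :=
  ENNReal.mul_inv_cancel (brn_ne_zero M y) (brn_ne_top M _)
lemma Phi_add (M N : ℕ) (y : X) : Phi (M + N) y = Phi M y * Phi N y := by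
  unfold Phi; rw [pow_add, ENNReal.mul_inv (Or.inl (brn_ne_zero M y)) (Or.inl (brn_ne_top M _))]
lemma Phi_anti {M N : ℕ} (h : M ≤ N) (y : X) : Phi N y ≤ Phi M y := by
  unfold Phi
  exact ENNReal.inv_le_inv.2 (pow_le_pow_right₀ (one_le_br (norm_nonneg _)) h)
lemma Phi_le_one (M : ℕ) (y : X) : Phi M y ≤ 1 := by
  have := Phi_anti (Nat.zero_le M) y; simpa [Phi] using this
lemma br_mul_Phi (M N : ℕ) (y : X) : br ‖y‖ ^ M * Phi (M + N) y = Phi N y := by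
  rw [Phi_add, ← mul_assoc, Phi_mul, one_mul]
lemma measurable_br_norm : Measurable (fun y : X => br ‖y‖) := by
  unfold br; fun_prop
lemma measurable_Phi (M : ℕ) : Measurable (Phi M : X → ℝ≥0∞) := by
  unfold Phi; exact (measurable_br_norm.pow_const M).inv
lemma Phi_shift (M : ℕ) (y z : X) : Phi M y ≤ br ‖z‖ ^ M * Phi M (y + z) := by
  have h : br ‖y + z‖ ^ M ≤ br ‖z‖ ^ M * br ‖y‖ ^ M := by
    rw [← mul_pow]
    apply pow_le_pow_left₀ (by positivity)
    rw [mul_comm]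
    exact (br_mono (norm_add_le y z)).trans (br_add_le (norm_nonneg _) (norm_nonneg _))
  calc Phi M y = (br ‖y + z‖ ^ M * Phi M (y+z)) * Phi M y := by rw [Phi_mul, one_mul]
    _ ≤ (br ‖z‖ ^ M * br ‖y‖ ^ M * Phi M (y+z)) * Phi M y := by gcongr
    _ = br ‖z‖ ^ M * Phi M (y+z) * (br ‖y‖ ^ M * Phi M y) := by ring
    _ = _ := by rw [Phi_mul, mul_one]
lemma Phi_neg (M : ℕ) (y : X) : Phi M (-y) = Phi M y := by simp [Phi]

/-- integral of Phi -/
lemma lintegral_Phi_ne_top {M : ℕ} (hM : Module.finrank ℝ X + 1 ≤ M) :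
    ∫⁻ y : X, Phi M y ≠ ∞ := by
  have h : ∀ y : X, Phi M y = ENNReal.ofReal ((1 + ‖y‖) ^ (-(M:ℝ))) := by
    intro y
    unfold Phi br
    rw [Real.rpow_neg (by positivity), Real.rpow_natCast,
      ENNReal.ofReal_inv_of_pos (by positivity), ENNReal.ofReal_pow (by positivity)]
  simp_rw [h]
  refine (finite_integral_one_add_norm ?_).ne
  exact_mod_cast hM
lemma lintegral_Phi_ne_zero (M : ℕ) : ∫⁻ y : X, Phi M y ≠ 0 := by
  intro h
  rw [lintegral_eq_zero_iff (measurable_Phi M)] at h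
  have h2 : (volume : Measure X) Set.univ = 0 := by
    have : ∀ᵐ y : X, False := by
      filter_upwards [h] with y hy using Phi_ne_zero M y hy
    simpa [ae_iff] using this
  exact (NeZero.ne (volume : Measure X)) (Measure.measure_univ_eq_zero.1 h2)

/-- weighted average along a linear map -/
def avg (M : ℕ) (T : X →L[ℝ] X) (u : X → ℝ≥0∞) (x : X) : ℝ≥0∞ := ∫⁻ y, u (x + T y) * Phi M y

lemma measurable_avg (M : ℕ) (T : X →L[ℝ] X) {u : X → ℝ≥0∞} (hu : Measurable u) :
    Measurable (avg M T u) := by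
  unfold avg
  apply Measurable.lintegral_prod_right' (f := fun z : X × X => u (z.1 + T z.2) * Phi M z.2)
  have := measurable_Phi (X := X) M
  fun_prop

lemma avg_mono (M : ℕ) (T : X →L[ℝ] X) {u v : X → ℝ≥0∞} (h : ∀ x, u x ≤ v x) (x : X) :
    avg M T u x ≤ avg M T v x := lintegral_mono fun y => by gcongr; exact h _

lemma avg_anti {M N : ℕ} (hMN : M ≤ N) (T : X →L[ℝ] X) (u : X → ℝ≥0∞) (x : X) :
    avg N T u x ≤ avg M T u x := lintegral_mono fun y => by gcongr; exact Phi_anti hMN y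

lemma avg_const_mul (M : ℕ) (T : X →L[ℝ] X) {u : X → ℝ≥0∞} (hu : Measurable u) (c : ℝ≥0∞) (x : X) :
    avg M T (fun x => c * u x) x = c * avg M T u x := by
  unfold avg
  simp_rw [mul_assoc]
  rw [lintegral_const_mul]
  exact (hu.comp (by fun_prop)).mul (measurable_Phi M)

lemma avg_sum {ι : Type*} (s : Finset ι) (M : ℕ) (T : X →L[ℝ] X) {u : ι → X → ℝ≥0∞}
    (hu : ∀ i, Measurable (u i)) (x : X) :
    avg M T (fun x => ∑ i ∈ s, u i x) x = ∑ i ∈ s, avg M T (u i) x := by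
  unfold avg
  simp_rw [Finset.sum_mul]
  rw [lintegral_finsetSum]
  intro i _
  exact ((hu i).comp (by fun_prop)).mul (measurable_Phi M)

/-- Harnack property -/
def Harn (K : ℝ≥0∞) (M : ℕ) (T : X →L[ℝ] X) (H : X → ℝ≥0∞) : Prop :=
  ∀ x y, H (x + T y) ≤ K * br ‖y‖ ^ M * H x

lemma avg_harn (M : ℕ) (T : X →L[ℝ] X) {u : X → ℝ≥0∞} (hu : Measurable u) : Harn 1 M T (avg M T u) := by
  intro x v
  unfold avg
  have h1 : ∫⁻ y, u (x + T v + T y) * Phi M y = ∫⁻ y, u (x + T y) * Phi M (y - v) := by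
    rw [← lintegral_add_right_eq_self (fun y => u (x + T y) * Phi M (y - v)) v]
    congr 1; ext y
    simp [add_assoc, add_comm (T v)]
  rw [h1, one_mul, ← lintegral_const_mul]
  · apply lintegral_mono; intro y
    have := Phi_shift M (y - v) v
    simp only [sub_add_cancel] at this
    calc u (x + T y) * Phi M (y - v) ≤ u (x + T y) * (br ‖v‖ ^ M * Phi M y) := by gcongr
      _ = _ := by ring
  · exact (hu.comp (by fun_prop)).mul (measurable_Phi M)

lemma Harn.comp {K : ℝ≥0∞} {M : ℕ} {T : X →L[ℝ] X} {H : X → ℝ≥0∞} (h : Harn K M T H)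
    (R : X →L[ℝ] X) {A : ℝ} (hR : ‖R‖ ≤ A) :
    Harn (K * ENNReal.ofReal (max 1 A) ^ M) M (T.comp R) H := by
  intro x y
  refine (h x (R y)).trans ?_
  have : br ‖R y‖ ≤ ENNReal.ofReal (max 1 A) * br ‖y‖ :=
    (br_mono ((R.le_opNorm y).trans (by gcongr))).trans (br_mul_le (norm_nonneg _))
  calc K * br ‖R y‖ ^ M * H x ≤ K * (ENNReal.ofReal (max 1 A) * br ‖y‖) ^ M * H x := by gcongr
    _ = _ := by rw [mul_pow]; ring

lemma Harn.avg_le {K : ℝ≥0∞} {M : ℕ} {T : X →L[ℝ] X} {H : X → ℝ≥0∞} (h : Harn K M T H)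
    (N : ℕ) (x : X) : avg (M + N) T H x ≤ K * (∫⁻ y : X, Phi N y) * H x := by
  unfold avg
  calc ∫⁻ y, H (x + T y) * Phi (M + N) y ≤ ∫⁻ y, K * H x * Phi N y := by
        apply lintegral_mono; intro y
        calc H (x + T y) * Phi (M + N) y ≤ (K * br ‖y‖ ^ M * H x) * Phi (M + N) y := by
              gcongr; exact h x y
          _ = K * H x * (br ‖y‖ ^ M * Phi (M + N) y) := by ring
          _ = _ := by rw [br_mul_Phi]
    _ = _ := by rw [lintegral_const_mul _ (measurable_Phi N)]; ring

lemma Harn.le_avg {K : ℝ≥0∞} {M : ℕ} {T : X →L[ℝ] X} {H : X → ℝ≥0∞} (h : Harn K M T H)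
    (hK : K ≠ ∞) (N : ℕ) (x : X) : (∫⁻ y : X, Phi (M + N) y) * H x ≤ K * avg N T H x := by
  unfold avg
  rw [← lintegral_mul_const _ (measurable_Phi _), ← lintegral_const_mul' _ _ hK]
  apply lintegral_mono; intro y
  have := h (x + T y) (-y)
  simp only [map_neg, add_neg_cancel_right, norm_neg] at this
  calc Phi (M + N) y * H x ≤ Phi (M + N) y * (K * br ‖y‖ ^ M * H (x + T y)) := by gcongr
    _ = K * H (x + T y) * (br ‖y‖ ^ M * Phi (M + N) y) := by ring
    _ = _ := by rw [br_mul_Phi]; ring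


lemma absorb {M N : ℕ} (T R : X →L[ℝ] X) {A : ℝ} (hR : ‖R‖ ≤ A) {u : X → ℝ≥0∞} (hu : Measurable u) (x : X) :
    avg (M + N) (T.comp R) (avg M T u) x ≤
      ENNReal.ofReal (max 1 A) ^ M * (∫⁻ y : X, Phi N y) * avg M T u x := by
  simpa using ((avg_harn M T hu).comp R hR).avg_le N x

lemma avg_comm {M N : ℕ} (T R : X →L[ℝ] X) {u : X → ℝ≥0∞} (hu : Measurable u) (x : X) :
    avg M T (avg N R u) x = avg N R (avg M T u) x := by
  unfold avg
  have hm := measurable_Phi (X := X) M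
  have hn := measurable_Phi (X := X) N
  have e1 : ∀ y : X, (∫⁻ z, u (x + T y + R z) * Phi N z) * Phi M y
      = ∫⁻ z, u (x + T y + R z) * Phi N z * Phi M y := by
    intro y; rw [lintegral_mul_const]; fun_prop
  have e2 : ∀ y : X, (∫⁻ z, u (x + R y + T z) * Phi M z) * Phi N y
      = ∫⁻ z, u (x + R y + T z) * Phi M z * Phi N y := by
    intro y; rw [lintegral_mul_const]; fun_prop
  simp_rw [e1, e2]
  rw [lintegral_lintegral_swap]
  · congr 1; ext y; congr 1; ext z
    rw [add_right_comm x (T z) (R y)]; ring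
  · apply Measurable.aemeasurable
    show Measurable (fun p : X × X => u (x + T p.1 + R p.2) * Phi N p.2 * Phi M p.1)
    fun_prop

/-- weight class -/
def Wt (E : ℕ) (κ : ℝ) (Ω : X → ℝ≥0∞) : Prop :=
  Measurable Ω ∧ ∀ x y, Ω (x + y) ≤ br (κ * ‖y‖) ^ E * Ω x

lemma Wt.harn {E : ℕ} {κ : ℝ} {Ω : X → ℝ≥0∞} (h : Wt E κ Ω) (hκ : 0 ≤ κ) (T : X →L[ℝ] X) {A : ℝ}
    (hT : κ * ‖T‖ ≤ A) : Harn (ENNReal.ofReal (max 1 A) ^ E) E T Ω := by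
  intro x y
  refine (h.2 x (T y)).trans ?_
  rw [← mul_pow]
  gcongr
  refine (br_mono ?_).trans (br_mul_le (a := A) (norm_nonneg _))
  calc κ * ‖T y‖ ≤ κ * (‖T‖ * ‖y‖) := by gcongr; exact T.le_opNorm y
    _ = (κ * ‖T‖) * ‖y‖ := by ring
    _ ≤ A * ‖y‖ := by gcongr

lemma avg_dual (M : ℕ) (T : X →L[ℝ] X) {u Ω : X → ℝ≥0∞} (hu : Measurable u) (hΩ : Measurable Ω) :
    ∫⁻ x, avg M T u x * Ω x = ∫⁻ x, u x * avg M (-T) Ω x := by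
  unfold avg
  have hm := measurable_Phi (X := X) M
  have e1 : ∀ x : X, (∫⁻ z, u (x + T z) * Phi M z) * Ω x
      = ∫⁻ z, u (x + T z) * Phi M z * Ω x := by
    intro y; rw [lintegral_mul_const]; fun_prop
  have e2 : ∀ x : X, u x * (∫⁻ z, Ω (x + (-T) z) * Phi M z)
      = ∫⁻ z, u x * (Ω (x + (-T) z) * Phi M z) := by
    intro y; rw [lintegral_const_mul]; fun_prop
  simp_rw [e1, e2]
  rw [lintegral_lintegral_swap (f := fun x z => u (x + T z) * Phi M z * Ω x),
    lintegral_lintegral_swap (f := fun x z => u x * (Ω (x + (-T) z) * Phi M z))]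
  · congr 1; ext z
    rw [← lintegral_add_right_eq_self (fun x => u x * (Ω (x + (-T) z) * Phi M z)) (T z)]
    congr 1; ext x
    simp only [ContinuousLinearMap.neg_apply, add_neg_cancel_right]
    ring
  · apply Measurable.aemeasurable
    show Measurable (fun p : X × X => u p.1 * (Ω (p.1 + (-T) p.2) * Phi M p.2))
    fun_prop
  · apply Measurable.aemeasurable
    show Measurable (fun p : X × X => u (p.1 + T p.2) * Phi M p.2 * Ω p.1)
    fun_prop

lemma Wt.avg_le {E : ℕ} {κ : ℝ} {Ω : X → ℝ≥0∞} (h : Wt E κ Ω) (hκ : 0 ≤ κ) (N : ℕ) (T : X →L[ℝ] X) {A : ℝ}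
    (hT : κ * ‖T‖ ≤ A) {u : X → ℝ≥0∞} (hu : Measurable u) :
    ∫⁻ x, avg (E + N) T u x * Ω x ≤
      ENNReal.ofReal (max 1 A) ^ E * (∫⁻ y : X, Phi N y) * ∫⁻ x, u x * Ω x := by
  rw [avg_dual _ _ hu h.1, ← lintegral_const_mul _ (f := fun x => u x * Ω x) (hu.mul h.1)]
  apply lintegral_mono; intro x
  have := (h.harn hκ (-T) (A := A) (by simpa using hT)).avg_le N x
  calc u x * avg (E + N) (-T) Ω x ≤ u x * (ENNReal.ofReal (max 1 A) ^ E * (∫⁻ y : X, Phi N y) * Ω x) := by gcongr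
    _ = _ := by ring

lemma Wt.le_avg {E : ℕ} {κ : ℝ} {Ω : X → ℝ≥0∞} (h : Wt E κ Ω) (hκ : 0 ≤ κ) (N : ℕ) (T : X →L[ℝ] X) {A : ℝ}
    (hT : κ * ‖T‖ ≤ A) {u : X → ℝ≥0∞} (hu : Measurable u) :
    (∫⁻ y : X, Phi (E + N) y) * ∫⁻ x, u x * Ω x ≤
      ENNReal.ofReal (max 1 A) ^ E * ∫⁻ x, avg N T u x * Ω x := by
  rw [avg_dual _ _ hu h.1, ← lintegral_const_mul _ (f := fun x => u x * Ω x) (hu.mul h.1),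
    ← lintegral_const_mul _ (f := fun x => u x * avg N (-T) Ω x) (hu.mul (measurable_avg _ _ h.1))]
  apply lintegral_mono; intro x
  have := (h.harn hκ (-T) (A := A) (by simpa using hT)).le_avg (by simp) N x
  calc (∫⁻ y : X, Phi (E + N) y) * (u x * Ω x) = u x * ((∫⁻ y : X, Phi (E + N) y) * Ω x) := by ring
    _ ≤ u x * (ENNReal.ofReal (max 1 A) ^ E * avg N (-T) Ω x) := by gcongr
    _ = _ := by ring

/-- Hölder/Jensen for avg -/
lemma avg_holder (M : ℕ) (T : X →L[ℝ] X) {u v : X → ℝ≥0∞} (hu : Measurable u) (hv : Measurable v)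
    {a b : ℝ} (ha : 0 < a) (hb : 0 < b) (hab : a + b = 1) (x : X) :
    avg M T (fun x => u x ^ a * v x ^ b) x ≤ avg M T u x ^ a * avg M T v x ^ b := by
  unfold avg
  have hm := measurable_Phi (X := X) M
  have key := ENNReal.lintegral_mul_norm_pow_le (μ := (volume : Measure X))
    (f := fun y => u (x + T y) * Phi M y) (g := fun y => v (x + T y) * Phi M y)
    (by fun_prop) (by fun_prop) ha.le hb.le hab
  refine le_trans (le_of_eq ?_) key
  congr 1; ext y
  rw [ENNReal.mul_rpow_of_nonneg _ _ ha.le, ENNReal.mul_rpow_of_nonneg _ _ hb.le]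
  have : Phi M y = Phi M y ^ a * Phi M y ^ b := by
    rw [← ENNReal.rpow_add_of_nonneg _ _ ha.le hb.le, hab, ENNReal.rpow_one]
  conv_lhs => rw [this]
  ring

lemma avg_one (M : ℕ) (T : X →L[ℝ] X) (x : X) : avg M T (fun _ => 1) x = ∫⁻ y : X, Phi M y := by
  simp [avg]

lemma avg_jensen (M : ℕ) (T : X →L[ℝ] X) {u : X → ℝ≥0∞} (hu : Measurable u)
    {a : ℝ} (ha : 0 < a) (ha1 : a ≤ 1) (x : X) :
    avg M T (fun x => u x ^ a) x ≤ (∫⁻ y : X, Phi M y) ^ (1 - a) * avg M T u x ^ a := by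
  rcases eq_or_lt_of_le ha1 with rfl | h
  · simp
  · have := avg_holder M T hu (measurable_const (a := (1 : ℝ≥0∞))) ha (sub_pos.2 h) (by ring) x
    rw [avg_one] at this
    simpa [mul_comm] using this

lemma minkowski {α ι : Type*} [MeasurableSpace α] (μ : Measure α) (s : Finset ι) {g : ι → α → ℝ≥0∞}
    (hg : ∀ i, Measurable (g i)) {w : α → ℝ≥0∞} (hw : Measurable w) {r : ℝ} (hr : 1 ≤ r) :
    (∫⁻ x, (∑ i ∈ s, g i x) ^ r * w x ∂μ) ^ (1 / r) ≤ ∑ i ∈ s, (∫⁻ x, g i x ^ r * w x ∂μ) ^ (1 / r) := by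
  have e : ∀ f : α → ℝ≥0∞, Measurable f → ∫⁻ x, f x ^ r * w x ∂μ = ∫⁻ x, f x ^ r ∂(μ.withDensity w) := by
    intro f hf
    rw [lintegral_withDensity_eq_lintegral_mul _ hw (hf.pow_const r)]
    simp only [Pi.mul_apply, mul_comm]
  rw [e _ (Finset.measurable_fun_sum _ fun i _ => hg i)]
  simp_rw [fun i => e _ (hg i)]
  classical
  induction s using Finset.induction_on with
  | empty =>
    have : 0 < r := by linarith
    simp [ENNReal.zero_rpow_of_pos this]
    linarith
  | insert a s ha ih =>
    simp_rw [Finset.sum_insert ha]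
    refine le_trans ?_ (add_le_add_right ih _)
    exact ENNReal.lintegral_Lp_add_le (hg a).aemeasurable
      (Finset.measurable_fun_sum _ fun i _ => hg i).aemeasurable hr

lemma minkowski' {α ι : Type*} [MeasurableSpace α] (μ : Measure α) (s : Finset ι) {u : ι → α → ℝ≥0∞}
    (hu : ∀ i, Measurable (u i)) {w : α → ℝ≥0∞} (hw : Measurable w) {r : ℝ} (hr : 1 ≤ r) :
    ∫⁻ x, (∑ i ∈ s, u i x ^ (1 / r)) ^ r * w x ∂μ ≤ (∑ i ∈ s, (∫⁻ x, u i x * w x ∂μ) ^ (1 / r)) ^ r := by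
  have hr0 : 0 < r := by linarith
  have := minkowski μ s (g := fun i x => u i x ^ (1 / r)) (fun i => (hu i).pow_const _) hw hr
  have e : ∀ i x, (u i x ^ (1 / r)) ^ r = u i x := fun i x => by
    rw [← ENNReal.rpow_mul, one_div, inv_mul_cancel₀ hr0.ne', ENNReal.rpow_one]
  simp_rw [e] at this
  calc _ = ((∫⁻ x, (∑ i ∈ s, u i x ^ (1 / r)) ^ r * w x ∂μ) ^ (1 / r)) ^ r := by
        rw [← ENNReal.rpow_mul, one_div, inv_mul_cancel₀ hr0.ne', ENNReal.rpow_one]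
    _ ≤ _ := by gcongr

lemma change_var {Y : Type*} [NormedAddCommGroup Y] [NormedSpace ℝ Y] [FiniteDimensional ℝ Y]
  [MeasureSpace Y] [BorelSpace Y] [(volume : Measure Y).IsAddHaarMeasure] (T : X ≃L[ℝ] Y) :
    ∃ c : ℝ≥0∞, c ≠ 0 ∧ c ≠ ∞ ∧ ∀ f : Y → ℝ≥0∞, ∫⁻ x, f (T x) = c * ∫⁻ y, f y := by
  have h1 := T.isAddHaarMeasure_map (volume : Measure X)
  have hc := Measure.isAddLeftInvariant_eq_smul (Measure.map T (volume : Measure X)) (volume : Measure Y)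
  have hp : 0 < Measure.addHaarScalarFactor (Measure.map T (volume : Measure X)) (volume : Measure Y) :=
    Measure.addHaarScalarFactor_pos_of_isAddHaarMeasure _ _
  generalize Measure.addHaarScalarFactor (Measure.map T (volume : Measure X)) (volume : Measure Y) = c at hc hp
  refine ⟨c, by simpa using hp.ne', by simp, fun f => ?_⟩
  have := lintegral_map_equiv (μ := (volume : Measure X)) f (T.toHomeomorph.toMeasurableEquiv)
  have e : ((T.toHomeomorph.toMeasurableEquiv : X ≃ᵐ Y) : X → Y) = T := rfl
  rw [e] at this
  rw [← this, hc, lintegral_smul_measure]; rfl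

/-- regularised weight -/
def reg (E : ℕ) (κ : ℝ) (Ω : X → ℝ≥0∞) (x : X) : ℝ≥0∞ := ⨆ y, Ω y * (br (κ * ‖x - y‖) ^ E)⁻¹

lemma le_reg (E : ℕ) (κ : ℝ) (Ω : X → ℝ≥0∞) (x : X) : Ω x ≤ reg E κ Ω x := by
  refine le_trans ?_ (le_iSup _ x)
  simp [br]

lemma reg_le {E : ℕ} {κ : ℝ} (hκ : 0 ≤ κ) {Ω : X → ℝ≥0∞} {A : ℝ≥0∞}
    (h : ∀ x y, Ω (x + y) ≤ A * br (κ * ‖y‖) ^ E * Ω x) (x : X) : reg E κ Ω x ≤ A * Ω x := by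
  refine iSup_le fun y => ?_
  have h1 := h x (y - x)
  rw [add_sub_cancel, norm_sub_rev] at h1
  have h0 : br (κ * ‖x - y‖) ^ E ≠ 0 := pow_ne_zero _ (br_ne_zero (by positivity))
  calc Ω y * (br (κ * ‖x - y‖) ^ E)⁻¹ ≤ (A * br (κ * ‖x - y‖) ^ E * Ω x) * (br (κ * ‖x - y‖) ^ E)⁻¹ := by gcongr
    _ = A * Ω x * (br (κ * ‖x - y‖) ^ E * (br (κ * ‖x - y‖) ^ E)⁻¹) := by ring
    _ = _ := by rw [ENNReal.mul_inv_cancel h0 (brn_ne_top _ _), mul_one]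

lemma continuous_br {f : X → ℝ} (hf : Continuous f) : Continuous (fun x => br (f x)) := by
  unfold br; exact ENNReal.continuous_ofReal.comp (by fun_prop)

lemma reg_wt {E : ℕ} {κ : ℝ} (hκ : 0 ≤ κ) (Ω : X → ℝ≥0∞) : Wt E κ (reg E κ Ω) := by
  constructor
  · apply LowerSemicontinuous.measurable
    apply lowerSemicontinuous_iSup
    intro y
    apply Continuous.lowerSemicontinuous
    rw [continuous_iff_continuousAt]
    intro x
    apply ENNReal.Tendsto.const_mul
    · have : Continuous fun x : X => (br (κ * ‖x - y‖) ^ E)⁻¹ :=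
        (ENNReal.continuous_pow E |>.comp (continuous_br (by fun_prop))).inv
      exact this.continuousAt
    · left; exact ENNReal.inv_ne_zero.2 (brn_ne_top _ _)
  · intro x z
    refine iSup_le fun y => ?_
    have h2 : br (κ * ‖x - y‖) ≤ br (κ * ‖x + z - y‖) * br (κ * ‖z‖) := by
      refine (br_mono ?_).trans (br_add_le (by positivity) (by positivity))
      rw [← mul_add]; gcongr
      calc ‖x - y‖ = ‖(x + z - y) - z‖ := by congr 1; abel
        _ ≤ _ := norm_sub_le _ _
    have h0 : br (κ * ‖x + z - y‖) ^ E ≠ 0 := pow_ne_zero _ (br_ne_zero (by positivity))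
    have h0' : br (κ * ‖z‖) ^ E ≠ 0 := pow_ne_zero _ (br_ne_zero (by positivity))
    have h3 : (br (κ * ‖x + z - y‖) ^ E)⁻¹ ≤ br (κ * ‖z‖) ^ E * (br (κ * ‖x - y‖) ^ E)⁻¹ := by
      have : (br (κ * ‖x + z - y‖) ^ E * br (κ * ‖z‖) ^ E)⁻¹ ≤ (br (κ * ‖x - y‖) ^ E)⁻¹ := by
        apply ENNReal.inv_le_inv.2
        rw [← mul_pow]; gcongr
      rw [ENNReal.mul_inv (Or.inl h0) (Or.inl (brn_ne_top _ _))] at this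
      calc (br (κ * ‖x + z - y‖) ^ E)⁻¹ = br (κ * ‖z‖) ^ E * ((br (κ * ‖x + z - y‖) ^ E)⁻¹ * (br (κ * ‖z‖) ^ E)⁻¹) := by
            rw [mul_left_comm, ENNReal.mul_inv_cancel h0' (brn_ne_top _ _), mul_one]
        _ ≤ _ := by gcongr
    calc Ω y * (br (κ * ‖x + z - y‖) ^ E)⁻¹ ≤ Ω y * (br (κ * ‖z‖) ^ E * (br (κ * ‖x - y‖) ^ E)⁻¹) := by gcongr
      _ = br (κ * ‖z‖) ^ E * (Ω y * (br (κ * ‖x - y‖) ^ E)⁻¹) := by ring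
      _ ≤ _ := by gcongr; exact le_iSup (fun y => Ω y * (br (κ * ‖x - y‖) ^ E)⁻¹) y

end
end Dcp

end


section
open MeasureTheory Real
open scoped RealInnerProductSpace ENNReal NNReal FourierTransform SchwartzMap

set_option linter.all false
namespace Dcp

section
variable {W : Type*} [NormedAddCommGroup W] [InnerProductSpace ℝ W] [FiniteDimensional ℝ W]
  [MeasurableSpace W] [BorelSpace W]

lemma schwartz_decay (f : 𝓢(W, ℂ)) (M : ℕ) : ∃ C : ℝ≥0, ∀ x, ‖f x‖ₑ ≤ C * Phi M x := by
  have h := SchwartzMap.one_add_le_sup_seminorm_apply (𝕜 := ℝ) (m := (M, 0)) le_rfl le_rfl f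
  set K := 2 ^ (M, 0).1 * (Finset.Iic (M, 0)).sup (fun m => SchwartzMap.seminorm ℝ m.1 m.2) f
  refine ⟨K.toNNReal, fun x => ?_⟩
  have h1 := h x
  simp only [norm_iteratedFDeriv_zero] at h1
  have h2 : br ‖x‖ ^ M * ‖f x‖ₑ ≤ K.toNNReal := by
    rw [← ofReal_norm_eq_enorm, br, ← ENNReal.ofReal_pow (by positivity), ← ENNReal.ofReal_mul (by positivity)]
    exact ENNReal.ofReal_le_ofReal h1
  calc ‖f x‖ₑ = (br ‖x‖ ^ M * Phi M x) * ‖f x‖ₑ := by rw [Phi_mul, one_mul]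
    _ = (br ‖x‖ ^ M * ‖f x‖ₑ) * Phi M x := by ring
    _ ≤ _ := by gcongr

/-- bump as Schwartz -/
def bump (c : W) (a b : ℝ) (ha : 0 < a) (hab : a < b) : 𝓢(W, ℂ) :=
  HasCompactSupport.toSchwartzMap (f := fun x => (((⟨a, b, ha, hab⟩ : ContDiffBump c) x : ℝ) : ℂ))
    ((⟨a, b, ha, hab⟩ : ContDiffBump c).hasCompactSupport.comp_left (g := fun t : ℝ => (t:ℂ)) (by simp))
    (Complex.ofRealCLM.contDiff.comp (⟨a, b, ha, hab⟩ : ContDiffBump c).contDiff)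

lemma bump_apply (c : W) (a b : ℝ) (ha : 0 < a) (hab : a < b) (x : W) :
    bump c a b ha hab x = (((⟨a, b, ha, hab⟩ : ContDiffBump c) x : ℝ) : ℂ) := rfl

/-- reproducing kernel -/
lemma exists_repr (A : ℝ) (hA : 0 < A) : ∃ k : 𝓢(W, ℂ), ∀ ω : W, ‖ω‖ ≤ A → ∫ y, k y * ee ⟪y, ω⟫ = 1 := by
  let b := bump (0 : W) A (A+1) hA (by linarith)
  refine ⟨𝓕 b, fun ω hω => ?_⟩
  have h : (𝓕⁻ (𝓕 b)) ω = b ω := by rw [FourierTransform.fourierInv_fourier_eq]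
  rw [SchwartzMap.fourierInv_coe, Real.fourierInv_eq'] at h
  have hb : b ω = 1 := by
    show bump (0 : W) A (A+1) hA _ ω = 1
    rw [bump_apply, ContDiffBump.one_of_mem_closedBall]
    · simp
    · simpa using hω
  rw [hb] at h
  rw [← h]
  congr 1; ext y
  rw [smul_eq_mul, mul_comm]
  congr 1
  unfold ee; congr 1
  push_cast; ring

lemma exists_orth : ∃ f : 𝓢(W, ℂ), f 0 ≠ 0 ∧
    ∀ ω : W, 1 ≤ ‖ω‖ → ∫ y, f y * (starRingEnd ℂ) (f y) * ee ⟪y, ω⟫ = 0 := by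
  let b := fun c : W => bump c (1/4) (1/2) (by norm_num) (by norm_num)
  have hbc : ∀ c x, b c x = b 0 (x - c) := by
    intro c x
    show bump c _ _ _ _ x = bump 0 _ _ _ _ (x - c)
    rw [bump_apply, bump_apply]
    simp [ContDiffBump.apply]
  refine ⟨𝓕 (b 0), ?_, fun ω hω => ?_⟩
  · rw [SchwartzMap.fourier_coe, Real.fourier_eq]
    simp only [inner_zero_right, neg_zero, AddChar.map_zero_eq_one, one_smul]
    have : ∫ v, (b 0) v = ((∫ v, (⟨1/4, 1/2, by norm_num, by norm_num⟩ : ContDiffBump (0:W)) v : ℝ) : ℂ) := by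
      rw [← integral_complex_ofReal]; rfl
    rw [this]
    exact_mod_cast (ContDiffBump.integral_pos _).ne'
  · have h1 : ∀ y, (𝓕 (b (-ω))) y = ee ⟪y, ω⟫ * (𝓕 (b 0)) y := by
      intro y
      rw [SchwartzMap.fourier_coe, SchwartzMap.fourier_coe, Real.fourier_eq', Real.fourier_eq',
        ← integral_const_mul, ← integral_add_right_eq_self _ (-ω)]
      congr 1; ext v
      rw [hbc, smul_eq_mul, smul_eq_mul, ← mul_assoc]
      simp only [add_sub_cancel_right, ee]
      rw [← Complex.exp_add]
      congr 2
      simp only [inner_add_left, inner_neg_left, real_inner_comm]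
      push_cast; ring
    have h2 := SchwartzMap.integral_inner_fourier_fourier (b 0) (b (-ω))
    have h3 : ∫ x, inner ℂ ((b 0) x) ((b (-ω)) x) = 0 := by
      rw [← integral_zero W ℂ]
      congr 1; ext x
      by_cases hx : ‖x‖ < 1/2
      · have : (b (-ω)) x = 0 := by
          show bump _ _ _ _ _ x = 0
          rw [bump_apply, ContDiffBump.zero_of_le_dist]; · simp
          simp only [dist_eq_norm, sub_neg_eq_add]
          have := norm_sub_le (x + ω) x
          simp at this
          linarith
        simp [this]
      · have : (b 0) x = 0 := by
          show bump _ _ _ _ _ x = 0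
          rw [bump_apply, ContDiffBump.zero_of_le_dist]; · simp
          simp only [dist_zero_right]
          linarith
        simp [this]
    rw [h3] at h2
    rw [← h2]
    congr 1; ext y
    rw [h1, RCLike.inner_apply]; ring

end
section

abbrev V (d : ℕ) := EuclideanSpace ℝ (Fin d)
abbrev X (d : ℕ) := V d × ℝ

instance (d : ℕ) : (volume : Measure (X d)).IsAddHaarMeasure :=
  inferInstanceAs ((volume : Measure (V d)).prod (volume : Measure ℝ)).IsAddHaarMeasure

lemma finrank_X (d : ℕ) : Module.finrank ℝ (X d) = d + 1 := by simp

variable {d : ℕ}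

def ph (x ω : X d) : ℝ := ⟪x.1, ω.1⟫ + x.2 * ω.2
def chr (ω x : X d) : ℂ := ee (ph x ω)
def ES (S : Set (X d)) : Submodule ℂ (X d → ℂ) := Submodule.span ℂ (chr '' S)

lemma ee_add (s t : ℝ) : ee (s + t) = ee s * ee t := by
  unfold ee; rw [← Complex.exp_add]; congr 1; push_cast; ring
lemma norm_ee (t : ℝ) : ‖ee t‖ = 1 := by
  unfold ee
  have : (2 * π * Complex.I * t : ℂ) = ((2 * π * t : ℝ) : ℂ) * Complex.I := by push_cast; ring
  rw [this, Complex.norm_exp_ofReal_mul_I]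
lemma conj_ee (t : ℝ) : (starRingEnd ℂ) (ee t) = ee (-t) := by
  unfold ee; rw [← Complex.exp_conj]; congr 1; simp [map_ofNat]
lemma continuous_ee : Continuous ee := by unfold ee; fun_prop
lemma ph_add_left (x y ω : X d) : ph (x + y) ω = ph x ω + ph y ω := by
  simp [ph, inner_add_left]; ring
lemma ph_add_right (x y ω : X d) : ph ω (x + y) = ph ω x + ph ω y := by
  simp [ph, inner_add_right]; ring
lemma ph_smul_left (a : ℝ) (x ω : X d) : ph (a • x) ω = a * ph x ω := by
  simp [ph, inner_smul_left]; ring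
lemma ph_smul_right (a : ℝ) (x ω : X d) : ph x (a • ω) = a * ph x ω := by
  simp [ph, inner_smul_right]; ring
lemma ph_neg_right (x ω : X d) : ph x (-ω) = - ph x ω := by
  simp [ph]; ring
lemma ph_sub_right (x y ω : X d) : ph ω (x - y) = ph ω x - ph ω y := by
  rw [sub_eq_add_neg, ph_add_right, ph_neg_right]; ring
lemma continuous_ph (ω : X d) : Continuous fun x => ph x ω := by unfold ph; fun_prop
lemma continuous_chr (ω : X d) : Continuous (chr ω) := continuous_ee.comp (continuous_ph ω)
lemma norm_chr (ω x : X d) : ‖chr ω x‖ = 1 := norm_ee _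

lemma ES_mono {S S' : Set (X d)} (h : S ⊆ S') : ES S ≤ ES S' := Submodule.span_mono (Set.image_mono h)
lemma ES_cont {S : Set (X d)} {F : X d → ℂ} (hF : F ∈ ES S) : Continuous F := by
  induction hF using Submodule.span_induction with
  | mem x h => obtain ⟨ω, -, rfl⟩ := h; exact continuous_chr ω
  | zero => exact continuous_const
  | add x y _ _ hx hy => exact hx.add hy
  | smul a x _ hx => exact hx.const_smul a
lemma ES_bdd {S : Set (X d)} {F : X d → ℂ} (hF : F ∈ ES S) : ∃ B : ℝ, ∀ x, ‖F x‖ ≤ B := by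
  induction hF using Submodule.span_induction with
  | mem x h => obtain ⟨ω, -, rfl⟩ := h; exact ⟨1, fun x => (norm_chr ω x).le⟩
  | zero => exact ⟨0, by simp⟩
  | add x y _ _ hx hy =>
    obtain ⟨a, ha⟩ := hx; obtain ⟨b, hb⟩ := hy
    exact ⟨a + b, fun z => (norm_add_le _ _).trans (add_le_add (ha z) (hb z))⟩
  | smul a x _ hx =>
    obtain ⟨b, hb⟩ := hx
    exact ⟨‖a‖ * b, fun z => by simp [norm_smul]; gcongr; exact hb z⟩
lemma ES_meas {S : Set (X d)} {F : X d → ℂ} (hF : F ∈ ES S) (q : ℝ) :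
    Measurable (fun x => ‖F x‖ₑ ^ q) := (ES_cont hF).measurable.enorm.pow_const q

lemma Phi_prod (M : ℕ) (y : X d) : Phi M y.1 * Phi M y.2 ≤ Phi M y := by
  unfold Phi
  rw [← ENNReal.mul_inv (Or.inl (brn_ne_zero M _)) (Or.inl (brn_ne_top M _))]
  apply ENNReal.inv_le_inv.2
  rw [← mul_pow]
  gcongr
  refine (br_mono ?_).trans (br_add_le (norm_nonneg _) (norm_nonneg _))
  rw [Prod.norm_def]
  exact max_le (by linarith [norm_nonneg y.2]) (by linarith [norm_nonneg y.1])

/-- reproducing kernel on X -/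
lemma exists_kernel (d : ℕ) (A : ℝ) : ∃ k : X d → ℂ, Continuous k ∧ (∀ M : ℕ, ∃ C : ℝ≥0, ∀ y, ‖k y‖ₑ ≤ C * Phi M y) ∧
    ∀ ω : X d, ‖ω‖ ≤ A → ∫ y, k y * chr ω y = 1 := by
  obtain ⟨k1, h1⟩ := exists_repr (W := V d) (max A 1) (by positivity)
  obtain ⟨k2, h2⟩ := exists_repr (W := ℝ) (max A 1) (by positivity)
  refine ⟨fun y => k1 y.1 * k2 y.2, ?_, ?_, ?_⟩
  · exact (k1.continuous.comp continuous_fst).mul (k2.continuous.comp continuous_snd)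
  · intro M
    obtain ⟨C1, hC1⟩ := schwartz_decay k1 M
    obtain ⟨C2, hC2⟩ := schwartz_decay k2 M
    refine ⟨C1 * C2, fun y => ?_⟩
    rw [enorm_mul]
    calc ‖k1 y.1‖ₑ * ‖k2 y.2‖ₑ ≤ (C1 * Phi M y.1) * (C2 * Phi M y.2) := mul_le_mul' (hC1 _) (hC2 _)
      _ = (C1 * C2) * (Phi M y.1 * Phi M y.2) := by ring
      _ ≤ _ := by push_cast; gcongr; exact Phi_prod M y
  · intro ω hω
    have e : ∀ y : X d, k1 y.1 * k2 y.2 * chr ω y = (k1 y.1 * ee ⟪y.1, ω.1⟫) * (k2 y.2 * ee ⟪y.2, ω.2⟫) := by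
      intro y
      unfold chr ph
      rw [ee_add]
      have : ⟪y.2, ω.2⟫ = y.2 * ω.2 := by simp [mul_comm]
      rw [this]; ring
    simp_rw [e]
    rw [show (volume : Measure (X d)) = (volume : Measure (V d)).prod (volume : Measure ℝ) from rfl,
      integral_prod_mul (fun y : V d => k1 y * ee ⟪y, ω.1⟫) (fun y : ℝ => k2 y * ee ⟪y, ω.2⟫), h1, h2, one_mul]
    · exact (norm_snd_le ω).trans (hω.trans (le_max_left _ _))
    · exact (norm_fst_le ω).trans (hω.trans (le_max_left _ _))

lemma integrable_of_decay {k : X d → ℂ} (hk : Continuous k) {C : ℝ≥0} (h : ∀ y, ‖k y‖ₑ ≤ C * Phi (d + 2) y)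
    {g : X d → ℂ} (hg : Continuous g) {B : ℝ} (hB : ∀ y, ‖g y‖ ≤ B) : Integrable (fun y => k y * g y) := by
  have hi : Integrable k := by
    refine ⟨hk.aestronglyMeasurable, ?_⟩
    unfold HasFiniteIntegral
    calc ∫⁻ y, ‖k y‖ₑ ≤ ∫⁻ y : X d, C * Phi (d + 2) y := lintegral_mono h
      _ < ∞ := by
        rw [lintegral_const_mul _ (measurable_Phi _)]
        exact ENNReal.mul_lt_top (by simp) (lintegral_Phi_ne_top (by rw [finrank_X])).lt_top
  exact hi.mul_bdd hg.aestronglyMeasurable (Filter.Eventually.of_forall hB)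

def LCond (T : X d →L[ℝ] X d) (S : Set (X d)) (A : ℝ) : Prop :=
  ∃ ω0 : X d, ∀ ω ∈ S, ∃ ω' : X d, ‖ω'‖ ≤ A ∧ ∀ y, ph (T y) (ω - ω0) = ph y ω'

lemma loc_const (d : ℕ) (A : ℝ) (M : ℕ) (hM : d + 2 ≤ M) {q : ℝ} (hq : 1 ≤ q) : ∃ C : ℝ≥0, ∀ (T : X d →L[ℝ] X d) (S : Set (X d)),
    LCond T S A → ∀ F ∈ ES S, ∀ x, ‖F x‖ₑ ^ q ≤ C * avg M T (fun x => ‖F x‖ₑ ^ q) x := by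
  obtain ⟨k, hkc, hkd, hk⟩ := exists_kernel d A
  obtain ⟨C, hC⟩ := hkd M
  obtain ⟨C', hC'⟩ := hkd (d + 2)
  have hq0 : 0 < q := by linarith
  have hI : ∫⁻ y : X d, Phi M y ≠ ∞ := lintegral_Phi_ne_top (by rw [finrank_X]; exact hM)
  refine ⟨(((C : ℝ≥0∞) * (∫⁻ y : X d, Phi M y) ^ (1 - 1/q)) ^ q).toNNReal, fun T S hS F hF x => ?_⟩
  obtain ⟨ω0, hω0⟩ := hS
  have hrep : ∀ x, F x = ∫ y, k y * (F (x + T y) * chr (-ω0) (T y)) := by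
    induction hF using Submodule.span_induction with
    | mem f h =>
      obtain ⟨ω, hω, rfl⟩ := h
      intro x
      obtain ⟨ω', h1, h2⟩ := hω0 ω hω
      have : ∀ y, k y * (chr ω (x + T y) * chr (-ω0) (T y)) = chr ω x * (k y * chr ω' y) := by
        intro y
        unfold chr
        rw [ph_add_left, ee_add, ← h2 y, ph_sub_right, sub_eq_add_neg, ee_add, ph_neg_right]; ring
      simp_rw [this]
      rw [integral_const_mul, hk ω' h1, mul_one]
    | zero => simp
    | add f g hf hg h1 h2 =>
      intro x
      simp only [Pi.add_apply]
      conv_lhs => rw [h1 x, h2 x]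
      have key : ∀ f ∈ ES S, Integrable (fun y => k y * (f (x + T y) * chr (-ω0) (T y))) := by
        intro f hf
        obtain ⟨B, hB⟩ := ES_bdd hf
        have hfc := ES_cont hf
        refine integrable_of_decay hkc hC' (B := B) ?_ ?_
        · exact (hfc.comp (by fun_prop)).mul ((continuous_chr _).comp T.continuous)
        · intro y; rw [norm_mul, norm_chr, mul_one]; exact hB _
      rw [← integral_add (key f hf) (key g hg)]
      congr 1; ext y; ring
    | smul a f hf h1 =>
      intro x
      simp only [Pi.smul_apply, smul_eq_mul]
      conv_lhs => rw [h1 x]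
      rw [← integral_const_mul]
      congr 1; ext y; ring
  have h1 : ‖F x‖ₑ ≤ C * avg M T (fun x => ‖F x‖ₑ) x := by
    conv_lhs => rw [hrep x]
    refine (enorm_integral_le_lintegral_enorm _).trans ?_
    unfold avg
    rw [← lintegral_const_mul]
    · apply lintegral_mono
      intro y
      simp only
      rw [enorm_mul, enorm_mul]
      have : ‖chr (-ω0) (T y)‖ₑ = 1 := by rw [← ofReal_norm_eq_enorm, norm_chr]; simp
      rw [this, mul_one]
      calc ‖k y‖ₑ * ‖F (x + T y)‖ₑ ≤ (C * Phi M y) * ‖F (x + T y)‖ₑ := by gcongr; exact hC y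
        _ = _ := by ring
    · have := (ES_cont hF).measurable
      have := measurable_Phi (X := X d) M
      fun_prop
  have h2 := avg_jensen M T (ES_meas hF q) (a := 1 / q) (by positivity) (by rw [div_le_one hq0]; exact hq) x
  have e : ∀ t : ℝ≥0∞, (t ^ q) ^ (1 / q) = t := fun t => by
    rw [← ENNReal.rpow_mul, mul_one_div_cancel hq0.ne', ENNReal.rpow_one]
  have e' : ∀ t : ℝ≥0∞, (t ^ (1 / q)) ^ q = t := fun t => by
    rw [← ENNReal.rpow_mul, one_div_mul_cancel hq0.ne', ENNReal.rpow_one]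
  simp_rw [e] at h2
  have hfin : ((C : ℝ≥0∞) * (∫⁻ y : X d, Phi M y) ^ (1 - 1/q)) ^ q ≠ ∞ := by
    apply ENNReal.rpow_ne_top_of_nonneg hq0.le
    apply ENNReal.mul_ne_top (by simp)
    apply ENNReal.rpow_ne_top_of_nonneg _ hI
    have : 1 / q ≤ 1 := by rw [div_le_one hq0]; exact hq
    linarith
  rw [ENNReal.coe_toNNReal hfin]
  calc ‖F x‖ₑ ^ q ≤ (C * ((∫⁻ y : X d, Phi M y) ^ (1 - 1/q) * avg M T (fun x => ‖F x‖ₑ ^ q) x ^ (1/q))) ^ q := by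
        gcongr; exact h1.trans (by gcongr)
    _ = _ := by
      rw [← mul_assoc, ENNReal.mul_rpow_of_nonneg _ _ hq0.le, e']

/-- positive kernel with frequency support in the unit V-ball -/
lemma exists_gker (d : ℕ) : ∃ g : X d → ℝ, Continuous g ∧ (∀ y, 0 ≤ g y) ∧ 0 < g 0 ∧
    (∀ M : ℕ, ∃ C : ℝ≥0, ∀ y, ‖(g y : ℂ)‖ₑ ≤ C * Phi M y) ∧
    ∀ ω : X d, 1 ≤ ‖ω.1‖ → ∫ y, (g y : ℂ) * chr ω y = 0 := by
  obtain ⟨f1, h10, h1⟩ := exists_orth (W := V d)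
  obtain ⟨f2, h20, -⟩ := exists_orth (W := ℝ)
  have c1 := f1.continuous
  have c2 := f2.continuous
  refine ⟨fun y => ‖f1 y.1‖ ^ 2 * ‖f2 y.2‖ ^ 2, by fun_prop, fun y => by positivity, ?_, ?_, ?_⟩
  · have := norm_pos_iff.2 h10
    have := norm_pos_iff.2 h20
    simp only [Prod.fst_zero, Prod.snd_zero]; positivity
  · intro M
    obtain ⟨C1, hC1⟩ := schwartz_decay f1 M
    obtain ⟨C2, hC2⟩ := schwartz_decay f2 M
    refine ⟨(C1 * C2) ^ 2, fun y => ?_⟩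
    have e : ‖((‖f1 y.1‖ ^ 2 * ‖f2 y.2‖ ^ 2 : ℝ) : ℂ)‖ₑ = (‖f1 y.1‖ₑ * ‖f2 y.2‖ₑ) ^ 2 := by
      rw [← ofReal_norm_eq_enorm, ← ofReal_norm_eq_enorm, ← ofReal_norm_eq_enorm, ← ENNReal.ofReal_mul (by positivity),
        ← ENNReal.ofReal_pow (by positivity), Complex.norm_real, Real.norm_of_nonneg (by positivity)]
      congr 1; ring
    rw [e]
    calc (‖f1 y.1‖ₑ * ‖f2 y.2‖ₑ) ^ 2 ≤ ((C1 * Phi M y.1) * (C2 * Phi M y.2)) ^ 2 := by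
          gcongr
          · exact hC1 _
          · exact hC2 _
      _ = (C1 * C2) ^ 2 * (Phi M y.1 * Phi M y.2) ^ 2 := by ring
      _ ≤ (C1 * C2) ^ 2 * (Phi M y) ^ 2 := by gcongr; exact Phi_prod M y
      _ ≤ _ := by
        push_cast; gcongr
        rw [sq]
        calc Phi M y * Phi M y ≤ 1 * Phi M y := by gcongr; exact Phi_le_one M y
          _ = _ := one_mul _
  · intro ω hω
    have e : ∀ y : X d, ((‖f1 y.1‖ ^ 2 * ‖f2 y.2‖ ^ 2 : ℝ) : ℂ) * chr ω y =
        (f1 y.1 * (starRingEnd ℂ) (f1 y.1) * ee ⟪y.1, ω.1⟫) * (‖f2 y.2‖ ^ 2 * ee (y.2 * ω.2)) := by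
      intro y
      unfold chr ph
      rw [ee_add, Complex.mul_conj, Complex.normSq_eq_norm_sq]
      push_cast; ring
    simp_rw [e]
    rw [show (volume : Measure (X d)) = (volume : Measure (V d)).prod (volume : Measure ℝ) from rfl,
      integral_prod_mul (fun y : V d => f1 y * (starRingEnd ℂ) (f1 y) * ee ⟪y, ω.1⟫)
        (fun y : ℝ => (‖f2 y‖ ^ 2 : ℂ) * ee (y * ω.2)), h1 _ hω, zero_mul]

lemma orth_pair {g : X d → ℝ} (hgc : Continuous g) {C : ℝ≥0}
    (hgd : ∀ y, ‖(g y : ℂ)‖ₑ ≤ C * Phi (d+2) y)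
    (hg : ∀ ω : X d, 1 ≤ ‖ω.1‖ → ∫ y, (g y : ℂ) * chr ω y = 0) (ρ : ℝ)
    {S S' : Set (X d)} (hS : ∀ ω ∈ S, ∀ ω' ∈ S', 1 ≤ |ρ| * ‖ω.1 - ω'.1‖)
    {F F' : X d → ℂ} (hF : F ∈ ES S) (hF' : F' ∈ ES S') (x : X d) :
    ∫ y, (g y : ℂ) * (F (x + ρ • y) * (starRingEnd ℂ) (F' (x + ρ • y))) = 0 := by
  have hgcc : Continuous (fun y => (g y : ℂ)) := Complex.continuous_ofReal.comp hgc
  have int : ∀ F ∈ ES S, ∀ F' ∈ ES S', Integrable fun y => (g y : ℂ) * (F (x + ρ • y) * (starRingEnd ℂ) (F' (x + ρ • y))) := by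
    intro F hF F' hF'
    obtain ⟨B, hB⟩ := ES_bdd hF
    obtain ⟨B', hB'⟩ := ES_bdd hF'
    have := ES_cont hF
    have := ES_cont hF'
    refine integrable_of_decay hgcc hgd (B := B * B') ?_ ?_
    · fun_prop
    · intro y; rw [norm_mul, RCLike.norm_conj]
      exact mul_le_mul (hB _) (hB' _) (norm_nonneg _) ((norm_nonneg _).trans (hB 0))
  induction hF using Submodule.span_induction with
  | mem f h =>
    obtain ⟨ω, hω, rfl⟩ := h
    have hω' : chr ω ∈ ES S := Submodule.subset_span ⟨ω, hω, rfl⟩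
    induction hF' using Submodule.span_induction with
    | mem f h =>
      obtain ⟨ω', hω', rfl⟩ := h
      have : ∀ y, (g y : ℂ) * (chr ω (x + ρ • y) * (starRingEnd ℂ) (chr ω' (x + ρ • y)))
          = (chr ω x * (starRingEnd ℂ) (chr ω' x)) * ((g y : ℂ) * chr (ρ • (ω - ω')) y) := by
        intro y
        unfold chr
        rw [conj_ee, conj_ee, ph_add_left, ph_add_left, neg_add, ee_add, ee_add, ph_smul_left, ph_smul_left,
          ph_smul_right, ph_sub_right, mul_sub, sub_eq_add_neg, ee_add]; ring
      simp_rw [this]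
      rw [integral_const_mul, hg, mul_zero]
      have := hS ω hω ω' hω'
      simpa [norm_smul] using this
    | zero => simp
    | add f f' h h' h1 h2 =>
      simp only [Pi.add_apply, map_add, mul_add]
      rw [integral_add (int _ hω' _ h) (int _ hω' _ h'), h1, h2, add_zero]
    | smul a f h h1 =>
      have : ∀ y, (g y : ℂ) * (chr ω (x + ρ • y) * (starRingEnd ℂ) ((a • f) (x + ρ • y)))
         = (starRingEnd ℂ) a * ((g y : ℂ) * (chr ω (x + ρ • y) * (starRingEnd ℂ) (f (x + ρ • y)))) := by
        intro y; simp only [Pi.smul_apply, smul_eq_mul, map_mul]; ring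
      simp_rw [this]
      rw [integral_const_mul, h1, mul_zero]
  | zero => simp
  | add f f' h h' h1 h2 =>
    simp only [Pi.add_apply, add_mul, mul_add]
    rw [integral_add (int _ h _ hF') (int _ h' _ hF'), h1, h2, add_zero]
  | smul a f h h1 =>
    have : ∀ y, (g y : ℂ) * ((a • f) (x + ρ • y) * (starRingEnd ℂ) (F' (x + ρ • y)))
       = a * ((g y : ℂ) * (f (x + ρ • y) * (starRingEnd ℂ) (F' (x + ρ • y)))) := by
      intro y; simp only [Pi.smul_apply, smul_eq_mul]; ring
    simp_rw [this]
    rw [integral_const_mul, h1, mul_zero]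

lemma l2orth_loc {g : X d → ℝ} (hgc : Continuous g) (hg0 : ∀ y, 0 ≤ g y) {C : ℝ≥0}
    (hgd : ∀ y, ‖(g y : ℂ)‖ₑ ≤ C * Phi (d+2) y)
    (hg : ∀ ω : X d, 1 ≤ ‖ω.1‖ → ∫ y, (g y : ℂ) * chr ω y = 0) (ρ : ℝ)
    {ι : Type*} [Fintype ι] (S : ι → Set (X d)) (F : ι → X d → ℂ) (hF : ∀ i, F i ∈ ES (S i))
    (N : ι → ι → Prop) [DecidableRel N] (hN : ∀ i j, N i j → N j i)
    (hS : ∀ i j, ¬ N i j → ∀ ω ∈ S i, ∀ ω' ∈ S j, 1 ≤ |ρ| * ‖ω.1 - ω'.1‖) (D : ℕ)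
    (hD : ∀ i, (Finset.univ.filter (fun j => N i j)).card ≤ D) (x : X d) :
    ∫⁻ y, ‖∑ i, F i (x + ρ • y)‖ₑ ^ 2 * ENNReal.ofReal (g y) ≤
      2 * D * ∑ i, ∫⁻ y, ‖F i (x + ρ • y)‖ₑ ^ 2 * ENNReal.ofReal (g y) := by
  have hgcc : Continuous (fun y => (g y : ℂ)) := Complex.continuous_ofReal.comp hgc
  have hc : ∀ i, Continuous (F i) := fun i => ES_cont (hF i)
  have int : ∀ i j, Integrable fun y => (g y : ℂ) * (F i (x + ρ • y) * (starRingEnd ℂ) (F j (x + ρ • y))) := by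
    intro i j
    obtain ⟨B, hB⟩ := ES_bdd (hF i)
    obtain ⟨B', hB'⟩ := ES_bdd (hF j)
    have := hc i
    have := hc j
    refine integrable_of_decay hgcc hgd (B := B * B') ?_ ?_
    · fun_prop
    · intro y; rw [norm_mul, RCLike.norm_conj]
      exact mul_le_mul (hB _) (hB' _) (norm_nonneg _) ((norm_nonneg _).trans (hB 0))
  set A : ι → ℝ≥0∞ := fun i => ∫⁻ y, ‖F i (x + ρ • y)‖ₑ ^ 2 * ENNReal.ofReal (g y) with hA
  set I : ι → ι → ℂ := fun i j => ∫ y, (g y : ℂ) * (F i (x + ρ • y) * (starRingEnd ℂ) (F j (x + ρ • y))) with hI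
  have hge : ∀ y, ‖(g y : ℂ)‖ₑ = ENNReal.ofReal (g y) := fun y => by
    rw [← ofReal_norm_eq_enorm, Complex.norm_real, Real.norm_of_nonneg (hg0 y)]
  have hIb : ∀ i j, ‖I i j‖ₑ ≤ A i + A j := by
    intro i j
    refine (enorm_integral_le_lintegral_enorm _).trans ?_
    rw [hA]
    simp only
    rw [← lintegral_add_left]
    · apply lintegral_mono; intro y
      simp only
      rw [enorm_mul, enorm_mul, hge, ← ofReal_norm_eq_enorm ((starRingEnd ℂ) _), RCLike.norm_conj, ofReal_norm_eq_enorm,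
        ← add_mul, mul_comm]
      gcongr
      generalize ‖F i (x + ρ • y)‖ₑ = a
      generalize ‖F j (x + ρ • y)‖ₑ = b
      rcases le_total a b with h | h
      · calc a * b ≤ b * b := by gcongr
          _ = b ^ 2 := (sq b).symm
          _ ≤ _ := le_add_self
      · calc a * b ≤ a * a := by gcongr
          _ = a ^ 2 := (sq a).symm
          _ ≤ _ := le_self_add
    · have := (hc i).measurable
      have := hgc.measurable
      fun_prop
  have e1 : ∫⁻ y, ‖∑ i, F i (x + ρ • y)‖ₑ ^ 2 * ENNReal.ofReal (g y) = ‖∑ i, ∑ j, I i j‖ₑ := by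
    have e2 : ∑ i, ∑ j, I i j = ∫ y, ((g y * ‖∑ i, F i (x + ρ • y)‖ ^ 2 : ℝ) : ℂ) := by
      have : ∀ y, ((g y * ‖∑ i, F i (x + ρ • y)‖ ^ 2 : ℝ) : ℂ)
          = ∑ i, ∑ j, (g y : ℂ) * (F i (x + ρ • y) * (starRingEnd ℂ) (F j (x + ρ • y))) := by
        intro y
        push_cast
        rw [← Complex.ofReal_pow, ← Complex.normSq_eq_norm_sq, ← Complex.mul_conj, map_sum, Finset.sum_mul_sum]
        simp_rw [Finset.mul_sum]
      simp_rw [this]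
      rw [integral_finset_sum]
      · congr 1; ext i
        rw [integral_finset_sum]
        intro j _; exact int i j
      · intro i _
        exact integrable_finset_sum _ fun j _ => int i j
    have hIntg : Integrable (fun y => g y * ‖∑ i, F i (x + ρ • y)‖ ^ 2) := by
      have : Integrable fun y => ∑ i, ∑ j, (g y : ℂ) * (F i (x + ρ • y) * (starRingEnd ℂ) (F j (x + ρ • y))) :=
        integrable_finset_sum _ fun i _ => integrable_finset_sum _ fun j _ => int i j
      have h2 := this.re
      refine h2.congr (Filter.Eventually.of_forall fun y => ?_)
      simp only
      have : ((g y * ‖∑ i, F i (x + ρ • y)‖ ^ 2 : ℝ) : ℂ)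
          = ∑ i, ∑ j, (g y : ℂ) * (F i (x + ρ • y) * (starRingEnd ℂ) (F j (x + ρ • y))) := by
        push_cast
        rw [← Complex.ofReal_pow, ← Complex.normSq_eq_norm_sq, ← Complex.mul_conj, map_sum, Finset.sum_mul_sum]
        simp_rw [Finset.mul_sum]
      rw [← this]
      exact Complex.ofReal_re _
    rw [e2, integral_complex_ofReal, ← ofReal_norm_eq_enorm, Complex.norm_real, Real.norm_of_nonneg
      (integral_nonneg fun y => mul_nonneg (hg0 y) (by positivity)),
      ofReal_integral_eq_lintegral_ofReal hIntg (Filter.Eventually.of_forall fun y => mul_nonneg (hg0 y) (by positivity))]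
    congr 1; ext y
    rw [ENNReal.ofReal_mul (hg0 y), ENNReal.ofReal_pow (norm_nonneg _), ofReal_norm_eq_enorm, mul_comm]
  rw [e1]
  calc ‖∑ i, ∑ j, I i j‖ₑ ≤ ∑ i, ∑ j, ‖I i j‖ₑ := by
        refine (enorm_sum_le _ _).trans ?_
        gcongr
        exact enorm_sum_le _ _
    _ ≤ ∑ i, ∑ j, if N i j then A i + A j else 0 := by
        gcongr with i _ j _
        split_ifs with h
        · exact hIb i j
        · have : I i j = 0 := orth_pair hgc hgd hg ρ (hS i j h) (hF i) (hF j) x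
          simp [this]
    _ = ∑ i, ∑ j, ((if N i j then A i else 0) + if N i j then A j else 0) := by
        congr 1; ext i; congr 1; ext j; split_ifs <;> simp
    _ = ∑ i, ∑ j, (if N i j then A i else 0) + ∑ i, ∑ j, (if N i j then A i else 0) := by
        simp_rw [Finset.sum_add_distrib]
        congr 1
        rw [Finset.sum_comm]
        congr 1; ext i; congr 1; ext j
        by_cases h : N j i
        · simp [h, hN _ _ h]
        · have : ¬ N i j := fun h' => h (hN _ _ h')
          simp [h, this]
    _ ≤ ∑ i, D * A i + ∑ i, D * A i := by
        have : ∀ i, ∑ j, (if N i j then A i else 0) ≤ D * A i := by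
          intro i
          rw [← Finset.sum_filter, Finset.sum_const, nsmul_eq_mul]
          gcongr; exact_mod_cast hD i
        gcongr <;> exact this _
    _ = _ := by rw [← Finset.mul_sum]; ring

def iso (d : ℕ) (ρ : ℝ) : X d →L[ℝ] X d := ρ • ContinuousLinearMap.id ℝ (X d)
lemma iso_apply (ρ : ℝ) (y : X d) : iso d ρ y = ρ • y := rfl

lemma l2orth (d M : ℕ) : ∃ C : ℝ≥0, ∀ (ρ : ℝ) {ι : Type} [Fintype ι] (S : ι → Set (X d)) (F : ι → X d → ℂ)
    (hF : ∀ i, F i ∈ ES (S i)) (N : ι → ι → Prop) (hN : ∀ i j, N i j → N j i)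
    (hS : ∀ i j, ¬ N i j → ∀ ω ∈ S i, ∀ ω' ∈ S j, 1 ≤ |ρ| * ‖ω.1 - ω'.1‖) (D : ℕ)
    (hD : ∀ i, {j | N i j}.ncard ≤ D) (x : X d),
    avg M (iso d ρ) (fun x => ‖∑ i, F i x‖ₑ ^ (2:ℝ)) x ≤ C * D * ∑ i, avg M (iso d ρ) (fun x => ‖F i x‖ₑ ^ (2:ℝ)) x := by
  classical
  obtain ⟨g, hgc, hg0, hgp, hgd, hg⟩ := exists_gker d
  obtain ⟨C1, hC1⟩ := hgd (d + 2)
  obtain ⟨C2, hC2⟩ := hgd (M + (d + 2))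
  have hgm := hgc.measurable
  have hPm := measurable_Phi (X := X d) M
  set c0 : ℝ≥0∞ := ∫⁻ y : X d, Phi M y * ENNReal.ofReal (g y) with hc0
  have hc00 : c0 ≠ 0 := by
    intro h
    rw [hc0, lintegral_eq_zero_iff (by fun_prop)] at h
    have h2 : g =ᵐ[volume] fun _ => 0 := by
      filter_upwards [h] with y hy
      have := (mul_eq_zero.1 hy).resolve_left (Phi_ne_zero M y)
      exact le_antisymm (ENNReal.ofReal_eq_zero.1 this) (hg0 y)
    have h3 := (Continuous.ae_eq_iff_eq volume hgc continuous_const).1 h2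
    rw [congrFun h3 0] at hgp
    exact lt_irrefl _ hgp
  have hge : ∀ y, ‖(g y : ℂ)‖ₑ = ENNReal.ofReal (g y) := fun y => by
    rw [← ofReal_norm_eq_enorm, Complex.norm_real, Real.norm_of_nonneg (hg0 y)]
  have hI : ∫⁻ y : X d, Phi (d+2) y ≠ ∞ := lintegral_Phi_ne_top (by rw [finrank_X])
  refine ⟨(c0⁻¹ * (2 * C2 * ∫⁻ y : X d, Phi (d+2) y)).toNNReal, ?_⟩
  intro ρ ι _ S F hF N hN hS D hD x
  rw [ENNReal.coe_toNNReal (by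
    apply ENNReal.mul_ne_top (ENNReal.inv_ne_top.2 hc00)
    exact ENNReal.mul_ne_top (by finiteness) hI)]
  have hloc := fun x => l2orth_loc hgc hg0 hC1 hg ρ S F hF N hN hS D (fun i => by
    have := hD i
    rw [Set.ncard_eq_toFinset_card'] at this
    simpa [Set.toFinset_setOf] using this) x
  set U : X d → ℝ≥0∞ := fun x => ‖∑ i, F i x‖ₑ ^ (2:ℝ) with hU
  have hc : ∀ i, Measurable (F i) := fun i => (ES_cont (hF i)).measurable
  have hUm : Measurable U := by
    rw [hU]; exact (Finset.measurable_fun_sum _ fun i _ => hc i).enorm.pow_const _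
  set u : ι → X d → ℝ≥0∞ := fun i x => ‖F i x‖ₑ ^ (2:ℝ) with hu
  have hum : ∀ i, Measurable (u i) := fun i => (hc i).enorm.pow_const _
  set G : X d → ℝ≥0∞ := fun x => ∫⁻ y, U (x + ρ • y) * ENNReal.ofReal (g y) with hG
  have h1 : ∀ z, G z ≤ 2 * D * (C2 * ∑ i, avg (M + (d+2)) (iso d ρ) (u i) z) := by
    intro z
    have := hloc z
    simp only [hG, hU]
    simp_rw [ENNReal.rpow_two]
    refine this.trans ?_
    refine mul_le_mul' le_rfl ?_
    rw [Finset.mul_sum]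
    refine Finset.sum_le_sum fun i _ => ?_
    unfold avg
    rw [← lintegral_const_mul]
    · apply lintegral_mono
      intro y
      simp only [hu, ENNReal.rpow_two, iso_apply]
      rw [← hge]
      calc ‖F i (z + ρ • y)‖ₑ ^ 2 * ‖(g y : ℂ)‖ₑ ≤ ‖F i (z + ρ • y)‖ₑ ^ 2 * (C2 * Phi (M + (d+2)) y) := by gcongr; exact hC2 y
        _ = _ := by ring
    · have := measurable_Phi (X := X d) (M + (d+2))
      have := hum i
      fun_prop
  have h2 : c0 * avg M (iso d ρ) U x ≤ avg M (iso d ρ) G x := by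
    have e : avg M (iso d ρ) G x = ∫⁻ y, avg M (iso d ρ) U (x + iso d ρ y) * ENNReal.ofReal (g y) := by
      unfold avg
      simp only [hG]
      have e1 : ∀ y : X d, (∫⁻ z, U (x + iso d ρ y + ρ • z) * ENNReal.ofReal (g z)) * Phi M y
        = ∫⁻ z, U (x + iso d ρ y + ρ • z) * ENNReal.ofReal (g z) * Phi M y := by
        intro y; rw [lintegral_mul_const]; fun_prop
      have e2 : ∀ y : X d, (∫⁻ z, U (x + iso d ρ y + iso d ρ z) * Phi M z) * ENNReal.ofReal (g y)
        = ∫⁻ z, U (x + iso d ρ y + iso d ρ z) * Phi M z * ENNReal.ofReal (g y) := by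
        intro y; rw [lintegral_mul_const]; fun_prop
      simp_rw [e1, e2]
      rw [lintegral_lintegral_swap]
      · congr 1; ext y; congr 1; ext z
        rw [iso_apply, iso_apply, add_right_comm x]; ring
      · apply Measurable.aemeasurable
        show Measurable (fun p : X d × X d => U (x + iso d ρ p.1 + ρ • p.2) * ENNReal.ofReal (g p.2) * Phi M p.1)
        fun_prop
    rw [e, hc0, ← lintegral_mul_const _ (by fun_prop)]
    apply lintegral_mono; intro y
    have := avg_harn M (iso d ρ) hUm (x + iso d ρ y) (-y)
    simp only [map_neg, add_neg_cancel_right, norm_neg, one_mul] at this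
    calc Phi M y * ENNReal.ofReal (g y) * avg M (iso d ρ) U x
        ≤ Phi M y * ENNReal.ofReal (g y) * (br ‖y‖ ^ M * avg M (iso d ρ) U (x + iso d ρ y)) := by gcongr
      _ = avg M (iso d ρ) U (x + iso d ρ y) * ENNReal.ofReal (g y) * (br ‖y‖ ^ M * Phi M y) := by ring
      _ = _ := by rw [Phi_mul, mul_one]
  have h3 : avg M (iso d ρ) G x ≤ 2 * D * (C2 * ∑ i, ((∫⁻ y : X d, Phi (d+2) y) * avg M (iso d ρ) (u i) x)) := by
    refine (avg_mono M _ h1 x).trans ?_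
    have m1 : ∀ i, Measurable (avg (M + (d+2)) (iso d ρ) (u i)) := fun i => measurable_avg _ _ (hum i)
    have m2 : Measurable (fun z => ∑ i, avg (M + (d+2)) (iso d ρ) (u i) z) := Finset.measurable_fun_sum _ fun i _ => m1 i
    rw [avg_const_mul M _ (m2.const_mul _), avg_const_mul M _ m2, avg_sum _ _ _ m1]
    gcongr with i _
    rw [avg_comm _ _ (hum i)]
    have := absorb (M := M) (N := d+2) (iso d ρ) (ContinuousLinearMap.id ℝ (X d)) (A := 1) (ContinuousLinearMap.norm_id_le) (hum i) x
    simpa using this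
  calc avg M (iso d ρ) U x = c0⁻¹ * (c0 * avg M (iso d ρ) U x) := by
        rw [← mul_assoc, ENNReal.inv_mul_cancel hc00, one_mul]
        have : c0 ≤ C1 * ∫⁻ y : X d, Phi (d+2) y := by
          rw [hc0, ← lintegral_const_mul _ (measurable_Phi _)]
          apply lintegral_mono; intro y
          calc Phi M y * ENNReal.ofReal (g y) ≤ 1 * (C1 * Phi (d+2) y) := by
                gcongr
                · exact Phi_le_one M y
                · rw [← hge]; exact hC1 y
            _ = _ := one_mul _
        exact (this.trans_lt (ENNReal.mul_lt_top (by simp) hI.lt_top)).ne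
    _ ≤ c0⁻¹ * (2 * D * (C2 * ∑ i, ((∫⁻ y : X d, Phi (d+2) y) * avg M (iso d ρ) (u i) x))) := by
        exact mul_le_mul' le_rfl (h2.trans h3)
    _ = _ := by rw [← Finset.mul_sum]; ring

end
end Dcp

end


section
open MeasureTheory Real
open scoped RealInnerProductSpace ENNReal NNReal

set_option linter.all false
namespace Dcp

section
variable {ι : Type*} [Fintype ι] [DecidableEq ι]

lemma finner_aux (ν : ι → Measure ℝ) [∀ i, IsProbabilityMeasure (ν i)] (f : ι → (ι → ℝ) → ℝ≥0∞)
    (hf : ∀ i, Measurable (f i)) (hu : ∀ i z t, f i (Function.update z i t) = f i z)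
    (θ : ℝ) (h0 : 0 ≤ θ) (h1 : ((Fintype.card ι : ℝ) - 1) * θ ≤ 1) (s : Finset ι) :
    ∀ z, lmarginal ν s (fun z => ∏ i, f i z ^ θ) z ≤ ∏ i, (lmarginal ν s (f i) z) ^ θ := by
  have hm : Measurable (fun z => ∏ i, f i z ^ θ) :=
    Finset.measurable_prod _ fun i _ => (hf i).pow_const θ
  induction s using Finset.induction_on with
  | empty => intro z; simp
  | insert j s hj ih =>
    intro z
    rw [lmarginal_insert _ hm hj]
    have hg : ∀ t, lmarginal ν s (f j) (Function.update z j t) = lmarginal ν s (f j) z := by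
      intro t
      rw [lmarginal_update_of_notMem (hf j) hj]
      congr 1; ext w; exact hu j w t
    calc ∫⁻ t, lmarginal ν s (fun z => ∏ i, f i z ^ θ) (Function.update z j t) ∂ν j
        ≤ ∫⁻ t, ∏ i, (lmarginal ν s (f i) (Function.update z j t)) ^ θ ∂ν j :=
          lintegral_mono fun t => ih _
      _ = ∫⁻ t, (lmarginal ν s (f j) z) ^ θ * ((1:ℝ≥0∞) ^ (1 - ((Fintype.card ι : ℝ) - 1) * θ) *
            ∏ i ∈ Finset.univ.erase j, (lmarginal ν s (f i) (Function.update z j t)) ^ θ) ∂ν j := by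
          refine lintegral_congr fun t => ?_
          rw [← Finset.mul_prod_erase _ _ (Finset.mem_univ j), hg, ENNReal.one_rpow, one_mul]
      _ ≤ (lmarginal ν s (f j) z) ^ θ * ((∫⁻ t, (1:ℝ≥0∞) ∂ν j) ^ (1 - ((Fintype.card ι : ℝ) - 1) * θ) *
            ∏ i ∈ Finset.univ.erase j, (∫⁻ t, (lmarginal ν s (f i) (Function.update z j t)) ∂ν j) ^ θ) := by
          rw [lintegral_const_mul]
          · gcongr
            refine ENNReal.lintegral_mul_prod_norm_pow_le (p := fun _ => θ) _ (by fun_prop) ?_ _ ?_ (by linarith) (fun _ _ => h0)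
            · intro i _
              exact (((hf i).lmarginal ν).comp (measurable_update z)).aemeasurable
            · rw [Finset.sum_const, Finset.card_erase_of_mem (Finset.mem_univ j), Finset.card_univ, nsmul_eq_mul,
                Nat.cast_sub (Fintype.card_pos_iff.2 ⟨j⟩)]
              push_cast; ring
          · refine Measurable.mul measurable_const (Finset.measurable_prod _ fun i _ => ?_)
            exact (((hf i).lmarginal ν).comp (measurable_update z)).pow_const θ
      _ = _ := by
          rw [← Finset.mul_prod_erase _ (fun i => (lmarginal ν (insert j s) (f i) z) ^ θ) (Finset.mem_univ j)]
          simp only [lintegral_const, measure_univ, mul_one, ENNReal.one_rpow, one_mul]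
          congr 2
          · rw [lmarginal_insert _ (hf j) hj]
            simp only [hg, lintegral_const, measure_univ, mul_one]
          · funext i
            rw [lmarginal_insert _ (hf i) hj]

lemma finner (ν : ι → Measure ℝ) [∀ i, IsProbabilityMeasure (ν i)] (f : ι → (ι → ℝ) → ℝ≥0∞)
    (hf : ∀ i, Measurable (f i)) (hu : ∀ i z t, f i (Function.update z i t) = f i z)
    (θ : ℝ) (h0 : 0 ≤ θ) (h1 : ((Fintype.card ι : ℝ) - 1) * θ ≤ 1) :
    ∫⁻ z, ∏ i, f i z ^ θ ∂Measure.pi ν ≤ ∏ i, (∫⁻ z, f i z ∂Measure.pi ν) ^ θ := by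
  have := finner_aux ν f hf hu θ h0 h1 Finset.univ (fun _ => 0)
  simpa [lmarginal_univ] using this

lemma lintegral_update (ν : ι → Measure ℝ) [∀ i, IsProbabilityMeasure (ν i)] (f : (ι → ℝ) → ℝ≥0∞)
    (hf : Measurable f) (i : ι) :
    ∫⁻ z, ∫⁻ t, f (Function.update z i t) ∂ν i ∂Measure.pi ν = ∫⁻ z, f z ∂Measure.pi ν := by
  have hm : Measurable (fun z => ∫⁻ t, f (Function.update z i t) ∂ν i) := by
    have := hf.lmarginal ν (s := {i})
    rwa [lmarginal_singleton] at this
  rw [lintegral_eq_lmarginal_univ (fun _ => 0), lintegral_eq_lmarginal_univ (fun _ => 0),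
    lmarginal_erase' _ hf (Finset.mem_univ i), lmarginal_erase' _ hm (Finset.mem_univ i)]
  simp

end

/-- weighted Jensen -/
lemma wJ {ι : Type*} (s : Finset ι) (u H : ι → ℝ≥0∞) (hH : ∀ i, H i ≠ ∞) (h0 : ∀ i, H i = 0 → u i = 0)
    {α : ℝ} (ha : 0 < α) (ha1 : α ≤ 1) :
    ∑ i ∈ s, u i ^ α ≤ (∑ i ∈ s, H i ^ α) ^ (1 - α) * (∑ i ∈ s, H i ^ (α - 1) * u i) ^ α := by
  have h := ENNReal.inner_le_weight_mul_Lp_of_nonneg s (p := 1/α) (by rw [le_div_iff₀ ha]; linarith)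
    (fun i => H i ^ α) (fun i => (u i / H i) ^ α)
  rw [one_div, inv_inv] at h
  have hz : ∀ i, H i = 0 ∨ (H i ≠ 0) := fun i => em _
  refine le_trans (le_of_eq ?_) (h.trans (le_of_eq ?_))
  · refine Finset.sum_congr rfl fun i _ => ?_
    rcases hz i with h' | h'
    · simp [h', h0 i h', ha]
    · rw [← ENNReal.mul_rpow_of_nonneg _ _ ha.le, ENNReal.mul_div_cancel h' (hH i)]
  · congr 2
    refine Finset.sum_congr rfl fun i _ => ?_
    rcases hz i with h' | h'
    · simp [h', h0 i h', ha]
    · rw [← ENNReal.rpow_mul, mul_inv_cancel₀ ha.ne', ENNReal.rpow_one, div_eq_mul_inv, ENNReal.rpow_sub _ _ h' (hH i),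
        ENNReal.rpow_one, div_eq_mul_inv]; ring

section
def nu1 : Measure ℝ := volume.restrict (Set.Icc (-(1/2):ℝ) (1/2))
instance : IsProbabilityMeasure nu1 := ⟨by rw [nu1, Measure.restrict_apply_univ, Real.volume_Icc]; norm_num⟩
def mu (n : ℕ) : Measure (Fin n → ℝ) := Measure.pi (fun _ => nu1)
instance (n : ℕ) : IsProbabilityMeasure (mu n) := by unfold mu; infer_instance
def Q (n : ℕ) : Set (Fin n → ℝ) := Set.univ.pi fun _ => Set.Icc (-(1/2):ℝ) (1/2)
lemma Q_meas (n : ℕ) : MeasurableSet (Q n) := MeasurableSet.univ_pi fun _ => measurableSet_Icc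
lemma mem_Q {n : ℕ} (z : Fin n → ℝ) : z ∈ Q n ↔ ∀ i, |z i| ≤ 1/2 := by
  simp only [Q, Set.mem_univ_pi, Set.mem_Icc, abs_le]
lemma mu_eq (n : ℕ) : mu n = volume.restrict (Q n) := by
  rw [mu, Q, volume_pi, Measure.restrict_pi_pi]; rfl

lemma lintegral_affine (n : ℕ) (a : ℝ) (ha : 0 < a) (w : Fin n → ℝ) (f : (Fin n → ℝ) → ℝ≥0∞) (hf : Measurable f) :
    ∫⁻ z, f (w + a • z) = ENNReal.ofReal (a⁻¹ ^ n) * ∫⁻ z, f z := by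
  have h := Measure.map_addHaar_smul (volume : Measure (Fin n → ℝ)) ha.ne'
  have h2 : ∫⁻ z, f (w + a • z) = ∫⁻ z, f (w + z) ∂(Measure.map (a • ·) (volume : Measure (Fin n → ℝ))) := by
    rw [lintegral_map (by fun_prop) (by fun_prop)]
  rw [h2, h, lintegral_smul_measure, lintegral_add_left_eq_self f w]
  rw [Module.finrank_fin_fun, abs_of_pos (by positivity), inv_pow, smul_eq_mul]

variable {X : Type*} [NormedAddCommGroup X] [NormedSpace ℝ X] [FiniteDimensional ℝ X]
  [MeasureSpace X] [BorelSpace X] [(volume : Measure X).IsAddHaarMeasure] {n : ℕ}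

def PP (L : (Fin n → ℝ) →L[ℝ] X) (a : ℝ) (u : X → ℝ≥0∞) (x : X) : ℝ≥0∞ := ∫⁻ z, u (x + a • L z) ∂mu n

lemma PP_meas (L : (Fin n → ℝ) →L[ℝ] X) (a : ℝ) {u : X → ℝ≥0∞} (hu : Measurable u) : Measurable (PP L a u) := by
  unfold PP
  refine Measurable.lintegral_prod_right' (f := fun q : X × (Fin n → ℝ) => u (q.1 + a • L q.2)) ?_
  exact hu.comp (by fun_prop)

lemma PP_box (L : (Fin n → ℝ) →L[ℝ] X) {a b : ℝ} (ha : 0 < a) (hb : 0 < b) (w : Fin n → ℝ) (hw : ∀ i, |w i| + a/2 ≤ b/2)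
    {u : X → ℝ≥0∞} (hu : Measurable u) (x : X) :
    PP L a u (x + L w) ≤ ENNReal.ofReal ((b/a)^n) * PP L b u x := by
  unfold PP
  rw [mu_eq, ← lintegral_indicator (Q_meas n), ← lintegral_indicator (Q_meas n)]
  set f : (Fin n → ℝ) → ℝ≥0∞ := fun z => (Q n).indicator (fun z => u (x + b • L z)) z with hf
  have hfm : Measurable f := Measurable.indicator (hu.comp (by fun_prop)) (Q_meas n)
  have h := lintegral_affine n (a/b) (by positivity) (b⁻¹ • w) f hfm
  rw [inv_div] at h
  rw [← h]
  refine lintegral_mono fun z => ?_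
  by_cases hz : z ∈ Q n
  · have hz' : b⁻¹ • w + (a/b) • z ∈ Q n := by
      rw [mem_Q] at hz ⊢
      intro i
      have h1 := hw i
      have h2 := hz i
      simp only [Pi.add_apply, Pi.smul_apply, smul_eq_mul]
      have : b⁻¹ * w i + a / b * z i = (w i + a * z i) / b := by field_simp
      rw [this, abs_div, abs_of_pos hb, div_le_iff₀ hb]
      have h3 : |a * z i| ≤ a * (1/2) := by rw [abs_mul, abs_of_pos ha]; gcongr
      have := abs_add_le (w i) (a * z i)
      linarith
    simp only [hf, Set.indicator_of_mem hz, Set.indicator_of_mem hz']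
    apply le_of_eq
    congr 1
    rw [map_add, map_smul, map_smul, smul_add, smul_smul, smul_smul, mul_inv_cancel₀ hb.ne', one_smul, mul_div_cancel₀ _ hb.ne', add_assoc]
  · simp [Set.indicator_of_notMem hz]

lemma PP_PP_le (L : (Fin n → ℝ) →L[ℝ] X) {a b : ℝ} (ha : 0 < a) (hab : a ≤ b)
    {u : X → ℝ≥0∞} (hu : Measurable u) (x : X) :
    ∫⁻ z, PP L a u (x + b • L z) ∂mu n ≤ 2 ^ n * PP L (2*b) u x := by
  have hb : 0 < b := lt_of_lt_of_le ha hab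
  unfold PP
  rw [lintegral_lintegral_swap (by
    refine Measurable.aemeasurable ?_
    exact hu.comp (by fun_prop))]
  have hae : ∀ᵐ y ∂mu n, y ∈ Q n := by rw [mu_eq]; exact ae_restrict_mem (Q_meas n)
  calc ∫⁻ y, ∫⁻ z, u (x + b • L z + a • L y) ∂mu n ∂mu n
      ≤ ∫⁻ y, 2 ^ n * PP L (2*b) u x ∂mu n := by
        refine lintegral_mono_ae (hae.mono fun y hy => ?_)
        have h := PP_box L hb (by positivity : 0 < 2*b) (a • y) (by
          intro i
          have := (mem_Q y).1 hy i
          rw [Pi.smul_apply, smul_eq_mul, abs_mul, abs_of_pos ha]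
          nlinarith) hu x
        rw [show 2 * b / b = 2 by field_simp, ENNReal.ofReal_pow (by norm_num), ENNReal.ofReal_ofNat] at h
        refine le_trans (le_of_eq ?_) h
        unfold PP
        refine lintegral_congr fun z => ?_
        rw [map_smul]; congr 1; abel
    _ = _ := by rw [lintegral_const, measure_univ, mul_one]; rfl


lemma Wt.box_le {E : ℕ} {κ : ℝ} {Ω : X → ℝ≥0∞} (h : Wt E κ Ω) (hκ : 0 ≤ κ) (L : (Fin n → ℝ) →L[ℝ] X) {K b : ℝ}
    (hL : ‖L‖ ≤ K) (hb : 0 ≤ b) (hκb : κ * b ≤ 1) {G : X → ℝ≥0∞} (hG : Measurable G) :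
    ∫⁻ x, G x * Ω x ≤ br K ^ E * ∫⁻ x, (∫⁻ z, G (x + b • L z) ∂mu n) * Ω x := by
  have hΩ := h.1
  have hK : 0 ≤ K := (norm_nonneg _).trans hL
  have hae : ∀ᵐ y ∂mu n, y ∈ Q n := by rw [mu_eq]; exact ae_restrict_mem (Q_meas n)
  have hm : Measurable (fun q : X × (Fin n → ℝ) => G (q.1 + b • L q.2)) := hG.comp (by fun_prop)
  have e1 : ∫⁻ x, (∫⁻ z, G (x + b • L z) ∂mu n) * Ω x = ∫⁻ z, (∫⁻ x, G (x + b • L z) * Ω x) ∂mu n := by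
    rw [lintegral_lintegral_swap]
    · refine lintegral_congr fun x => ?_
      rw [lintegral_mul_const]
      exact hG.comp (by fun_prop)
    · exact ((hm.comp measurable_swap).mul (hΩ.comp measurable_snd)).aemeasurable
  have e2 : ∀ z ∈ Q n, ∫⁻ x, G x * Ω x ≤ br K ^ E * ∫⁻ x, G (x + b • L z) * Ω x := by
    intro z hz
    rw [← lintegral_add_right_eq_self (fun x => G x * Ω x) (b • L z), ← lintegral_const_mul]
    · refine lintegral_mono fun x => ?_
      calc G (x + b • L z) * Ω (x + b • L z) ≤ G (x + b • L z) * (br (κ * ‖b • L z‖) ^ E * Ω x) := by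
            gcongr; exact h.2 _ _
        _ ≤ G (x + b • L z) * (br K ^ E * Ω x) := by
            gcongr
            apply br_mono
            rw [norm_smul, Real.norm_of_nonneg hb]
            have h1 : ‖L z‖ ≤ K := by
              have hz1 : ‖z‖ ≤ 1 := by
                rw [pi_norm_le_iff_of_nonneg zero_le_one]
                intro i; have := (mem_Q z).1 hz i; rw [Real.norm_eq_abs]; linarith
              calc ‖L z‖ ≤ ‖L‖ * ‖z‖ := L.le_opNorm z
                _ ≤ K * 1 := by gcongr
                _ = K := mul_one K
            calc κ * (b * ‖L z‖) = (κ * b) * ‖L z‖ := by ring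
              _ ≤ 1 * K := by gcongr
              _ = K := one_mul K
        _ = _ := by ring
    · exact (hG.comp (by fun_prop)).mul hΩ
  rw [e1]
  calc ∫⁻ x, G x * Ω x = ∫⁻ z, (∫⁻ x, G x * Ω x) ∂mu n := by rw [lintegral_const, measure_univ, mul_one]
    _ ≤ ∫⁻ z, br K ^ E * (∫⁻ x, G (x + b • L z) * Ω x) ∂mu n := lintegral_mono_ae (hae.mono e2)
    _ = _ := by
      rw [lintegral_const_mul]
      exact Measurable.lintegral_prod_right' (f := fun q : (Fin n → ℝ) × X => G (q.2 + b • L q.1) * Ω q.2)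
        ((hm.comp measurable_swap).mul (hΩ.comp measurable_snd))

lemma piece_shift (L : (Fin n → ℝ) ≃L[ℝ] X) {K ρ σ R2 : ℝ} (hLs : ‖(L.symm : X →L[ℝ] (Fin n → ℝ))‖ ≤ K)
    (hρ : 0 < ρ) (hσ : 0 < σ) (hR : ρ / σ ≤ R2) {h : X → ℝ≥0∞} (hh : Measurable h) {CH : ℝ≥0∞} {nn : X} {i : Fin n}
    (hn : ‖nn - L (Pi.single i 1)‖ ≤ 2 * σ) (hH : ∀ x t, |t| ≤ R2 → h (x + t • nn) ≤ CH * h x) (x : X)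
    {z : Fin n → ℝ} {t : ℝ} (hz : z ∈ Q n) (ht : t ∈ Set.Icc (-(1/2):ℝ) (1/2)) :
    PP (L : (Fin n → ℝ) →L[ℝ] X) ρ h (x + (ρ/(2*σ)) • L z) ≤ CH * ENNReal.ofReal ((1+2*K)^n) *
      PP (L : (Fin n → ℝ) →L[ℝ] X) ((1+2*K)*ρ) h (x + (ρ/(2*σ)) • L (Function.update z i t)) := by
  have hK : 0 ≤ K := (norm_nonneg _).trans hLs
  set ρ' := ρ/(2*σ) with hρ'
  have hρ'0 : 0 < ρ' := by positivity
  have hzi := (mem_Q z).1 hz i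
  have htz : |t - z i| ≤ 1 := by
    rw [abs_le] at hzi ⊢; constructor <;> linarith [ht.1, ht.2, hzi.1, hzi.2]
  set τ := (t - z i) * ρ' with hτ
  have hτ' : |τ| ≤ ρ' := by rw [hτ, abs_mul, abs_of_pos hρ'0]; nlinarith
  have hρR : ρ' ≤ R2 := by
    refine le_trans ?_ hR
    rw [hρ']; gcongr; linarith
  set w := L.symm (τ • (nn - L (Pi.single i 1))) with hw
  have hLw : L w = τ • (nn - L (Pi.single i 1)) := by rw [hw, L.apply_symm_apply]
  have hwn : ‖w‖ ≤ K * ρ := by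
    calc ‖w‖ ≤ ‖(L.symm : X →L[ℝ] (Fin n → ℝ))‖ * ‖τ • (nn - L (Pi.single i 1))‖ :=
          (L.symm : X →L[ℝ] (Fin n → ℝ)).le_opNorm _
      _ ≤ K * (ρ' * (2 * σ)) := by
          rw [norm_smul, Real.norm_eq_abs]; gcongr
      _ = K * ρ := by rw [hρ']; field_simp
  have hup : Function.update z i t = z + (t - z i) • Pi.single i 1 := by
    ext j
    by_cases hj : j = i
    · subst hj; simp
    · simp [hj]
  have hpt : x + ρ' • L z + τ • nn = x + ρ' • L (Function.update z i t) + L w := by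
    rw [hLw, hup, map_add, map_smul, smul_add, smul_smul, smul_sub, hτ, mul_comm ρ']
    abel
  have hb := PP_box (L : (Fin n → ℝ) →L[ℝ] X) hρ (by positivity : 0 < (1+2*K)*ρ) w (by
    intro j
    have : |w j| ≤ K * ρ := by rw [← Real.norm_eq_abs]; exact (norm_le_pi_norm w j).trans hwn
    linarith) hh (x + ρ' • L (Function.update z i t))
  rw [mul_div_cancel_right₀ _ hρ.ne'] at hb
  rw [mul_assoc]
  refine le_trans ?_ (mul_le_mul' le_rfl hb)
  unfold PP
  rw [← lintegral_const_mul]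
  swap
  · exact hh.comp (by fun_prop)
  refine lintegral_mono fun y => ?_
  have h1 := hH (x + ρ' • L (Function.update z i t) + L w + ρ • L y) (-τ) (by rw [abs_neg]; exact hτ'.trans hρR)
  refine le_trans (le_of_eq ?_) h1
  rw [← hpt]; congr 1
  rw [neg_smul]
  simp only [ContinuousLinearEquiv.coe_coe]
  abel

lemma PP_eq_zero (L : (Fin n → ℝ) →L[ℝ] X) (a : ℝ) {h : X → ℝ≥0∞} (hh : Measurable h)
    (h0 : (∀ x, h x = 0) ∨ (∀ x, h x ≠ 0)) {x : X} (hx : PP L a h x = 0) : ∀ x, h x = 0 := by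
  rcases h0 with h0 | h0
  · exact h0
  · exfalso
    unfold PP at hx
    have hm : Measurable (fun z => h (x + a • L z)) := hh.comp (by fun_prop)
    rw [lintegral_eq_zero_iff hm] at hx
    have : ∀ᵐ z ∂mu n, False := hx.mono fun z hz => h0 _ hz
    simp at this
    exact (IsProbabilityMeasure.ne_zero (mu n)) this

lemma PP_le (L : (Fin n → ℝ) →L[ℝ] X) (a : ℝ) {h : X → ℝ≥0∞} {N : ℝ≥0∞} (hN : ∀ x, h x ≤ N) (x : X) :
    PP L a h x ≤ N := by
  unfold PP
  calc _ ≤ ∫⁻ z, N ∂mu n := lintegral_mono fun z => hN _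
    _ = N := by rw [lintegral_const, measure_univ, mul_one]

lemma kak_pt {ι : Type*} (L : (Fin n → ℝ) ≃L[ℝ] X) {K ρ σ R2 α β : ℝ} {CH : ℝ≥0∞}
    (hLs : ‖(L.symm : X →L[ℝ] (Fin n → ℝ))‖ ≤ K)
    (hρ : 0 < ρ) (hσ : 0 < σ) (hR : ρ / σ ≤ R2) (hAσ : 2 * (1 + 2 * K) * σ ≤ 1)
    (ha : 0 < α) (ha1 : α ≤ 1) (hb : 0 ≤ β) (hθ : ((n:ℝ) - 1) * (α * β) ≤ 1)
    (S : Fin n → Finset ι) (h : ι → X → ℝ≥0∞) (hh : ∀ J, Measurable (h J))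
    (h0 : ∀ J, (∀ x, h J x = 0) ∨ (∀ x, h J x ≠ 0)) (hN : ∀ J, ∃ N : ℝ≥0∞, N ≠ ∞ ∧ ∀ x, h J x ≤ N)
    (nn : ι → X) (hn : ∀ i, ∀ J ∈ S i, ‖nn J - L (Pi.single i 1)‖ ≤ 2 * σ)
    (hH : ∀ J x t, |t| ≤ R2 → h J (x + t • nn J) ≤ CH * h J x) (x : X) :
    ∫⁻ z, ∏ i, (∑ J ∈ S i, (PP (L : (Fin n → ℝ) →L[ℝ] X) ρ (h J) (x + (ρ/(2*σ)) • L z)) ^ α) ^ β ∂mu n ≤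
      ((CH * ENNReal.ofReal ((1+2*K)^n)) ^ (α * β) * (2 ^ n) ^ (α * β)) ^ n *
        ∏ i, (∑ J ∈ S i, (PP (L : (Fin n → ℝ) →L[ℝ] X) (ρ / σ) (h J) x) ^ α) ^ β := by
  have hK : 0 ≤ K := (norm_nonneg _).trans hLs
  have hae : ∀ᵐ y ∂mu n, y ∈ Q n := by rw [mu_eq]; exact ae_restrict_mem (Q_meas n)
  have haeI : ∀ᵐ t ∂nu1, t ∈ Set.Icc (-(1/2):ℝ) (1/2) := ae_restrict_mem measurableSet_Icc
  set ρ' := ρ/(2*σ) with hρ'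
  set L' := (L : (Fin n → ℝ) →L[ℝ] X) with hL'
  set Ca := CH * ENNReal.ofReal ((1+2*K)^n) with hCa
  set H : ι → ℝ≥0∞ := fun J => PP L' (ρ/σ) (h J) x with hHdef
  set g : ι → (Fin n → ℝ) → ℝ≥0∞ := fun J z => PP L' ((1+2*K)*ρ) (h J) (x + ρ' • L z) with hg
  have hgm : ∀ J, Measurable (g J) := fun J => (PP_meas L' _ (hh J)).comp (by fun_prop)
  set ub : Fin n → ι → (Fin n → ℝ) → ℝ≥0∞ := fun i J z => ∫⁻ t, g J (Function.update z i t) ∂nu1 with hub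
  have hubm : ∀ i J, Measurable (ub i J) := by
    intro i J
    have := (hgm J).lmarginal (fun _ => nu1) (s := {i})
    rwa [lmarginal_singleton] at this
  set f : Fin n → (Fin n → ℝ) → ℝ≥0∞ := fun i z => ∑ J ∈ S i, H J ^ (α - 1) * ub i J z with hf
  have hfm : ∀ i, Measurable (f i) := fun i => Finset.measurable_sum _ fun J _ => (hubm i J).const_mul _
  have hHtop : ∀ J, H J ≠ ∞ := by
    intro J
    obtain ⟨N, hN1, hN2⟩ := hN J
    exact ne_top_of_le_ne_top hN1 (PP_le L' _ hN2 x)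
  have hHz : ∀ J, H J = 0 → ∀ y, h J y = 0 := fun J hJ => PP_eq_zero L' _ (hh J) (h0 J) hJ
  set T : Fin n → ℝ≥0∞ := fun i => ∑ J ∈ S i, H J ^ α with hT
  have step1 : ∀ z ∈ Q n, ∀ i, (∑ J ∈ S i, (PP L' ρ (h J) (x + ρ' • L z)) ^ α) ^ β ≤
      T i ^ ((1 - α) * β) * (Ca ^ (α * β) * f i z ^ (α * β)) := by
    intro z hz i
    have hu : ∀ J ∈ S i, PP L' ρ (h J) (x + ρ' • L z) ≤ Ca * ub i J z := by
      intro J hJ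
      calc PP L' ρ (h J) (x + ρ' • L z) = ∫⁻ t, PP L' ρ (h J) (x + ρ' • L z) ∂nu1 := by
            rw [lintegral_const, measure_univ, mul_one]
        _ ≤ ∫⁻ t, Ca * g J (Function.update z i t) ∂nu1 := by
            refine lintegral_mono_ae (haeI.mono fun t ht => ?_)
            exact piece_shift L hLs hρ hσ hR (hh J) (hn i J hJ) (hH J) x hz ht
        _ = _ := by
            rw [lintegral_const_mul]
            exact (hgm J).comp (measurable_update z)
    calc (∑ J ∈ S i, (PP L' ρ (h J) (x + ρ' • L z)) ^ α) ^ β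
        ≤ (T i ^ (1 - α) * (∑ J ∈ S i, H J ^ (α - 1) * PP L' ρ (h J) (x + ρ' • L z)) ^ α) ^ β := by
          gcongr
          refine wJ (S i) _ H hHtop ?_ ha ha1
          intro J hJ
          have := hHz J hJ
          simp [PP, this]
      _ ≤ (T i ^ (1 - α) * (∑ J ∈ S i, H J ^ (α - 1) * (Ca * ub i J z)) ^ α) ^ β := by
          gcongr with J hJ
          exact hu J hJ
      _ = (T i ^ (1 - α) * (Ca * f i z) ^ α) ^ β := by
          congr 3
          rw [hf, Finset.mul_sum]
          refine Finset.sum_congr rfl fun J _ => by ring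
      _ = _ := by
          rw [ENNReal.mul_rpow_of_nonneg _ _ hb, ← ENNReal.rpow_mul, ← ENNReal.rpow_mul,
            ENNReal.mul_rpow_of_nonneg _ _ (by positivity)]
  have step2 : ∀ i, ∫⁻ z, f i z ∂mu n ≤ 2 ^ n * T i := by
    intro i
    rw [hf]
    simp only
    rw [lintegral_finset_sum _ (fun J _ => (hubm i J).const_mul _), hT, Finset.mul_sum]
    refine Finset.sum_le_sum fun J hJ => ?_
    rw [lintegral_const_mul _ (hubm i J)]
    have e1 : ∫⁻ z, ub i J z ∂mu n = ∫⁻ z, g J z ∂mu n := lintegral_update (fun _ => nu1) (g J) (hgm J) i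
    rw [e1]
    have e2 : ∫⁻ z, g J z ∂mu n ≤ 2 ^ n * H J := by
      have := PP_PP_le L' (a := (1+2*K)*ρ) (b := ρ') (by positivity) (by
        rw [hρ', le_div_iff₀ (by positivity)]; nlinarith) (hh J) x
      rwa [show 2 * ρ' = ρ / σ by rw [hρ']; field_simp] at this
    refine (mul_le_mul' le_rfl e2).trans ?_
    by_cases hz : H J = 0
    · rw [hz]; simp
    · rw [ENNReal.rpow_sub _ _ hz (hHtop J), ENNReal.rpow_one, mul_left_comm, ENNReal.div_mul_cancel hz (hHtop J)]
  calc _ ≤ ∫⁻ z, (∏ i, T i ^ ((1 - α) * β) * Ca ^ (α * β)) * ∏ i, f i z ^ (α * β) ∂mu n := by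
        refine lintegral_mono_ae (hae.mono fun z hz => ?_)
        rw [← Finset.prod_mul_distrib]
        refine Finset.prod_le_prod' fun i _ => ?_
        rw [mul_assoc]; exact step1 z hz i
    _ = (∏ i, T i ^ ((1 - α) * β) * Ca ^ (α * β)) * ∫⁻ z, ∏ i, f i z ^ (α * β) ∂mu n := by
        rw [lintegral_const_mul]
        exact Finset.measurable_prod _ fun i _ => (hfm i).pow_const _
    _ ≤ (∏ i, T i ^ ((1 - α) * β) * Ca ^ (α * β)) * ∏ i, (∫⁻ z, f i z ∂mu n) ^ (α * β) := by
        gcongr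
        refine finner (fun _ => nu1) f hfm ?_ (α * β) (by positivity) (by simpa using hθ)
        intro i z t
        simp only [hf, hub, Function.update_idem]
    _ ≤ (∏ i, T i ^ ((1 - α) * β) * Ca ^ (α * β)) * ∏ i, (2 ^ n * T i) ^ (α * β) := by
        gcongr with i
        exact step2 i
    _ = ∏ i, ((Ca ^ (α * β) * (2 ^ n) ^ (α * β)) * T i ^ β) := by
        rw [← Finset.prod_mul_distrib]
        refine Finset.prod_congr rfl fun i _ => ?_
        rw [ENNReal.mul_rpow_of_nonneg (2^n) (T i) (by positivity : 0 ≤ α * β)]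
        have : T i ^ β = T i ^ ((1 - α) * β) * T i ^ (α * β) := by
          rw [← ENNReal.rpow_add_of_nonneg _ _ (by nlinarith) (by positivity)]
          congr 1; ring
        rw [this]; ring
    _ = _ := by rw [Finset.prod_mul_distrib, Finset.prod_const, Finset.card_univ, Fintype.card_fin]

lemma kak_step {ι : Type*} (L : (Fin n → ℝ) ≃L[ℝ] X) {K ρ σ R2 α β κ : ℝ} {CH : ℝ≥0∞} {E : ℕ} {Ω : X → ℝ≥0∞}
    (hLs : ‖(L.symm : X →L[ℝ] (Fin n → ℝ))‖ ≤ K) (hL : ‖(L : (Fin n → ℝ) →L[ℝ] X)‖ ≤ K)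
    (hρ : 0 < ρ) (hσ : 0 < σ) (hR : ρ / σ ≤ R2) (hAσ : 2 * (1 + 2 * K) * σ ≤ 1)
    (ha : 0 < α) (ha1 : α ≤ 1) (hb : 0 ≤ β) (hθ : ((n:ℝ) - 1) * (α * β) ≤ 1)
    (hΩ : Wt E κ Ω) (hκ : 0 ≤ κ) (hκR : κ * R2 ≤ 1)
    (S : Fin n → Finset ι) (h : ι → X → ℝ≥0∞) (hh : ∀ J, Measurable (h J))
    (h0 : ∀ J, (∀ x, h J x = 0) ∨ (∀ x, h J x ≠ 0)) (hN : ∀ J, ∃ N : ℝ≥0∞, N ≠ ∞ ∧ ∀ x, h J x ≤ N)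
    (nn : ι → X) (hn : ∀ i, ∀ J ∈ S i, ‖nn J - L (Pi.single i 1)‖ ≤ 2 * σ)
    (hH : ∀ J x t, |t| ≤ R2 → h J (x + t • nn J) ≤ CH * h J x) :
    ∫⁻ x, (∏ i, (∑ J ∈ S i, (PP (L : (Fin n → ℝ) →L[ℝ] X) ρ (h J) x) ^ α) ^ β) * Ω x ≤
      (br K ^ E * ((CH * ENNReal.ofReal ((1+2*K)^n)) ^ (α * β) * (2 ^ n) ^ (α * β)) ^ n) *
        ∫⁻ x, (∏ i, (∑ J ∈ S i, (PP (L : (Fin n → ℝ) →L[ℝ] X) (ρ / σ) (h J) x) ^ α) ^ β) * Ω x := by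
  have hm : ∀ a, Measurable (fun x => ∏ i, (∑ J ∈ S i, (PP (L : (Fin n → ℝ) →L[ℝ] X) a (h J) x) ^ α) ^ β) := fun a =>
    Finset.measurable_prod _ fun i _ => (Finset.measurable_sum _ fun J _ => (PP_meas _ _ (hh J)).pow_const _).pow_const _
  have hκb : κ * (ρ / (2 * σ)) ≤ 1 := by
    refine le_trans ?_ hκR
    refine mul_le_mul_of_nonneg_left (le_trans ?_ hR) hκ
    gcongr; linarith
  refine (hΩ.box_le hκ (L : (Fin n → ℝ) →L[ℝ] X) hL (by positivity) hκb (hm ρ)).trans ?_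
  rw [mul_assoc]
  gcongr
  rw [← lintegral_const_mul]
  swap
  · exact (hm _).mul hΩ.1
  refine lintegral_mono fun x => ?_
  rw [← mul_assoc]
  gcongr
  exact kak_pt L hLs hρ hσ hR hAσ ha ha1 hb hθ S h hh h0 hN nn hn hH x

/-- iterated -/
lemma kak_iter {ι : Type*} (L : (Fin n → ℝ) ≃L[ℝ] X) {K σ R2 α β κ : ℝ} {CH : ℝ≥0∞} {E : ℕ} {Ω : X → ℝ≥0∞}
    (hLs : ‖(L.symm : X →L[ℝ] (Fin n → ℝ))‖ ≤ K) (hL : ‖(L : (Fin n → ℝ) →L[ℝ] X)‖ ≤ K)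
    (hσ : 0 < σ) (hσ1 : σ ≤ 1) (hAσ : 2 * (1 + 2 * K) * σ ≤ 1)
    (ha : 0 < α) (ha1 : α ≤ 1) (hb : 0 ≤ β) (hθ : ((n:ℝ) - 1) * (α * β) ≤ 1)
    (hΩ : Wt E κ Ω) (hκ : 0 ≤ κ) (hκR : κ * R2 ≤ 1)
    (S : Fin n → Finset ι) (h : ι → X → ℝ≥0∞) (hh : ∀ J, Measurable (h J))
    (h0 : ∀ J, (∀ x, h J x = 0) ∨ (∀ x, h J x ≠ 0)) (hN : ∀ J, ∃ N : ℝ≥0∞, N ≠ ∞ ∧ ∀ x, h J x ≤ N)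
    (nn : ι → X) (hn : ∀ i, ∀ J ∈ S i, ‖nn J - L (Pi.single i 1)‖ ≤ 2 * σ)
    (hH : ∀ J x t, |t| ≤ R2 → h J (x + t • nn J) ≤ CH * h J x) (m : ℕ) :
    ∀ ρ : ℝ, 0 < ρ → ρ / σ ^ m ≤ R2 →
    ∫⁻ x, (∏ i, (∑ J ∈ S i, (PP (L : (Fin n → ℝ) →L[ℝ] X) ρ (h J) x) ^ α) ^ β) * Ω x ≤
      (br K ^ E * ((CH * ENNReal.ofReal ((1+2*K)^n)) ^ (α * β) * (2 ^ n) ^ (α * β)) ^ n) ^ m *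
        ∫⁻ x, (∏ i, (∑ J ∈ S i, (PP (L : (Fin n → ℝ) →L[ℝ] X) (ρ / σ ^ m) (h J) x) ^ α) ^ β) * Ω x := by
  induction m with
  | zero => intro ρ _ _; simp
  | succ m ih =>
    intro ρ hρ hR
    have e : ρ / σ ^ (m+1) = ρ / σ / σ ^ m := by rw [div_div, pow_succ']
    have h1 : ρ / σ ≤ R2 := by
      refine le_trans ?_ hR
      rw [e]
      exact le_div_self (by positivity) (by positivity) (pow_le_one₀ hσ.le hσ1)
    refine (kak_step L hLs hL hρ hσ h1 hAσ ha ha1 hb hθ hΩ hκ hκR S h hh h0 hN nn hn hH).trans ?_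
    rw [pow_succ', e]
    refine le_trans ?_ (le_of_eq (mul_assoc _ _ _).symm)
    refine mul_le_mul' le_rfl ?_
    exact ih (ρ / σ) (by positivity) (by rw [← e]; exact hR)

lemma PP_start (L : (Fin n → ℝ) →L[ℝ] X) (a : ℝ) {M : ℕ} {T : X →L[ℝ] X} {h : X → ℝ≥0∞} (hT : Harn 1 M T h)
    (hh : Measurable h) {K : ℝ} (hy : ∀ z ∈ Q n, ∃ y, a • L z = T y ∧ ‖y‖ ≤ K) (x : X) :
    h x ≤ br K ^ M * PP L a h x := by
  have hae : ∀ᵐ y ∂mu n, y ∈ Q n := by rw [mu_eq]; exact ae_restrict_mem (Q_meas n)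
  calc h x = ∫⁻ z, h x ∂mu n := by rw [lintegral_const, measure_univ, mul_one]
    _ ≤ ∫⁻ z, br K ^ M * h (x + a • L z) ∂mu n := by
      refine lintegral_mono_ae (hae.mono fun z hz => ?_)
      obtain ⟨y, hy1, hy2⟩ := hy z hz
      have := hT (x + T y) (-y)
      rw [map_neg, add_neg_cancel_right, norm_neg, one_mul] at this
      rw [hy1]
      refine this.trans ?_
      gcongr
      exact br_mono hy2
    _ = _ := by rw [lintegral_const_mul]; rfl; exact hh.comp (by fun_prop)

variable (X) in
lemma PP_end (n : ℕ) (K : ℝ) (M : ℕ) : ∃ C : ℝ≥0, ∀ L : (Fin n → ℝ) ≃L[ℝ] X, ‖(L : (Fin n → ℝ) →L[ℝ] X)‖ ≤ K →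
    ‖(L.symm : X →L[ℝ] (Fin n → ℝ))‖ ≤ K → ∀ a : ℝ, ∀ u : X → ℝ≥0∞, Measurable u → ∀ x,
    PP (L : (Fin n → ℝ) →L[ℝ] X) a u x ≤ C * avg M (a • ContinuousLinearMap.id ℝ X) u x := by
  set v := volume (Metric.ball (0:X) 1) with hv
  have hv0 : v ≠ 0 := (Metric.measure_ball_pos volume _ one_pos).ne'
  have hv1 : v ≠ ∞ := measure_ball_lt_top.ne
  set D := volume (Metric.closedBall (0 : Fin n → ℝ) K) with hD
  have hD1 : D ≠ ∞ := measure_closedBall_lt_top.ne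
  set C := br K ^ M * (D / v) with hC
  have hCt : C ≠ ∞ := ENNReal.mul_ne_top (brn_ne_top M K) (ENNReal.div_ne_top hD1 hv0)
  refine ⟨C.toNNReal, fun L hL hLs a u hu x => ?_⟩
  rw [ENNReal.coe_toNNReal hCt]
  obtain ⟨c, hc0, hc1, hc⟩ := change_var L
  have hcD : c ≤ D / v := by
    rw [ENNReal.le_div_iff_mul_le (Or.inl hv0) (Or.inl hv1)]
    have h1 := hc ((Metric.ball (0:X) 1).indicator 1)
    rw [lintegral_indicator_one measurableSet_ball] at h1
    rw [← h1]
    have : (fun z => (Metric.ball (0:X) 1).indicator (1 : X → ℝ≥0∞) (L z)) ≤ (Metric.closedBall (0 : Fin n → ℝ) K).indicator 1 := by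
      intro z
      by_cases hz : L z ∈ Metric.ball (0:X) 1
      · have : z ∈ Metric.closedBall (0 : Fin n → ℝ) K := by
          rw [mem_closedBall_zero_iff]
          rw [mem_ball_zero_iff] at hz
          have hK : 0 ≤ K := (norm_nonneg _).trans hLs
          calc ‖z‖ = ‖L.symm (L z)‖ := by rw [L.symm_apply_apply]
            _ ≤ ‖(L.symm : X →L[ℝ] (Fin n → ℝ))‖ * ‖L z‖ := (L.symm : X →L[ℝ] (Fin n → ℝ)).le_opNorm _
            _ ≤ K * 1 := by gcongr
            _ = K := mul_one K
        simp [Set.indicator_of_mem hz, Set.indicator_of_mem this]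
      · simp [Set.indicator_of_notMem hz]
    calc _ ≤ ∫⁻ z, (Metric.closedBall (0 : Fin n → ℝ) K).indicator 1 z := lintegral_mono this
      _ = D := lintegral_indicator_one measurableSet_closedBall
  unfold PP
  rw [mu_eq, ← lintegral_indicator (Q_meas n)]
  have hm : Measurable (fun y => u (x + a • y) * Phi M y) := (hu.comp (by fun_prop)).mul (measurable_Phi M)
  calc ∫⁻ z, (Q n).indicator (fun z => u (x + a • (L : (Fin n → ℝ) →L[ℝ] X) z)) z
      ≤ ∫⁻ z, br K ^ M * (fun y => u (x + a • y) * Phi M y) (L z) := by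
        refine lintegral_mono fun z => ?_
        by_cases hz : z ∈ Q n
        · rw [Set.indicator_of_mem hz]
          have hz1 : ‖z‖ ≤ 1 := by
            rw [pi_norm_le_iff_of_nonneg zero_le_one]
            intro i; have := (mem_Q z).1 hz i; rw [Real.norm_eq_abs]; linarith
          have hK : 0 ≤ K := (norm_nonneg _).trans hL
          have hLz : ‖L z‖ ≤ K := by
            calc ‖L z‖ ≤ ‖(L : (Fin n → ℝ) →L[ℝ] X)‖ * ‖z‖ := (L : (Fin n → ℝ) →L[ℝ] X).le_opNorm z
              _ ≤ K * 1 := by gcongr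
              _ = K := mul_one K
          calc u (x + a • L z) = u (x + a • L z) * (br ‖L z‖ ^ M * Phi M (L z)) := by rw [Phi_mul, mul_one]
            _ ≤ u (x + a • L z) * (br K ^ M * Phi M (L z)) := by gcongr; exact br_mono hLz
            _ = _ := by ring
        · simp [Set.indicator_of_notMem hz]
    _ = br K ^ M * (c * ∫⁻ y, u (x + a • y) * Phi M y) := by
        rw [lintegral_const_mul]
        · congr 1; exact hc (fun y => u (x + a • y) * Phi M y)
        · exact hm.comp (by fun_prop)
    _ ≤ br K ^ M * (D / v * ∫⁻ y, u (x + a • y) * Phi M y) := by gcongr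
    _ = _ := by rw [hC, mul_assoc]; rfl

end

end Dcp

end


section
open MeasureTheory Real
open scoped RealInnerProductSpace ENNReal NNReal

set_option linter.all false
namespace Dcp

section
variable {d : ℕ}

def cap (s : ℝ) (c : V d) : Set (X d) := {ω | ‖ω.1 - c‖ ≤ s ∧ |ω.2 - ‖ω.1‖ ^ 2| ≤ s ^ 2}

/-- squared weighted norm -/
def nq (p : ℝ) (Ω : X d → ℝ≥0∞) (F : X d → ℂ) : ℝ≥0∞ := (∫⁻ x, ‖F x‖ₑ ^ p * Ω x) ^ (2 / p)

def Fam {ι : Type} (A s : ℝ) (B : ℕ) (S : Finset ι) (c : ι → V d) (F : ι → X d → ℂ) : Prop :=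
  (∀ θ ∈ S, ‖c θ‖ ≤ A) ∧ (∀ v, {θ | θ ∈ S ∧ ‖c θ - v‖ ≤ s}.ncard ≤ B) ∧ (∀ θ ∈ S, F θ ∈ ES (cap s (c θ))) ∧
    ∀ θ, F θ ∈ ES Set.univ

def Dec (d : ℕ) (p : ℝ) (E B : ℕ) (A s : ℝ) (Xc : ℝ≥0∞) : Prop :=
  ∀ Ω : X d → ℝ≥0∞, Wt E (s ^ 2) Ω → ∀ (ι : Type) (S : Finset ι) (c : ι → V d) (F : ι → X d → ℂ),
    Fam A s B S c F → nq p Ω (∑ θ ∈ S, F θ) ≤ Xc * ∑ θ ∈ S, nq p Ω (F θ)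

lemma Fam.subset {ι : Type} {A s : ℝ} {B : ℕ} {S S' : Finset ι} {c : ι → V d} {F : ι → X d → ℂ}
    (h : Fam A s B S c F) (hS : S' ⊆ S) : Fam A s B S' c F := by
  refine ⟨fun θ hθ => h.1 θ (hS hθ), fun v => le_trans (Set.ncard_le_ncard ?_ ?_) (h.2.1 v), fun θ hθ => h.2.2.1 θ (hS hθ), h.2.2.2⟩
  · intro θ hθ; exact ⟨hS hθ.1, hθ.2⟩
  · exact S.finite_toSet.subset fun θ hθ => hθ.1

lemma Fam.mono {ι : Type} {A A' s : ℝ} {B B' : ℕ} {S : Finset ι} {c : ι → V d} {F : ι → X d → ℂ}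
    (h : Fam A s B S c F) (hA : A ≤ A') (hB : B ≤ B') : Fam A' s B' S c F :=
  ⟨fun θ hθ => (h.1 θ hθ).trans hA, fun v => (h.2.1 v).trans hB, h.2.2⟩

lemma Dec.mono {p : ℝ} {E B B' : ℕ} {A A' s : ℝ} {Xc Xc' : ℝ≥0∞} (h : Dec d p E B' A' s Xc) (hA : A ≤ A')
    (hB : B ≤ B') (hX : Xc ≤ Xc') : Dec d p E B A s Xc' := by
  intro Ω hΩ ι S c F hF
  refine (h Ω hΩ ι S c F (hF.mono hA hB)).trans ?_
  gcongr

/-- the parabolic map -/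
def par (N : ℝ) (hN : N ≠ 0) (c : V d) : X d ≃L[ℝ] X d :=
  LinearEquiv.toContinuousLinearEquiv
  { toFun := fun y => (N • y.1 - (2 * N ^ 2 * y.2) • c, N ^ 2 * y.2)
    map_add' := by
      intro x y
      ext1
      · simp [smul_add, mul_add, add_smul]; abel
      · simp [mul_add]
    map_smul' := by
      intro a x
      ext1
      · simp [smul_sub, smul_smul]; congr 1
        · congr 1; ring
        · congr 1; ring
      · simp; ring
    invFun := fun y => (N⁻¹ • (y.1 + (2 * y.2) • c), (N ^ 2)⁻¹ * y.2)
    left_inv := by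
      intro y
      ext1
      · simp only [smul_add, smul_sub, smul_smul]
        rw [inv_mul_cancel₀ hN, one_smul, mul_assoc]; abel
      · field_simp
    right_inv := by
      intro y
      ext1
      · simp only [smul_add, smul_sub, smul_smul]
        rw [mul_inv_cancel₀ hN, one_smul, ← mul_assoc N, mul_inv_cancel₀ hN, one_mul]
        have : 2 * N ^ 2 * ((N ^ 2)⁻¹ * y.2) = 2 * y.2 := by field_simp
        rw [this]; abel
      · field_simp }

lemma par_apply (N : ℝ) (hN : N ≠ 0) (c : V d) (y : X d) :
    par N hN c y = (N • y.1 - (2 * N ^ 2 * y.2) • c, N ^ 2 * y.2) := rfl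

lemma par_ph (N : ℝ) (hN : N ≠ 0) (c : V d) (y ω : X d) :
    ph (par N hN c y) (ω - (c, ‖c‖ ^ 2)) = ph y (N • (ω.1 - c), N ^ 2 * (ω.2 - ‖ω.1‖ ^ 2 + ‖ω.1 - c‖ ^ 2)) := by
  have h1 : ‖ω.1 - c‖ ^ 2 = ‖ω.1‖ ^ 2 - 2 * ⟪ω.1, c⟫ + ‖c‖ ^ 2 := norm_sub_sq_real _ _
  have h2 : ⟪c, c⟫ = ‖c‖ ^ 2 := real_inner_self_eq_norm_sq c
  rw [h1, par_apply]
  simp only [ph, Prod.fst_sub, Prod.snd_sub, inner_sub_left, inner_sub_right, inner_smul_left, inner_smul_right,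
    conj_trivial, h2]
  rw [real_inner_comm c ω.1]
  ring

lemma par_norm_le {N : ℝ} (hN : N ≠ 0) (hN1 : 1 ≤ N) {c : V d} {A : ℝ} (hc : ‖c‖ ≤ A) (y : X d) :
    ‖par N hN c y‖ ≤ (1 + 2 * A) * N ^ 2 * ‖y‖ := by
  have hA : 0 ≤ A := (norm_nonneg _).trans hc
  have h1 : ‖y.1‖ ≤ ‖y‖ := norm_fst_le y
  have h2 : |y.2| ≤ ‖y‖ := norm_snd_le y
  have h3 : N ≤ N ^ 2 := by nlinarith
  have h0 : 0 ≤ ‖y‖ := norm_nonneg _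
  rw [par_apply, Prod.norm_def]
  apply max_le
  · refine (norm_sub_le _ _).trans ?_
    simp only [norm_smul, Real.norm_eq_abs, abs_mul, abs_of_nonneg (show 0 ≤ N by linarith), abs_pow, abs_two]
    calc N * ‖y.1‖ + 2 * N ^ 2 * |y.2| * ‖c‖ ≤ N ^ 2 * ‖y‖ + 2 * N ^ 2 * ‖y‖ * A := by gcongr
      _ = _ := by ring
  · simp only [Real.norm_eq_abs, abs_mul, abs_of_nonneg (show 0 ≤ N by linarith), abs_pow]
    calc N ^ 2 * |y.2| ≤ N ^ 2 * ‖y‖ := by gcongr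
      _ ≤ _ := by nlinarith [mul_nonneg (mul_nonneg hA (sq_nonneg N)) h0]

lemma ES_par {S S' : Set (X d)} (T : X d → X d) (ω0 : X d) (h : ∀ ω ∈ S, ∃ ω' ∈ S', ∀ y, ph (T y) (ω - ω0) = ph y ω')
    {F : X d → ℂ} (hF : F ∈ ES S) : (fun x => chr (-ω0) (T x) * F (T x)) ∈ ES S' := by
  induction hF using Submodule.span_induction with
  | mem F hF =>
    obtain ⟨ω, hω, rfl⟩ := hF
    obtain ⟨ω', hω', h'⟩ := h ω hω
    have : (fun x => chr (-ω0) (T x) * chr ω (T x)) = chr ω' := by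
      ext x
      simp only [chr, ← ee_add, ← h' x]
      rw [← ph_add_right]; congr 2; abel
    rw [this]
    exact Submodule.subset_span ⟨ω', hω', rfl⟩
  | zero =>
    convert (ES S').zero_mem using 1
    ext x; simp
  | add F G _ _ h1 h2 =>
    convert (ES S').add_mem h1 h2 using 1
    ext x; simp [mul_add]
  | smul a F _ h1 =>
    convert (ES S').smul_mem a h1 using 1
    ext x; simp; ring

lemma cap_par {N s : ℝ} (hN : N ≠ 0) (hN1 : 1 ≤ N) {c0 c : V d} {ω : X d} (hω : ω ∈ cap s c) :
    ∃ ω' ∈ cap (N * s) (N • (c - c0)), ∀ y, ph (par N hN c0 y) (ω - (c0, ‖c0‖ ^ 2)) = ph y ω' := by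
  refine ⟨_, ?_, fun y => par_ph N hN c0 y ω⟩
  refine ⟨?_, ?_⟩
  · rw [← smul_sub, norm_smul, Real.norm_eq_abs, abs_of_nonneg (by linarith)]
    have : ω.1 - c0 - (c - c0) = ω.1 - c := by abel
    rw [this]
    exact mul_le_mul_of_nonneg_left hω.1 (by linarith)
  · simp only [norm_smul, Real.norm_eq_abs, mul_pow, sq_abs]
    rw [mul_add, add_sub_cancel_right, abs_mul, abs_of_nonneg (sq_nonneg N)]
    exact mul_le_mul_of_nonneg_left hω.2 (sq_nonneg N)

lemma rescale {p : ℝ} (hp : 2 ≤ p) {E B : ℕ} {A A1 s N : ℝ} {Xc : ℝ≥0∞} (hN1 : 1 ≤ N) {c0 : V d} (hc0 : ‖c0‖ ≤ A)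
    (hD : Dec d p E B A1 (s * N) Xc) {Ω : X d → ℝ≥0∞} (hΩ : Wt E (s ^ 2) Ω) {ι : Type} {S : Finset ι} {c : ι → V d}
    {F : ι → X d → ℂ} (hF : Fam A s B S c F) (hc : ∀ θ ∈ S, N * ‖c θ - c0‖ ≤ A1) :
    nq p Ω (∑ θ ∈ S, F θ) ≤ ENNReal.ofReal (1 + 2 * A) ^ E * Xc * ∑ θ ∈ S, nq p Ω (F θ) := by
  have hN0 : N ≠ 0 := by linarith
  have hA : 0 ≤ A := (norm_nonneg _).trans hc0
  set T := par N hN0 c0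
  obtain ⟨k, hk0, hkt, hk⟩ := change_var T
  set K := ENNReal.ofReal (1 + 2 * A) ^ E with hK
  have hK1 : 1 ≤ K := by
    rw [hK]; apply one_le_pow₀
    rw [← ENNReal.ofReal_one]; exact ENNReal.ofReal_le_ofReal (by linarith)
  set Ω' := reg E ((s * N) ^ 2) (fun x => Ω (T x)) with hΩ'
  have hreg : ∀ x, Ω' x ≤ K * Ω (T x) := by
    apply reg_le (by positivity)
    intro x y
    rw [map_add]
    refine (hΩ.2 _ _).trans ?_
    rw [hK, ← mul_pow]
    gcongr
    refine (br_mono ?_).trans ((br_mul_le (a := 1 + 2 * A) (b := (s * N) ^ 2 * ‖y‖) (by positivity)).trans ?_)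
    · calc s ^ 2 * ‖T y‖ ≤ s ^ 2 * ((1 + 2 * A) * N ^ 2 * ‖y‖) :=
            mul_le_mul_of_nonneg_left (par_norm_le hN0 hN1 hc0 y) (sq_nonneg s)
        _ = _ := by ring
    · rw [max_eq_right (by linarith)]
  set ω0 : X d := (c0, ‖c0‖ ^ 2)
  set G : ι → X d → ℂ := fun θ x => chr (-ω0) (T x) * F θ (T x) with hG
  have hGn : ∀ (H : X d → ℂ) x, ‖chr (-ω0) (T x) * H (T x)‖ₑ = ‖H (T x)‖ₑ := by
    intro H x
    rw [enorm_mul, ← ofReal_norm, norm_chr]; simp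
  have hsum : (∑ θ ∈ S, G θ) = fun x => chr (-ω0) (T x) * (∑ θ ∈ S, F θ) (T x) := by
    ext x; simp [hG, Finset.mul_sum]
  have hD' := hD Ω' (reg_wt (by positivity) _) ι S (fun θ => N • (c θ - c0)) G ?_
  · have h1 : ∀ H : X d → ℂ, k ^ (2 / p) * nq p Ω H ≤ nq p Ω' (fun x => chr (-ω0) (T x) * H (T x)) := by
      intro H
      unfold nq
      rw [← ENNReal.mul_rpow_of_nonneg _ _ (by positivity), ← hk (fun x => ‖H x‖ₑ ^ p * Ω x)]
      gcongr with x
      · exact (hGn H x).ge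
      · exact le_reg E ((s * N) ^ 2) (fun x => Ω (T x)) x
    have h2 : ∀ H : X d → ℂ, nq p Ω' (fun x => chr (-ω0) (T x) * H (T x)) ≤ K * (k ^ (2 / p) * nq p Ω H) := by
      intro H
      unfold nq
      rw [← ENNReal.mul_rpow_of_nonneg _ _ (by positivity), ← hk (fun x => ‖H x‖ₑ ^ p * Ω x)]
      calc (∫⁻ x, ‖chr (-ω0) (T x) * H (T x)‖ₑ ^ p * Ω' x) ^ (2 / p)
          ≤ (∫⁻ x, K * (‖H (T x)‖ₑ ^ p * Ω (T x))) ^ (2 / p) := by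
            refine ENNReal.rpow_le_rpow (lintegral_mono fun x => ?_) (by positivity)
            beta_reduce
            rw [hGn, mul_left_comm]
            exact mul_le_mul_right (hreg x) _
        _ = K ^ (2 / p) * (∫⁻ x, ‖H (T x)‖ₑ ^ p * Ω (T x)) ^ (2 / p) := by
            rw [lintegral_const_mul' _ _ (by finiteness), ENNReal.mul_rpow_of_nonneg _ _ (by positivity)]
        _ ≤ K * (∫⁻ x, ‖H (T x)‖ₑ ^ p * Ω (T x)) ^ (2 / p) := by
            gcongr
            calc K ^ (2 / p) ≤ K ^ (1 : ℝ) := ENNReal.rpow_le_rpow_of_exponent_le hK1 (by rw [div_le_one (by linarith)]; exact hp)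
              _ = K := ENNReal.rpow_one K
    have hkp0 : k ^ (2 / p) ≠ 0 := (ENNReal.rpow_pos (pos_iff_ne_zero.2 hk0) hkt).ne'
    have hkpt : k ^ (2 / p) ≠ ∞ := ENNReal.rpow_ne_top_of_nonneg (by positivity) hkt
    rw [← ENNReal.mul_le_mul_iff_right hkp0 hkpt]
    refine (h1 _).trans ?_
    rw [← hsum]
    refine hD'.trans ?_
    calc Xc * ∑ θ ∈ S, nq p Ω' (G θ) ≤ Xc * ∑ θ ∈ S, K * (k ^ (2 / p) * nq p Ω (F θ)) := by
          gcongr with θ hθ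
          exact h2 _
      _ = _ := by rw [← Finset.mul_sum, ← Finset.mul_sum]; ring
  · refine ⟨fun θ hθ => ?_, fun v => ?_, fun θ hθ => ?_, fun θ => ?_⟩
    · rw [norm_smul, Real.norm_eq_abs, abs_of_nonneg (by linarith)]; exact hc θ hθ
    · refine le_trans (Set.ncard_le_ncard ?_ ?_) (hF.2.1 (c0 + N⁻¹ • v))
      · intro θ hθ
        refine ⟨hθ.1, ?_⟩
        have h1 : N • (c θ - c0) - v = N • (c θ - (c0 + N⁻¹ • v)) := by
          rw [smul_sub, smul_sub, smul_add, smul_smul, mul_inv_cancel₀ hN0, one_smul]; abel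
        have h2 := hθ.2
        rw [h1, norm_smul, Real.norm_eq_abs, abs_of_nonneg (by linarith), mul_comm s N] at h2
        exact le_of_mul_le_mul_left h2 (by linarith)
      · exact S.finite_toSet.subset fun θ hθ => hθ.1
    · refine ES_par T ω0 (fun ω hω => ?_) (hF.2.2.1 θ hθ)
      rw [mul_comm s N]
      exact cap_par hN0 hN1 hω
    · exact ES_par T ω0 (fun ω hω => ⟨_, Set.mem_univ _, fun y => par_ph N hN0 c0 y ω⟩) (hF.2.2.2 θ)

end

end Dcp

end


section
open MeasureTheory Real
open scoped RealInnerProductSpace ENNReal NNReal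

set_option linter.all false
namespace Dcp

section
open Classical
variable {ι κ κ' : Type}

def cells (f : ι → κ) (S : Finset ι) : Finset (Finset ι) := S.image (fun θ => S.filter (fun θ' => f θ' = f θ))

lemma mem_cells {f : ι → κ} {S J : Finset ι} : J ∈ cells f S ↔ ∃ θ ∈ S, S.filter (fun θ' => f θ' = f θ) = J := by
  simp [cells]

lemma cells_sub {f : ι → κ} {S J : Finset ι} (h : J ∈ cells f S) : J ⊆ S := by
  obtain ⟨θ, hθ, rfl⟩ := mem_cells.1 h; exact Finset.filter_subset _ _

lemma cells_nonempty {f : ι → κ} {S J : Finset ι} (h : J ∈ cells f S) : J.Nonempty := by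
  obtain ⟨θ, hθ, rfl⟩ := mem_cells.1 h; exact ⟨θ, by simp [hθ]⟩

lemma cells_eq {f : ι → κ} {S J : Finset ι} (h : J ∈ cells f S) {θ θ' : ι} (hθ : θ ∈ J) (hθ' : θ' ∈ J) : f θ = f θ' := by
  obtain ⟨θ0, hθ0, rfl⟩ := mem_cells.1 h
  simp at hθ hθ'; rw [hθ.2, hθ'.2]

lemma cells_filter {f : ι → κ} {S J : Finset ι} (h : J ∈ cells f S) {θ : ι} (hθ : θ ∈ J) :
    J = S.filter (fun θ' => f θ' = f θ) := by
  obtain ⟨θ0, hθ0, rfl⟩ := mem_cells.1 h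
  simp at hθ; rw [hθ.2]

lemma cells_sum {M : Type*} [AddCommMonoid M] (f : ι → κ) (S : Finset ι) (g : ι → M) :
    ∑ J ∈ cells f S, ∑ θ ∈ J, g θ = ∑ θ ∈ S, g θ := by
  rw [← Finset.sum_fiberwise_of_maps_to (t := cells f S) (g := fun θ => S.filter (fun θ' => f θ' = f θ))]
  · refine Finset.sum_congr rfl fun J hJ => Finset.sum_congr ?_ fun _ _ => rfl
    ext θ
    simp only [Finset.mem_filter]
    constructor
    · intro h; exact ⟨cells_sub hJ h, (cells_filter hJ h).symm⟩
    · rintro ⟨h1, rfl⟩; simp [h1]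
  · intro θ hθ; exact mem_cells.2 ⟨θ, hθ, rfl⟩

lemma cells_cells_iff {f : ι → κ} {g : ι → κ'} {S : Finset ι} (h : ∀ θ θ', g θ = g θ' → f θ = f θ')
    {J K : Finset ι} (hJ : J ∈ cells f S) : K ∈ cells g J ↔ K ∈ cells g S ∧ ∃ θ ∈ K, θ ∈ J := by
  have key : ∀ θ ∈ J, J.filter (fun θ' => g θ' = g θ) = S.filter (fun θ' => g θ' = g θ) := by
    intro θ hθ
    ext θ'
    rw [cells_filter hJ hθ]
    simp only [Finset.mem_filter, and_assoc, and_congr_right_iff, and_iff_right_iff_imp]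
    intro _ h'; exact h _ _ h'
  constructor
  · intro hK
    obtain ⟨θ, hθ, rfl⟩ := mem_cells.1 hK
    exact ⟨mem_cells.2 ⟨θ, cells_sub hJ hθ, (key θ hθ).symm⟩, θ, by simp [hθ], hθ⟩
  · rintro ⟨hK, θ, hθK, hθJ⟩
    exact mem_cells.2 ⟨θ, hθJ, by rw [key θ hθJ, ← cells_filter hK hθK]⟩

lemma cells_refine {M : Type*} [AddCommMonoid M] {f : ι → κ} {g : ι → κ'} {S : Finset ι}
    (h : ∀ θ θ', g θ = g θ' → f θ = f θ') (φ : Finset ι → M) :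
    ∑ J ∈ cells f S, ∑ K ∈ cells g J, φ K = ∑ K ∈ cells g S, φ K := by
  rw [← Finset.sum_biUnion]
  · refine Finset.sum_congr ?_ fun _ _ => rfl
    ext K
    simp only [Finset.mem_biUnion]
    constructor
    · rintro ⟨J, hJ, hK⟩; exact ((cells_cells_iff h hJ).1 hK).1
    · intro hK
      obtain ⟨θ, hθ⟩ := cells_nonempty hK
      have hJ : S.filter (fun θ' => f θ' = f θ) ∈ cells f S := mem_cells.2 ⟨θ, cells_sub hK hθ, rfl⟩
      exact ⟨_, hJ, (cells_cells_iff h hJ).2 ⟨hK, θ, hθ, by simp [cells_sub hK hθ]⟩⟩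
  · intro J hJ J' hJ' hne
    rw [Function.onFun, Finset.disjoint_left]
    intro K hK hK'
    apply hne
    obtain ⟨θ, hθ⟩ := cells_nonempty hK
    rw [cells_filter hJ (cells_sub hK hθ), cells_filter hJ' (cells_sub hK' hθ)]

lemma cells_card_le (f : ι → κ) (S : Finset ι) (t : Finset κ) (h : ∀ θ ∈ S, f θ ∈ t) : (cells f S).card ≤ t.card := by
  refine le_trans ?_ (Finset.card_le_card (Finset.image_subset_iff.2 h))
  have : cells f S = (S.image f).image (fun k => S.filter (fun θ' => f θ' = k)) := by
    rw [Finset.image_image]; rfl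
  rw [this]
  exact Finset.card_image_le

end

section
variable {d : ℕ}
open Classical

def lab (N : ℕ) (v : V d) : Fin d → ℤ := fun i => ⌊(N : ℝ) * v i⌋

lemma norm_le_of_coord (v : V d) {r : ℝ} (hr : 0 ≤ r) (h : ∀ i, |v i| ≤ r) : ‖v‖ ≤ d * r := by
  rw [EuclideanSpace.norm_eq]
  apply Real.sqrt_le_iff.2 ⟨by positivity, ?_⟩
  calc ∑ i, ‖v i‖ ^ 2 ≤ ∑ i : Fin d, r ^ 2 := by gcongr with i; exact h i
    _ = d * r ^ 2 := by simp
    _ ≤ (d * r) ^ 2 := by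
      rw [mul_pow]
      gcongr
      rcases Nat.eq_zero_or_pos d with h0 | h0
      · subst h0; simp
      · have : (1 : ℝ) ≤ d := by exact_mod_cast h0
        nlinarith

lemma coord_le (v : V d) (i : Fin d) : |v i| ≤ ‖v‖ := PiLp.norm_apply_le v i

lemma lab_close {N : ℕ} (hN : 0 < N) {v v' : V d} (h : lab N v = lab N v') : (N : ℝ) * ‖v - v'‖ ≤ d := by
  have hN' : (0 : ℝ) < N := by exact_mod_cast hN
  have h1 : ‖(N : ℝ) • (v - v')‖ ≤ d * 1 := by
    apply norm_le_of_coord _ zero_le_one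
    intro i
    have := Int.abs_sub_lt_one_of_floor_eq_floor (congrFun h i)
    have e : ((N : ℝ) • (v - v')) i = N * v i - N * v' i := by simp [mul_sub]
    rw [e]; exact this.le
  rwa [norm_smul, Real.norm_eq_abs, abs_of_pos hN', mul_one] at h1

lemma lab_refine {N k : ℕ} (hk : 0 < k) {v v' : V d} (h : lab (N * k) v = lab (N * k) v') : lab N v = lab N v' := by
  have key : ∀ w : V d, ∀ i, lab N w i = lab (N * k) w i / (k : ℤ) := by
    intro w i
    have hk' : (0 : ℝ) < k := by exact_mod_cast hk
    unfold lab
    have : (N : ℝ) * w i = ((N * k : ℕ) * w i) / (k : ℝ) := by push_cast; field_simp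
    rw [this, Int.floor_div_natCast]
  ext i; rw [key, key, h]

lemma lab_far {N : ℕ} {v v' : V d} {m : ℕ} (h : ¬ ∀ i, |lab N v i - lab N v' i| ≤ m) : (m : ℝ) ≤ N * ‖v - v'‖ := by
  push Not at h
  obtain ⟨i, hi⟩ := h
  have h1 : |v i - v' i| ≤ ‖v - v'‖ := coord_le (v - v') i
  have h2 : (m : ℝ) + 1 ≤ |(lab N v i : ℝ) - lab N v' i| := by exact_mod_cast hi
  have h3 : |(lab N v i : ℝ) - lab N v' i| ≤ N * |v i - v' i| + 1 := by
    unfold lab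
    have a1 := Int.floor_le ((N : ℝ) * v i)
    have a2 := Int.lt_floor_add_one ((N : ℝ) * v i)
    have a3 := Int.floor_le ((N : ℝ) * v' i)
    have a4 := Int.lt_floor_add_one ((N : ℝ) * v' i)
    have a5 : (N : ℝ) * |v i - v' i| = |N * v i - N * v' i| := by
      rw [← mul_sub, abs_mul, abs_of_nonneg (show (0:ℝ) ≤ N from Nat.cast_nonneg N)]
    rw [a5]
    have b1 := le_abs_self ((N : ℝ) * v i - N * v' i)
    have b2 := neg_abs_le ((N : ℝ) * v i - N * v' i)
    rw [abs_le]; constructor <;> linarith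
  have h4 : (N : ℝ) * |v i - v' i| ≤ N * ‖v - v'‖ := by gcongr
  linarith

def labBox (d N A : ℕ) : Finset (Fin d → ℤ) := Fintype.piFinset fun _ => Finset.Icc (-(N * A : ℤ)) (N * A)

lemma labBox_card (d N A : ℕ) : (labBox d N A).card = (2 * N * A + 1) ^ d := by
  simp only [labBox, Fintype.card_piFinset, Int.card_Icc, Finset.prod_const, Finset.card_univ, Fintype.card_fin]
  congr 1
  have : ((N * A : ℤ) + 1 - -(N * A : ℤ)) = ((2 * N * A + 1 : ℕ) : ℤ) := by push_cast; ring
  rw [this, Int.toNat_natCast]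

lemma lab_mem {N A : ℕ} {v : V d} (h : ‖v‖ ≤ A) : lab N v ∈ labBox d N A := by
  simp only [labBox, Fintype.mem_piFinset, Finset.mem_Icc, lab]
  intro i
  have h1 := abs_le.1 ((coord_le v i).trans h)
  have h0 : (0 : ℝ) ≤ N := Nat.cast_nonneg N
  constructor
  · apply Int.le_floor.2; push_cast
    nlinarith [h1.1]
  · have h2 : ⌊(N : ℝ) * v i⌋ ≤ ⌊((N * A : ℤ) : ℝ)⌋ := by
      apply Int.floor_le_floor
      push_cast; nlinarith [h1.2]
    rwa [Int.floor_intCast] at h2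

def FS {ι : Type} (F : ι → X d → ℂ) (J : Finset ι) : X d → ℂ := ∑ θ ∈ J, F θ

/-- cells of scale `1/N` -/
def gc {ι : Type} (c : ι → V d) (N : ℕ) (S : Finset ι) : Finset (Finset ι) := cells (fun θ => lab N (c θ)) S

lemma gc_FS {ι : Type} (c : ι → V d) (N : ℕ) (S : Finset ι) (F : ι → X d → ℂ) :
    ∑ J ∈ gc c N S, FS F J = FS F S := cells_sum _ _ _

lemma gc_refine {ι : Type} {M : Type*} [AddCommMonoid M] (c : ι → V d) (N : ℕ) {k : ℕ} (hk : 0 < k) (S : Finset ι)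
    (φ : Finset ι → M) : ∑ J ∈ gc c N S, ∑ K ∈ gc c (N * k) J, φ K = ∑ K ∈ gc c (N * k) S, φ K :=
  cells_refine (fun θ θ' h => lab_refine hk h) φ

lemma gc_close {ι : Type} {c : ι → V d} {N : ℕ} (hN : 0 < N) {S J : Finset ι} (hJ : J ∈ gc c N S) {θ θ' : ι} (hθ : θ ∈ J)
    (hθ' : θ' ∈ J) : (N : ℝ) * ‖c θ - c θ'‖ ≤ d := lab_close hN (cells_eq hJ hθ hθ')

lemma FS_mem {ι : Type} {A s : ℝ} {B : ℕ} {S : Finset ι} {c : ι → V d} {F : ι → X d → ℂ}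
    (h : Fam A s B S c F) (hs : 0 ≤ s) {c0 : V d} {r : ℝ} (hr : 0 ≤ r) (hc : ∀ θ ∈ S, ‖c θ - c0‖ ≤ r) :
    FS F S ∈ ES (cap (r + s) c0) := by
  refine Submodule.sum_mem _ fun θ hθ => ES_mono ?_ (h.2.2.1 θ hθ)
  intro ω hω
  refine ⟨?_, hω.2.trans (by gcongr; linarith)⟩
  have : ω.1 - c0 = (ω.1 - c θ) + (c θ - c0) := by abel
  rw [this]
  refine (norm_add_le _ _).trans ?_
  linarith [hω.1, hc θ hθ]

lemma FS_mem0 {ι : Type} {A s : ℝ} {B : ℕ} {S : Finset ι} {c : ι → V d} {F : ι → X d → ℂ}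
    (h : Fam A s B S c F) (J : Finset ι) : FS F J ∈ ES (Set.univ : Set (X d)) :=
  Submodule.sum_mem _ fun θ hθ => h.2.2.2 θ

/-- a chosen element -/
def ctr {ι : Type} (c : ι → V d) (J : Finset ι) : V d := if h : J.Nonempty then c h.choose else 0

lemma ctr_spec {ι : Type} (c : ι → V d) {J : Finset ι} (h : J.Nonempty) : ∃ θ ∈ J, ctr c J = c θ :=
  ⟨h.choose, h.choose_spec, by simp [ctr, h]⟩

lemma gc_mem {ι : Type} {A s : ℝ} {B : ℕ} {S : Finset ι} {c : ι → V d} {F : ι → X d → ℂ}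
    (h : Fam A s B S c F) (hs : 0 ≤ s) {N : ℕ} (hN : 0 < N) (hsN : s * N ≤ 1) {J : Finset ι} (hJ : J ∈ gc c N S) :
    FS F J ∈ ES (cap ((d + 1) / N) (ctr c J)) := by
  have hN' : (0 : ℝ) < N := by exact_mod_cast hN
  obtain ⟨θ, hθ, e⟩ := ctr_spec c (cells_nonempty hJ)
  rw [e]
  have h1 := FS_mem (h.subset (cells_sub hJ)) hs (c0 := c θ) (r := d / N) (by positivity)
    (fun θ' hθ' => by rw [le_div_iff₀' hN']; exact gc_close hN hJ hθ' hθ)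
  refine ES_mono ?_ h1
  intro ω hω
  have h2 : (d : ℝ) / N + s ≤ (d + 1) / N := by
    rw [add_div]; gcongr; rw [le_div_iff₀ hN']; exact hsN
  exact ⟨hω.1.trans h2, hω.2.trans (by gcongr)⟩

lemma l2cells (d M : ℕ) : ∃ C : ℝ≥0, ∀ (N : ℕ), 0 < N → ∀ s : ℝ, s * N ≤ 1 → ∀ (ι : Type) (A : ℝ) (B : ℕ)
    (S : Finset ι) (c : ι → V d) (F : ι → X d → ℂ), Fam A s B S c F → ∀ x,
    avg M (iso d N) (fun x => ‖FS F S x‖ₑ ^ (2 : ℝ)) x ≤ C * ∑ K ∈ gc c N S, avg M (iso d N) (fun x => ‖FS F K x‖ₑ ^ (2 : ℝ)) x := by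
  obtain ⟨C, hC⟩ := l2orth d M
  refine ⟨C * ((9 ^ d : ℕ) : ℝ≥0), ?_⟩
  intro N hN s hsN ι A B S c F hF x
  have hN' : (0 : ℝ) < N := by exact_mod_cast hN
  let lb : (gc c N S) → Fin d → ℤ := fun K => lab N (c (cells_nonempty K.2).choose)
  have hlb : ∀ K : gc c N S, ∀ θ ∈ K.1, lab N (c θ) = lb K := fun K θ hθ =>
    cells_eq K.2 hθ (cells_nonempty K.2).choose_spec
  have hinj : Function.Injective lb := by
    intro K K' h
    obtain ⟨θ, hθ⟩ := cells_nonempty K.2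
    obtain ⟨θ', hθ'⟩ := cells_nonempty K'.2
    apply Subtype.ext
    rw [cells_filter K.2 hθ, cells_filter K'.2 hθ']
    have e1 := hlb K θ hθ
    have e2 := hlb K' θ' hθ'
    simp only [e1, e2, h]
  have h1 := hC (N : ℝ) (ι := gc c N S) (fun K => ⋃ θ ∈ K.1, cap s (c θ)) (fun K => FS F K.1)
    (fun K => Submodule.sum_mem _ fun θ hθ => ES_mono (Set.subset_biUnion_of_mem hθ) (hF.2.2.1 θ (cells_sub K.2 hθ)))
    (fun K K' => ∀ i, |lb K i - lb K' i| ≤ 4) (fun K K' h i => by rw [abs_sub_comm]; exact h i) ?_ (9 ^ d) ?_ x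
  · have e : (fun x => ‖∑ K : gc c N S, FS F K.1 x‖ₑ ^ (2 : ℝ)) = fun x => ‖FS F S x‖ₑ ^ (2 : ℝ) := by
      ext x
      rw [← gc_FS c N S F, Finset.sum_apply, Finset.sum_coe_sort (gc c N S) (fun K => FS F K x)]
    rw [e] at h1
    rw [← Finset.sum_coe_sort]
    refine h1.trans (le_of_eq ?_)
    push_cast; rfl
  · intro K K' hn ω hω ω' hω'
    simp only [Set.mem_iUnion] at hω hω'
    obtain ⟨θ, hθ, h1⟩ := hω
    obtain ⟨θ', hθ', h2⟩ := hω'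
    rw [← hlb K θ hθ, ← hlb K' θ' hθ'] at hn
    have h3 := lab_far (m := 4) (by exact_mod_cast hn)
    have h4 : ‖c θ - c θ'‖ ≤ ‖ω.1 - ω'.1‖ + 2 * s := by
      have : c θ - c θ' = (ω.1 - ω'.1) - (ω.1 - c θ) + (ω'.1 - c θ') := by abel
      rw [this]
      refine (norm_add_le _ _).trans ((add_le_add_left (norm_sub_le _ _) _).trans ?_)
      linarith [h1.1, h2.1]
    rw [abs_of_pos hN']
    push_cast at h3
    nlinarith [mul_le_mul_of_nonneg_left h4 hN'.le]
  · intro K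
    have hb : Set.MapsTo lb {K' | ∀ i, |lb K i - lb K' i| ≤ 4} (Fintype.piFinset fun i => Finset.Icc (lb K i - 4) (lb K i + 4) : Finset (Fin d → ℤ)) := by
      intro K' hK'
      simp only [Finset.mem_coe, Fintype.mem_piFinset, Finset.mem_Icc]
      intro i
      have := abs_le.1 (hK' i)
      constructor <;> linarith [this.1, this.2]
    refine (Set.ncard_le_ncard_of_injOn lb hb hinj.injOn (Finset.finite_toSet _)).trans ?_
    rw [Set.ncard_coe_finset, Fintype.card_piFinset]
    simp only [Int.card_Icc]
    have : ∀ i, (lb K i + 4 + 1 - (lb K i - 4)).toNat = 9 := by intro i; omega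
    simp [this]

end

end Dcp

end


section
open MeasureTheory Real
open scoped RealInnerProductSpace ENNReal NNReal

set_option linter.all false
namespace Dcp

section
variable {d : ℕ}

lemma int_wd {Y : Type*} [MeasurableSpace Y] {μ : Measure Y} {Ω f : Y → ℝ≥0∞} (hΩ : Measurable Ω) (hf : Measurable f) :
    ∫⁻ x, f x * Ω x ∂μ = ∫⁻ x, f x ∂(μ.withDensity Ω) := by
  rw [lintegral_withDensity_eq_lintegral_mul _ hΩ hf]
  simp [mul_comm]

lemma holder_prod {Y : Type*} [MeasurableSpace Y] {μ : Measure Y} {Ω : Y → ℝ≥0∞} (hΩ : Measurable Ω) {n : ℕ} (hn : 0 < n)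
    {f : Fin n → Y → ℝ≥0∞} (hf : ∀ i, Measurable (f i)) {Z : ℝ≥0∞} (h : ∀ i, ∫⁻ x, f i x * Ω x ∂μ ≤ Z) :
    ∫⁻ x, (∏ i, f i x ^ (1 / (n : ℝ))) * Ω x ∂μ ≤ Z := by
  have hn' : (0 : ℝ) < n := by exact_mod_cast hn
  rw [int_wd hΩ (Finset.measurable_prod _ fun i _ => (hf i).pow_const _)]
  refine (ENNReal.lintegral_prod_norm_pow_le Finset.univ (fun i _ => (hf i).aemeasurable) (p := fun _ => 1 / (n : ℝ)) ?_ ?_).trans ?_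
  · simp; field_simp
  · intro i _; positivity
  · calc ∏ i, (∫⁻ a, f i a ∂(μ.withDensity Ω)) ^ (1 / (n : ℝ)) ≤ ∏ i : Fin n, Z ^ (1 / (n : ℝ)) := by
          gcongr with i
          rw [← int_wd hΩ (hf i)]; exact h i
      _ = Z := by
        rw [Finset.prod_const, Finset.card_univ, Fintype.card_fin, ← ENNReal.rpow_natCast, ← ENNReal.rpow_mul]
        rw [one_div_mul_cancel hn'.ne', ENNReal.rpow_one]

lemma cs_int {Y : Type*} [MeasurableSpace Y] {μ : Measure Y} {Ω : Y → ℝ≥0∞} (hΩ : Measurable Ω)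
    {f g : Y → ℝ≥0∞} (hf : Measurable f) (hg : Measurable g) :
    ∫⁻ x, (f x ^ (1 / 2 : ℝ) * g x ^ (1 / 2 : ℝ)) * Ω x ∂μ ≤ (∫⁻ x, f x * Ω x ∂μ) ^ (1 / 2 : ℝ) * (∫⁻ x, g x * Ω x ∂μ) ^ (1 / 2 : ℝ) := by
  rw [int_wd hΩ (f := fun x => f x ^ (1 / 2 : ℝ) * g x ^ (1 / 2 : ℝ)) ((hf.pow_const _).mul (hg.pow_const _)), int_wd hΩ hf, int_wd hΩ hg]
  exact ENNReal.lintegral_mul_norm_pow_le hf.aemeasurable hg.aemeasurable (by norm_num) (by norm_num) (by norm_num)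

lemma cs_sum {ι : Type*} (s : Finset ι) (f g : ι → ℝ≥0∞) :
    ∑ i ∈ s, f i ^ (1 / 2 : ℝ) * g i ^ (1 / 2 : ℝ) ≤ (∑ i ∈ s, f i) ^ (1 / 2 : ℝ) * (∑ i ∈ s, g i) ^ (1 / 2 : ℝ) := by
  have h := ENNReal.inner_le_Lp_mul_Lq s (fun i => f i ^ (1 / 2 : ℝ)) (fun i => g i ^ (1 / 2 : ℝ)) (p := 2) (q := 2) Real.HolderConjugate.two_two
  refine h.trans (le_of_eq ?_)
  simp_rw [← ENNReal.rpow_mul]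
  norm_num

/-- general bound for the `L^p` factors -/
lemma Qbound {p : ℝ} (hp : 2 ≤ p) {E B N' : ℕ} (hN' : d + 2 ≤ N') {A s ρ : ℝ} {N : ℕ} (hA : (d : ℝ) ≤ A) (hN : 0 < N)
    (hρ0 : 0 ≤ ρ) (hρ : s ^ 2 * ρ ≤ 1) {Xc : ℝ≥0∞} (hD : Dec d p E B A (s * N) Xc) {Ω : X d → ℝ≥0∞} (hΩ : Wt E (s ^ 2) Ω)
    {ι : Type} {S0 : Finset ι} {c : ι → V d} {F : ι → X d → ℂ} (hF : Fam A s B S0 c F) {n : ℕ} (hn : 0 < n) (S : Fin n → Finset ι)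
    (hS : ∀ i, S i ⊆ S0) :
    (∫⁻ x, (∏ i, (∑ J ∈ gc c N (S i), (avg (E + N') (iso d ρ) (fun x => ‖FS F J x‖ₑ ^ p) x) ^ (2 / p)) ^ (p / (2 * n))) * Ω x) ^ (2 / p)
      ≤ (∫⁻ y : X d, Phi N' y) ^ (2 / p) * ENNReal.ofReal (1 + 2 * A) ^ E * Xc * ∑ θ ∈ S0, nq p Ω (F θ) := by
  have hp0 : 0 < p := by linarith
  have hN1 : (1 : ℝ) ≤ N := by exact_mod_cast hN
  set I := (∫⁻ y : X d, Phi N' y)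
  set K := ENNReal.ofReal (1 + 2 * A) ^ E
  set R := ∑ θ ∈ S0, nq p Ω (F θ)
  have hm : ∀ J, Measurable fun x => ‖FS F J x‖ₑ ^ p := fun J => ES_meas (FS_mem0 hF J) p
  set v : Finset ι → X d → ℝ≥0∞ := fun J => avg (E + N') (iso d ρ) (fun x => ‖FS F J x‖ₑ ^ p) with hv
  have hvm : ∀ J, Measurable (v J) := fun J => measurable_avg _ _ (hm J)
  set Z := I ^ (2 / p) * K * Xc * R with hZ
  have key : ∀ i, ∫⁻ x, (∑ J ∈ gc c N (S i), (v J x) ^ (2 / p)) ^ (p / 2) * Ω x ≤ Z ^ (p / 2) := by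
    intro i
    have h1 := minkowski' volume (gc c N (S i)) hvm hΩ.1 (r := p / 2) (by linarith)
    rw [one_div_div] at h1
    refine h1.trans ?_
    gcongr
    calc ∑ J ∈ gc c N (S i), (∫⁻ x, v J x * Ω x) ^ (2 / p)
        ≤ ∑ J ∈ gc c N (S i), I ^ (2 / p) * (K * Xc * ∑ θ ∈ J, nq p Ω (F θ)) := by
          gcongr with J hJ
          have hJS : J ⊆ S0 := (cells_sub hJ).trans (hS i)
          have h2 := hΩ.avg_le (sq_nonneg s) N' (iso d ρ) (A := 1) ?_ (hm J)
          · rw [max_self, ENNReal.ofReal_one, one_pow, one_mul] at h2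
            calc (∫⁻ x, v J x * Ω x) ^ (2 / p) ≤ (I * ∫⁻ x, ‖FS F J x‖ₑ ^ p * Ω x) ^ (2 / p) := by gcongr
              _ = I ^ (2 / p) * nq p Ω (FS F J) := ENNReal.mul_rpow_of_nonneg _ _ (by positivity)
              _ ≤ _ := by
                gcongr
                obtain ⟨θ0, hθ0⟩ := cells_nonempty hJ
                refine rescale hp hN1 (hF.1 θ0 (hJS hθ0)) hD hΩ (hF.subset hJS) fun θ hθ => ?_
                exact (gc_close hN hJ hθ hθ0).trans hA
          · refine le_trans ?_ hρ
            gcongr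
            refine ContinuousLinearMap.opNorm_le_bound _ hρ0 fun y => ?_
            rw [iso_apply, norm_smul, Real.norm_eq_abs, abs_of_nonneg hρ0]
      _ = I ^ (2 / p) * K * Xc * ∑ θ ∈ S i, nq p Ω (F θ) := by
          rw [← Finset.mul_sum, ← Finset.mul_sum, gc, cells_sum]; ring
      _ ≤ Z := by
          rw [hZ]; exact mul_le_mul_right (Finset.sum_le_sum_of_subset (hS i)) _
  have h3 := holder_prod hΩ.1 hn (fun i => ?_) key
  · calc _ ≤ (Z ^ (p / 2)) ^ (2 / p) := by
          gcongr
          refine le_trans (le_of_eq ?_) h3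
          congr 1; ext x; congr 1
          refine Finset.prod_congr rfl fun i _ => ?_
          rw [← ENNReal.rpow_mul]; congr 1; field_simp
      _ = Z := by rw [← ENNReal.rpow_mul, div_mul_div_cancel₀ (by norm_num), div_self hp0.ne', ENNReal.rpow_one]
  · exact (Finset.measurable_sum _ fun J _ => (hvm J).pow_const _).pow_const _

lemma lcond_par {N : ℕ} (hN : 0 < N) (hN0 : (N : ℝ) ≠ 0) (c : V d) :
    LCond (par (N : ℝ) hN0 c : X d →L[ℝ] X d) (cap ((d + 1) / N) c) (2 * (d + 1) ^ 2) := by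
  have hN' : (0 : ℝ) < N := by exact_mod_cast hN
  refine ⟨(c, ‖c‖ ^ 2), fun ω hω => ⟨_, ?_, fun y => par_ph _ hN0 c y ω⟩⟩
  have h1 : (N : ℝ) * ‖ω.1 - c‖ ≤ d + 1 := by rw [← le_div_iff₀' hN']; exact hω.1
  have h2 : (N : ℝ) ^ 2 * |ω.2 - ‖ω.1‖ ^ 2| ≤ (d + 1) ^ 2 := by
    rw [← le_div_iff₀' (by positivity), ← div_pow]; exact hω.2
  have hd : (0 : ℝ) ≤ d := Nat.cast_nonneg d
  rw [Prod.norm_def]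
  apply max_le
  · simp only [norm_smul, Real.norm_eq_abs, abs_of_pos hN']
    nlinarith
  · simp only [Real.norm_eq_abs, abs_mul, abs_pow, abs_of_pos hN']
    have h3 := abs_add_le (ω.2 - ‖ω.1‖ ^ 2) (‖ω.1 - c‖ ^ 2)
    rw [abs_of_nonneg (sq_nonneg ‖ω.1 - c‖)] at h3
    have h4 : (N : ℝ) ^ 2 * ‖ω.1 - c‖ ^ 2 ≤ (d + 1) ^ 2 := by
      rw [← mul_pow]; gcongr
    calc _ ≤ (N : ℝ) ^ 2 * (|ω.2 - ‖ω.1‖ ^ 2| + ‖ω.1 - c‖ ^ 2) := by gcongr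
      _ ≤ _ := by rw [mul_add]; linarith

/-- small linear maps -/
def shr (a b : ℝ) (c : V d) (e : ℝ) : X d →L[ℝ] X d :=
  (a • ContinuousLinearMap.fst ℝ (V d) ℝ + (e • ContinuousLinearMap.snd ℝ (V d) ℝ).smulRight c).prod (b • ContinuousLinearMap.snd ℝ (V d) ℝ)

lemma shr_apply (a b : ℝ) (c : V d) (e : ℝ) (y : X d) : shr a b c e y = (a • y.1 + (e * y.2) • c, b * y.2) := by
  simp [shr]

lemma shr_norm {a b : ℝ} {c : V d} {e A : ℝ} (ha : |a| ≤ 1) (hb : |b| ≤ 1) (he : |e| ≤ 2) (hc : ‖c‖ ≤ A) :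
    ‖shr a b c e‖ ≤ 1 + 2 * A := by
  have hA : 0 ≤ A := (norm_nonneg _).trans hc
  refine ContinuousLinearMap.opNorm_le_bound _ (by positivity) fun y => ?_
  have h1 : ‖y.1‖ ≤ ‖y‖ := norm_fst_le y
  have h2 : |y.2| ≤ ‖y‖ := norm_snd_le y
  rw [shr_apply, Prod.norm_def]
  apply max_le
  · refine (norm_add_le _ _).trans ?_
    simp only [norm_smul, Real.norm_eq_abs, abs_mul]
    calc |a| * ‖y.1‖ + |e| * |y.2| * ‖c‖ ≤ 1 * ‖y‖ + 2 * ‖y‖ * A := by gcongr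
      _ = _ := by ring
  · simp only [Real.norm_eq_abs, abs_mul]
    calc |b| * |y.2| ≤ 1 * ‖y‖ := by gcongr
      _ ≤ _ := by nlinarith [norm_nonneg y]

lemma iso_eq_par {N : ℕ} (hN0 : (N : ℝ) ≠ 0) (c : V d) :
    iso d N = (par (N : ℝ) hN0 c : X d →L[ℝ] X d).comp (shr 1 (N : ℝ)⁻¹ c 2) := by
  apply ContinuousLinearMap.ext; intro y
  rw [iso_apply, ContinuousLinearMap.comp_apply, ContinuousLinearEquiv.coe_coe, par_apply, shr_apply]
  ext1
  · simp only [Prod.smul_fst, one_smul, smul_add, smul_smul]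
    have : 2 * (N : ℝ) ^ 2 * ((N : ℝ)⁻¹ * y.2) = N * (2 * y.2) := by field_simp
    rw [this]; abel
  · simp only [Prod.smul_snd, smul_eq_mul]; field_simp

lemma par_eq_iso {N : ℕ} (hN0 : (N : ℝ) ≠ 0) (c : V d) :
    (par (N : ℝ) hN0 c : X d →L[ℝ] X d) = (iso d (N ^ 2)).comp (shr (N : ℝ)⁻¹ 1 c (-2)) := by
  apply ContinuousLinearMap.ext; intro y
  rw [ContinuousLinearMap.comp_apply, iso_apply, ContinuousLinearEquiv.coe_coe, par_apply, shr_apply]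
  ext1
  · simp only [Prod.smul_fst, smul_add, smul_smul]
    have : (N : ℝ) ^ 2 * (-2 * y.2) = - (2 * N ^ 2 * y.2) := by ring
    rw [this, neg_smul, ← sub_eq_add_neg]
    congr 2; field_simp
  · simp

lemma abs_inv_nat_le {N : ℕ} (hN : 0 < N) : |(N : ℝ)⁻¹| ≤ 1 := by
  have hN' : (1 : ℝ) ≤ N := by exact_mod_cast hN
  rw [abs_of_nonneg (by positivity)]; exact inv_le_one_of_one_le₀ hN'

lemma I_ne_top (d : ℕ) {M : ℕ} (hM : d + 2 ≤ M) : ∫⁻ y : X d, Phi M y ≠ ∞ :=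
  lintegral_Phi_ne_top (by rw [finrank_X]; omega)

lemma roundA (d M' : ℕ) (hM' : d + 2 ≤ M') (A : ℝ) {q : ℝ} (hq : 2 ≤ q) : ∃ C : ℝ≥0, ∀ (N : ℕ) (hN : 0 < N) (hN0 : (N : ℝ) ≠ 0)
    (c : V d), ‖c‖ ≤ A → ∀ G ∈ ES (cap (((d : ℝ) + 1) / N) c), ∀ x,
    avg (M' + (d + 2)) (iso d N) (fun x => ‖G x‖ₑ ^ (2 : ℝ)) x ≤
      C * (avg M' (par (N : ℝ) hN0 c : X d →L[ℝ] X d) (fun x => ‖G x‖ₑ ^ q) x) ^ (2 / q) := by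
  obtain ⟨C1, hC1⟩ := loc_const d (2 * ((d : ℝ) + 1) ^ 2) M' hM' (q := q) (by linarith)
  have hI : ∫⁻ y : X d, Phi (M' + (d + 2)) y ≠ ∞ := I_ne_top d (by omega)
  have hI2 : ∫⁻ y : X d, Phi (d + 2) y ≠ ∞ := I_ne_top d le_rfl
  set I := ∫⁻ y : X d, Phi (M' + (d + 2)) y
  set I2 := ∫⁻ y : X d, Phi (d + 2) y
  have ha1 : 2 / q ≤ 1 := by rw [div_le_one (by linarith)]; exact hq
  have ha0 : 0 < 2 / q := by positivity
  set C : ℝ≥0∞ := I ^ (1 - 2 / q) * (C1 * (ENNReal.ofReal (max 1 (1 + 2 * A)) ^ M' * I2)) ^ (2 / q) with hC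
  have hCt : C ≠ ∞ := by
    refine ENNReal.mul_ne_top (ENNReal.rpow_ne_top_of_nonneg (by linarith) hI) (ENNReal.rpow_ne_top_of_nonneg ha0.le ?_)
    exact ENNReal.mul_ne_top (by simp) (ENNReal.mul_ne_top (by finiteness) hI2)
  refine ⟨C.toNNReal, fun N hN hN0 c hc G hG x => ?_⟩
  rw [ENNReal.coe_toNNReal hCt]
  have hm : Measurable fun x => ‖G x‖ₑ ^ q := ES_meas hG q
  have h1 : (fun x => ‖G x‖ₑ ^ (2 : ℝ)) = fun x => (‖G x‖ₑ ^ q) ^ (2 / q) := by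
    ext x; rw [← ENNReal.rpow_mul]; congr 1; field_simp
  rw [h1]
  refine (avg_jensen _ _ hm ha0 ha1 x).trans ?_
  rw [hC, mul_assoc, ← ENNReal.mul_rpow_of_nonneg _ _ ha0.le]
  gcongr
  have h2 : avg (M' + (d + 2)) (iso d N) (fun x => ‖G x‖ₑ ^ q) x ≤ avg (M' + (d + 2)) (iso d N)
      (fun x => C1 * avg M' (par (N : ℝ) hN0 c : X d →L[ℝ] X d) (fun x => ‖G x‖ₑ ^ q) x) x :=
    avg_mono _ _ (hC1 _ _ (lcond_par hN hN0 c) G hG) x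
  refine h2.trans ?_
  rw [avg_const_mul _ _ (measurable_avg _ _ hm), mul_assoc]
  gcongr
  rw [iso_eq_par hN0 c]
  exact absorb _ _ (shr_norm (by simp) (abs_inv_nat_le hN) (by norm_num) hc) hm x

lemma roundD (d M2 : ℕ) (A : ℝ) : ∃ C : ℝ≥0, ∀ (N : ℕ) (hN : 0 < N) (hN0 : (N : ℝ) ≠ 0)
    (c : V d), ‖c‖ ≤ A → ∀ u : X d → ℝ≥0∞, Measurable u → ∀ x,
    avg M2 (iso d (N ^ 2)) (avg (M2 + (d + 2)) (par (N : ℝ) hN0 c : X d →L[ℝ] X d) u) x ≤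
      C * avg M2 (iso d (N ^ 2)) u x := by
  have hI2 : ∫⁻ y : X d, Phi (d + 2) y ≠ ∞ := I_ne_top d le_rfl
  refine ⟨(ENNReal.ofReal (max 1 (1 + 2 * A)) ^ M2 * ∫⁻ y : X d, Phi (d + 2) y).toNNReal, fun N hN hN0 c hc u hu x => ?_⟩
  rw [ENNReal.coe_toNNReal (ENNReal.mul_ne_top (by finiteness) hI2), avg_comm _ _ hu, par_eq_iso hN0 c]
  exact absorb _ _ (shr_norm (abs_inv_nat_le hN) (by simp) (by norm_num) hc) hu x


end

end Dcp

end


section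
open MeasureTheory Real
open scoped RealInnerProductSpace ENNReal NNReal

set_option linter.all false
namespace Dcp

section
variable {d : ℕ}

/-- multilinear integral -/
def mi {d : ℕ} (n : ℕ) (p : ℝ) (Ω : X d → ℝ≥0∞) (f : Fin n → X d → ℝ≥0∞) : ℝ≥0∞ :=
  (∫⁻ x, (∏ i, (f i x) ^ (p / (2 * n))) * Ω x) ^ (2 / p)

lemma mi_le {n : ℕ} (hn : 0 < n) {p : ℝ} (hp : 0 < p) {Ω : X d → ℝ≥0∞} {f g : Fin n → X d → ℝ≥0∞} {c : ℝ≥0∞} (hc : c ≠ ∞)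
    (h : ∀ i x, f i x ≤ c * g i x) : mi n p Ω f ≤ c * mi n p Ω g := by
  have hn' : (0 : ℝ) < n := by exact_mod_cast hn
  have hb : 0 ≤ p / (2 * n) := by positivity
  have e : (c ^ (p / (2 * n))) ^ n = c ^ (p / 2) := by
    rw [← ENNReal.rpow_natCast, ← ENNReal.rpow_mul]; congr 1; field_simp
  have h1 : ∀ x, (∏ i, (f i x) ^ (p / (2 * n))) * Ω x ≤ c ^ (p / 2) * ((∏ i, (g i x) ^ (p / (2 * n))) * Ω x) := by
    intro x
    rw [← mul_assoc]
    gcongr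
    calc ∏ i, (f i x) ^ (p / (2 * n)) ≤ ∏ i, (c * g i x) ^ (p / (2 * n)) := by gcongr with i; exact h i x
      _ = _ := by
        simp_rw [ENNReal.mul_rpow_of_nonneg _ _ hb]
        rw [Finset.prod_mul_distrib, Finset.prod_const, Finset.card_univ, Fintype.card_fin, e]
  unfold mi
  calc _ ≤ (∫⁻ x, c ^ (p / 2) * ((∏ i, (g i x) ^ (p / (2 * n))) * Ω x)) ^ (2 / p) :=
        ENNReal.rpow_le_rpow (lintegral_mono h1) (by positivity)
    _ = _ := by
      rw [lintegral_const_mul' _ _ (ENNReal.rpow_ne_top_of_nonneg (by positivity) hc),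
        ENNReal.mul_rpow_of_nonneg _ _ (by positivity), ← ENNReal.rpow_mul, div_mul_div_cancel₀ (by norm_num),
        div_self hp.ne', ENNReal.rpow_one]

lemma mi_cs {n : ℕ} {p : ℝ} (hp : 0 < p) {Ω : X d → ℝ≥0∞} (hΩ : Measurable Ω) {f g : Fin n → X d → ℝ≥0∞}
    (hf : ∀ i, Measurable (f i)) (hg : ∀ i, Measurable (g i)) :
    mi n p Ω (fun i x => f i x ^ (1 / 2 : ℝ) * g i x ^ (1 / 2 : ℝ)) ≤ mi n p Ω f ^ (1 / 2 : ℝ) * mi n p Ω g ^ (1 / 2 : ℝ) := by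
  unfold mi
  rw [← ENNReal.rpow_mul, ← ENNReal.rpow_mul, mul_comm (2 / p), ENNReal.rpow_mul, ENNReal.rpow_mul,
    ← ENNReal.mul_rpow_of_nonneg _ _ (by positivity)]
  gcongr
  refine le_trans (le_of_eq ?_) (cs_int hΩ (Finset.measurable_prod Finset.univ fun i _ => (hf i).pow_const (p / (2 * n)))
    (Finset.measurable_prod Finset.univ fun i _ => (hg i).pow_const (p / (2 * n))))
  congr 1; ext x; congr 1
  rw [← ENNReal.prod_rpow_of_nonneg (by norm_num), ← ENNReal.prod_rpow_of_nonneg (by norm_num), ← Finset.prod_mul_distrib]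
  refine Finset.prod_congr rfl fun i _ => ?_
  rw [ENNReal.mul_rpow_of_nonneg _ _ (by positivity), ← ENNReal.rpow_mul, ← ENNReal.rpow_mul, ← ENNReal.rpow_mul,
    ← ENNReal.rpow_mul, mul_comm (1 / 2 : ℝ)]

def Bq {ι : Type} (p : ℝ) (Ω : X d → ℝ≥0∞) (c : ι → V d) (F : ι → X d → ℂ) (S : Fin (d + 1) → Finset ι) (N M : ℕ) : ℝ≥0∞ :=
  mi (d + 1) p Ω (fun i x => ∑ J ∈ gc c N (S i), avg M (iso d N) (fun x => ‖FS F J x‖ₑ ^ (2 : ℝ)) x)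

def Trans {ι : Type} (K : ℝ) (N0 : ℕ) (c : ι → V d) (S : Fin (d + 1) → Finset ι) : Prop :=
  ∃ (ch : Fin (d + 1) → V d) (L : (Fin (d + 1) → ℝ) ≃L[ℝ] X d), ‖(L : (Fin (d + 1) → ℝ) →L[ℝ] X d)‖ ≤ K ∧
    ‖(L.symm : X d →L[ℝ] (Fin (d + 1) → ℝ))‖ ≤ K ∧ (∀ i, L (Pi.single i 1) = ((-2 : ℝ) • ch i, 1)) ∧
    ∀ i, ∀ θ ∈ S i, N0 * ‖c θ - ch i‖ ≤ 1

def Lam (d : ℕ) (p : ℝ) (E : ℕ) (K : ℝ) (Mx : ℕ) : ℝ≥0∞ :=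
  (br K ^ E * ((br 1 ^ Mx * ENNReal.ofReal ((1 + 2 * K) ^ (d + 1))) ^ ((p + 2) / (2 * p) * (p / (2 * (d + 1 : ℕ)))) *
    (2 ^ (d + 1)) ^ ((p + 2) / (2 * p) * (p / (2 * (d + 1 : ℕ))))) ^ (d + 1)) ^ (2 / p)

lemma base (d : ℕ) {p : ℝ} (hp : 2 ≤ p) (E B N' : ℕ) (hN' : d + 2 ≤ N') (A : ℝ) (hA : (d : ℝ) ≤ A) : ∃ C : ℝ≥0,
    ∀ (N : ℕ) (s : ℝ), 0 < N → 0 < s → s * N ≤ 1 → ∀ Ω : X d → ℝ≥0∞, Wt E (s ^ 2) Ω → ∀ (ι : Type) (S0 : Finset ι) (c : ι → V d)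
    (F : ι → X d → ℂ), Fam A s B S0 c F → ∀ S : Fin (d + 1) → Finset ι, (∀ i, S i ⊆ S0) → ∀ Xc, Dec d p E B A (s * N) Xc →
    Bq p Ω c F S N (E + N') ≤ C * (Xc * ∑ θ ∈ S0, nq p Ω (F θ)) := by
  have hI' : ∫⁻ y : X d, Phi N' y ≠ ∞ := I_ne_top d hN'
  have hI : ∫⁻ y : X d, Phi (E + N') y ≠ ∞ := I_ne_top d (by omega)
  have hp1 : 2 / p ≤ 1 := by rw [div_le_one (by linarith)]; exact hp
  have hc1 : (∫⁻ y : X d, Phi (E + N') y) ^ (1 - 2 / p) ≠ ∞ := ENNReal.rpow_ne_top_of_nonneg (by linarith) hI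
  have hc2 : (∫⁻ y : X d, Phi N' y) ^ (2 / p) * ENNReal.ofReal (1 + 2 * A) ^ E ≠ ∞ :=
    ENNReal.mul_ne_top (ENNReal.rpow_ne_top_of_nonneg (by positivity) hI') (by finiteness)
  refine ⟨((∫⁻ y : X d, Phi (E + N') y) ^ (1 - 2 / p) * ((∫⁻ y : X d, Phi N' y) ^ (2 / p) * ENNReal.ofReal (1 + 2 * A) ^ E)).toNNReal, ?_⟩
  rw [ENNReal.coe_toNNReal (ENNReal.mul_ne_top hc1 hc2)]
  intro N s hN hs hsN Ω hΩ ι S0 c F hF S hS Xc hD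
  have hN1 : (1 : ℝ) ≤ N := by exact_mod_cast hN
  have hm : ∀ J, Measurable fun x => ‖FS F J x‖ₑ ^ p := fun J => ES_meas (FS_mem0 hF J) p
  have h1 : Bq p Ω c F S N (E + N') ≤ (∫⁻ y : X d, Phi (E + N') y) ^ (1 - 2 / p) *
      mi (d + 1) p Ω (fun i x => ∑ J ∈ gc c N (S i), (avg (E + N') (iso d N) (fun x => ‖FS F J x‖ₑ ^ p) x) ^ (2 / p)) := by
    refine mi_le (by omega) (by linarith) hc1 fun i x => ?_
    rw [Finset.mul_sum]
    gcongr with J hJ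
    refine le_trans (le_of_eq ?_) (avg_jensen _ _ (hm J) (by positivity) hp1 x)
    congr 1; ext x; rw [← ENNReal.rpow_mul]; congr 1; field_simp
  refine h1.trans ?_
  rw [mul_assoc]
  gcongr
  refine (Qbound hp hN' hA hN (ρ := N) (by linarith) ?_ hD hΩ hF (Nat.succ_pos d) S hS).trans (le_of_eq (by ring))
  calc s ^ 2 * N ≤ s ^ 2 * (N * N) := by gcongr; nlinarith
    _ = (s * N) ^ 2 := by ring
    _ ≤ 1 := pow_le_one₀ (by positivity) hsN

lemma avg_zero_or {T : X d ≃L[ℝ] X d} {M : ℕ} {u : X d → ℝ≥0∞} (hu : Measurable u) :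
    (∀ x, avg M (T : X d →L[ℝ] X d) u x = 0) ∨ (∀ x, avg M (T : X d →L[ℝ] X d) u x ≠ 0) := by
  by_cases h : ∃ x, avg M (T : X d →L[ℝ] X d) u x = 0
  · left
    obtain ⟨x, hx⟩ := h
    intro z
    have := avg_harn M (T : X d →L[ℝ] X d) hu x (T.symm (z - x))
    rw [hx, mul_zero] at this
    simpa using this
  · right; push Not at h; exact h

lemma avg_bdd {T : X d →L[ℝ] X d} {M : ℕ} (hM : d + 2 ≤ M) {G : X d → ℂ} {S : Set (X d)} (hG : G ∈ ES S) {q : ℝ} (hq : 0 ≤ q) :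
    ∃ N : ℝ≥0∞, N ≠ ∞ ∧ ∀ x, avg M T (fun x => ‖G x‖ₑ ^ q) x ≤ N := by
  obtain ⟨b, hb⟩ := ES_bdd hG
  refine ⟨ENNReal.ofReal b ^ q * ∫⁻ y : X d, Phi M y, ENNReal.mul_ne_top (ENNReal.rpow_ne_top_of_nonneg hq (by simp)) (I_ne_top d hM), fun x => ?_⟩
  unfold avg
  rw [← lintegral_const_mul _ (measurable_Phi M)]
  refine lintegral_mono fun y => mul_le_mul_left (ENNReal.rpow_le_rpow ?_ hq) _
  rw [← ofReal_norm]; exact ENNReal.ofReal_le_ofReal (hb _)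

lemma round (d : ℕ) {p : ℝ} (hp : 2 ≤ p) (hpd : p * d ≤ 2 * (d + 2)) (E B N' : ℕ) (hN' : d + 2 ≤ N') (A : ℝ) (hA : (d : ℝ) ≤ A)
    (K : ℝ) (Mx : ℕ) (hMx : E + N' + (d + 2) ≤ Mx) : ∃ C : ℝ≥0,
    ∀ (N0 m N : ℕ) (s : ℝ), 0 < N0 → 2 * (1 + 2 * K) ≤ N0 → N = N0 ^ m → 0 < s → s * (N * N : ℕ) ≤ 1 →
    ∀ Ω : X d → ℝ≥0∞, Wt E (s ^ 2) Ω → ∀ (ι : Type) (S0 : Finset ι) (c : ι → V d)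
    (F : ι → X d → ℂ), Fam A s B S0 c F → ∀ S : Fin (d + 1) → Finset ι, (∀ i, S i ⊆ S0) → Trans K N0 c S →
    ∀ Xc, Dec d p E B A (s * N) Xc →
    Bq p Ω c F S N (E + N' + (d + 2) + (d + 2)) ≤ C * Lam d p E K Mx ^ m * (Bq p Ω c F S (N * N) (E + N') ^ (1 / 2 : ℝ) *
      (Xc * ∑ θ ∈ S0, nq p Ω (F θ)) ^ (1 / 2 : ℝ)) := by
  have hp0 : 0 < p := by linarith
  have hd0 : (0 : ℝ) ≤ d := Nat.cast_nonneg d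
  set q : ℝ := 4 * p / (p + 2) with hq
  have hq2 : 2 ≤ q := by rw [hq, le_div_iff₀ (by linarith)]; linarith
  set α : ℝ := (p + 2) / (2 * p) with hα
  have hαq : 2 / q = α := by rw [hq, hα]; field_simp; ring
  have hα0 : 0 < α := by positivity
  have hα1 : α ≤ 1 := by rw [hα, div_le_one (by linarith)]; linarith
  set M2 := E + N' with hM2
  set M' := M2 + (d + 2) with hM'
  have hM'2 : d + 2 ≤ M' := by omega
  obtain ⟨CA, hCA⟩ := roundA d M' hM'2 A hq2
  obtain ⟨CD, hCD⟩ := roundD d M2 A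
  obtain ⟨CP, hCP⟩ := PP_end (X := X d) (d + 1) K M2
  obtain ⟨CL, hCL⟩ := l2cells d M2
  set K' := (1 + 2 * A) * K with hK'
  set c1 : ℝ≥0∞ := CA * (br K' ^ M') ^ α with hc1
  have hc1t : c1 ≠ ∞ := ENNReal.mul_ne_top (by simp) (ENNReal.rpow_ne_top_of_nonneg hα0.le (brn_ne_top _ _))
  set c2 : ℝ≥0∞ := ((CP : ℝ≥0∞) * CD) ^ α with hc2
  have hc2t : c2 ≠ ∞ := ENNReal.rpow_ne_top_of_nonneg hα0.le (by finiteness)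
  set c4 : ℝ≥0∞ := (∫⁻ y : X d, Phi N' y) ^ (2 / p) * ENNReal.ofReal (1 + 2 * A) ^ E with hc4
  have hc4t : c4 ≠ ∞ := ENNReal.mul_ne_top (ENNReal.rpow_ne_top_of_nonneg (by positivity) (I_ne_top d hN')) (by finiteness)
  refine ⟨(c1 * c2 * (((CL : ℝ≥0∞)) ^ (1 / 2 : ℝ) * c4 ^ (1 / 2 : ℝ))).toNNReal, ?_⟩
  rw [ENNReal.coe_toNNReal (ENNReal.mul_ne_top (by finiteness) (ENNReal.mul_ne_top (ENNReal.rpow_ne_top_of_nonneg (by norm_num) (by simp))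
    (ENNReal.rpow_ne_top_of_nonneg (by norm_num) hc4t)))]
  intro N0 m N s hN0 hKN hNm hs hsN Ω hΩ ι S0 c F hF S hS hT Xc hD
  obtain ⟨ch, L, hL, hLs, hLe, hch⟩ := hT
  have hN : 0 < N := by rw [hNm]; positivity
  have hN1 : (1 : ℝ) ≤ N := by exact_mod_cast hN
  have hNne : (N : ℝ) ≠ 0 := by linarith
  have hN01 : (1 : ℝ) ≤ N0 := by exact_mod_cast hN0
  have hK0 : 0 ≤ K := (norm_nonneg _).trans hL
  have hsN1 : s * N ≤ 1 := by
    refine le_trans ?_ hsN; push_cast; gcongr; nlinarith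
  have hsN2 : s ^ 2 * (N : ℝ) ^ 2 ≤ 1 := by
    rw [← mul_pow]; exact pow_le_one₀ (by positivity) hsN1
  have hm : ∀ (r : ℝ) J, Measurable fun x => ‖FS F J x‖ₑ ^ r := fun r J => ES_meas (FS_mem0 hF J) r
  let T : Finset ι → X d ≃L[ℝ] X d := fun J => par (N : ℝ) hNne (ctr c J)
  let h : Finset ι → X d → ℝ≥0∞ := fun J => avg M' (T J : X d →L[ℝ] X d) (fun x => ‖FS F J x‖ₑ ^ q)
  have hhm : ∀ J, Measurable (h J) := fun J => measurable_avg _ _ (hm q J)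
  have hctrS : ∀ i, ∀ J ∈ gc c N (S i), ∃ θ ∈ S i, ctr c J = c θ := by
    intro i J hJ
    obtain ⟨θ, hθ, e⟩ := ctr_spec c (cells_nonempty hJ)
    exact ⟨θ, cells_sub hJ hθ, e⟩
  have hctrA : ∀ i, ∀ J ∈ gc c N (S i), ‖ctr c J‖ ≤ A := by
    intro i J hJ
    obtain ⟨θ, hθ, e⟩ := hctrS i J hJ
    rw [e]; exact hF.1 θ (hS i hθ)
  let f1 : Fin (d + 1) → X d → ℝ≥0∞ := fun i x => ∑ J ∈ gc c N (S i), (PP (L : (Fin (d + 1) → ℝ) →L[ℝ] X d) N (h J) x) ^ α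
  let f2 : Fin (d + 1) → X d → ℝ≥0∞ := fun i x => ∑ J ∈ gc c N (S i), (PP (L : (Fin (d + 1) → ℝ) →L[ℝ] X d) (N ^ 2) (h J) x) ^ α
  let P : Fin (d + 1) → X d → ℝ≥0∞ := fun i x => ∑ J ∈ gc c N (S i), avg M2 (iso d (N ^ 2)) (fun x => ‖FS F J x‖ₑ ^ (2 : ℝ)) x
  let Qf : Fin (d + 1) → X d → ℝ≥0∞ := fun i x => ∑ J ∈ gc c N (S i), (avg M2 (iso d (N ^ 2)) (fun x => ‖FS F J x‖ₑ ^ p) x) ^ (2 / p)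
  have s1 : Bq p Ω c F S N (M' + (d + 2)) ≤ c1 * mi (d + 1) p Ω f1 := by
    refine mi_le (by omega) hp0 hc1t fun i x => ?_
    simp only [f1]
    rw [Finset.mul_sum]
    gcongr with J hJ
    refine (hCA N hN hNne (ctr c J) (hctrA i J hJ) _ (gc_mem (hF.subset (hS i)) hs.le hN hsN1 hJ) x).trans ?_
    rw [hαq, hc1, mul_assoc, ← ENNReal.mul_rpow_of_nonneg _ _ hα0.le]
    gcongr
    refine PP_start _ _ (avg_harn M' (T J : X d →L[ℝ] X d) (hm q J)) (hhm J) ?_ x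
    intro z hz
    refine ⟨shr 1 (N : ℝ)⁻¹ (ctr c J) 2 (L z), ?_, ?_⟩
    · rw [← iso_apply (d := d), iso_eq_par hNne (ctr c J)]; rfl
    · refine (ContinuousLinearMap.le_of_opNorm_le_of_le _ (shr_norm (by simp) (abs_inv_nat_le hN) (by norm_num) (hctrA i J hJ)) (b := K) ?_)
      refine (ContinuousLinearMap.le_of_opNorm_le _ hL z).trans ?_
      have hz1 : ‖z‖ ≤ 1 := (pi_norm_le_iff_of_nonneg zero_le_one).2 fun j => by
        rw [Real.norm_eq_abs]; linarith [(mem_Q _).1 hz j]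
      nlinarith
  have s2 : mi (d + 1) p Ω f1 ≤ Lam d p E K Mx ^ m * mi (d + 1) p Ω f2 := by
    have hk := kak_iter L (σ := (N0 : ℝ)⁻¹) (R2 := (N : ℝ) ^ 2) (α := α) (β := p / (2 * (d + 1 : ℕ))) (CH := br 1 ^ Mx) hLs hL (by positivity)
      (inv_le_one_of_one_le₀ hN01) (by rw [← div_eq_mul_inv, div_le_one (by linarith)]; exact hKN) hα0 hα1 (by positivity)
      ?_ hΩ (sq_nonneg s) hsN2 (fun i => gc c N (S i)) h hhm (fun J => avg_zero_or (hm q J))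
      (fun J => avg_bdd hM'2 (FS_mem0 hF J) (by linarith)) (fun J => ((-2 : ℝ) • ctr c J, 1)) ?_ ?_ m N (by linarith) ?_
    · have e : (N : ℝ) / ((N0 : ℝ)⁻¹) ^ m = (N : ℝ) ^ 2 := by
        rw [hNm]; push_cast; rw [inv_pow, div_inv_eq_mul, sq]
      rw [e] at hk
      unfold mi Lam
      rw [← ENNReal.rpow_natCast (_ ^ (2 / p)), ← ENNReal.rpow_mul, mul_comm (2 / p), ENNReal.rpow_mul, ENNReal.rpow_natCast,
        ← ENNReal.mul_rpow_of_nonneg _ _ (by positivity)]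
      exact ENNReal.rpow_le_rpow hk (by positivity)
    · rw [hα]
      have : ((d + 1 : ℕ) : ℝ) - 1 = d := by push_cast; ring
      rw [this]
      have e : (d : ℝ) * ((p + 2) / (2 * p) * (p / (2 * (d + 1 : ℕ)))) = d * (p + 2) / (4 * (d + 1)) := by
        push_cast; field_simp; ring
      rw [e, div_le_one (by positivity)]
      nlinarith
    · intro i J hJ
      obtain ⟨θ, hθ, e⟩ := hctrS i J hJ
      rw [hLe, e, Prod.mk_sub_mk, sub_self, ← smul_sub, Prod.norm_def]
      simp only [norm_zero, norm_smul, norm_neg, Real.norm_ofNat]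
      refine max_le ?_ (by positivity)
      have := hch i θ hθ
      rw [← le_div_iff₀' (by linarith), one_div] at this
      linarith
    · intro J x t ht
      have hN2 : (0 : ℝ) < (N : ℝ) ^ 2 := by positivity
      have e : t • (((-2 : ℝ) • ctr c J, (1 : ℝ)) : X d) = T J (0, t / N ^ 2) := by
        simp only [T, par_apply]
        ext1
        · simp only [Prod.smul_mk, smul_smul, smul_zero, zero_sub, ← neg_smul]
          congr 1; field_simp
        · simp; field_simp
      rw [e]
      have := avg_harn M' (T J : X d →L[ℝ] X d) (hm q J) x (0, t / N ^ 2)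
      rw [one_mul] at this
      refine this.trans (mul_le_mul_left ?_ _)
      calc br ‖((0 : V d), t / (N : ℝ) ^ 2)‖ ^ M' ≤ br 1 ^ M' := by
            refine pow_le_pow_left' (br_mono ?_) _
            rw [Prod.norm_def]
            refine max_le (by simp) ?_
            rw [Real.norm_eq_abs, abs_div, abs_of_pos hN2, div_le_one hN2]; exact ht
        _ ≤ br 1 ^ Mx := pow_le_pow_right₀ (one_le_br zero_le_one) hMx
    · rw [hNm]; push_cast; rw [inv_pow, div_inv_eq_mul, sq]
  have s3 : mi (d + 1) p Ω f2 ≤ c2 * mi (d + 1) p Ω (fun i x => P i x ^ (1 / 2 : ℝ) * Qf i x ^ (1 / 2 : ℝ)) := by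
    refine mi_le (by omega) hp0 hc2t fun i x => ?_
    calc f2 i x ≤ ∑ J ∈ gc c N (S i), c2 * ((avg M2 (iso d (N ^ 2)) (fun x => ‖FS F J x‖ₑ ^ (2 : ℝ)) x) ^ (1 / 2 : ℝ) *
          ((avg M2 (iso d (N ^ 2)) (fun x => ‖FS F J x‖ₑ ^ p) x) ^ (2 / p)) ^ (1 / 2 : ℝ)) := by
          refine Finset.sum_le_sum fun J hJ => ?_
          have h1 : PP (L : (Fin (d + 1) → ℝ) →L[ℝ] X d) (N ^ 2) (h J) x ≤ (CP * CD) * avg M2 (iso d (N ^ 2)) (fun x => ‖FS F J x‖ₑ ^ q) x := by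
            refine (hCP L hL hLs _ (h J) (hhm J) x).trans ?_
            rw [mul_assoc]
            gcongr
            exact hCD N hN hNne (ctr c J) (hctrA i J hJ) _ (hm q J) x
          have h2 := avg_holder M2 (iso d (N ^ 2)) (hm 2 J) (hm p J) (a := p / (p + 2)) (b := 2 / (p + 2)) (by positivity) (by positivity)
            (by field_simp) x
          have e : (fun x => (‖FS F J x‖ₑ ^ (2 : ℝ)) ^ (p / (p + 2)) * (‖FS F J x‖ₑ ^ p) ^ (2 / (p + 2))) = fun x => ‖FS F J x‖ₑ ^ q := by
            ext x
            rw [← ENNReal.rpow_mul, ← ENNReal.rpow_mul, ← ENNReal.rpow_add_of_nonneg _ _ (by positivity) (by positivity)]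
            congr 1; rw [hq]; field_simp; ring
          rw [e] at h2
          calc _ ≤ ((CP * CD) * ((avg M2 (iso d (N ^ 2)) (fun x => ‖FS F J x‖ₑ ^ (2 : ℝ)) x) ^ (p / (p + 2)) *
                (avg M2 (iso d (N ^ 2)) (fun x => ‖FS F J x‖ₑ ^ p) x) ^ (2 / (p + 2)))) ^ α := by
                gcongr
                exact h1.trans (mul_le_mul_right h2 _)
            _ = _ := by
                rw [ENNReal.mul_rpow_of_nonneg (_ * _) (_ * _) hα0.le, ENNReal.mul_rpow_of_nonneg (_ ^ (p / (p + 2))) _ hα0.le, ← ENNReal.rpow_mul,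
                  ← ENNReal.rpow_mul, ← ENNReal.rpow_mul, hc2]
                have e1 : p / (p + 2) * α = 1 / 2 := by rw [hα]; field_simp
                have e2 : 2 / (p + 2) * α = 2 / p * (1 / 2) := by rw [hα]; field_simp
                rw [e1, e2]
      _ ≤ _ := by
          rw [← Finset.mul_sum]
          gcongr
          exact cs_sum _ _ _
  have s4 := mi_cs (n := d + 1) hp0 hΩ.1 (f := P) (g := Qf) (fun i => Finset.measurable_sum _ fun J _ => measurable_avg _ _ (hm 2 J))
    (fun i => Finset.measurable_sum _ fun J _ => (measurable_avg _ _ (hm p J)).pow_const _)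
  have eN : ((N * N : ℕ) : ℝ) = (N : ℝ) ^ 2 := by push_cast; ring
  have s5 : mi (d + 1) p Ω P ≤ CL * Bq p Ω c F S (N * N) M2 := by
    refine mi_le (by omega) hp0 (by simp) fun i x => ?_
    rw [← gc_refine c N hN, Finset.mul_sum]
    simp only [P]
    gcongr with J hJ
    rw [← eN]
    exact hCL (N * N) (Nat.mul_pos hN hN) s hsN ι A B J c F (hF.subset ((cells_sub hJ).trans (hS i))) x
  have s6 : mi (d + 1) p Ω Qf ≤ c4 * (Xc * ∑ θ ∈ S0, nq p Ω (F θ)) := by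
    rw [hc4, ← mul_assoc]
    exact Qbound hp hN' hA hN (sq_nonneg _) hsN2 hD hΩ hF (Nat.succ_pos d) S hS
  calc _ ≤ c1 * (Lam d p E K Mx ^ m * (c2 * ((CL * Bq p Ω c F S (N * N) M2) ^ (1 / 2 : ℝ) * (c4 * (Xc * ∑ θ ∈ S0, nq p Ω (F θ))) ^ (1 / 2 : ℝ)))) := by
        refine s1.trans ?_
        gcongr
        refine s2.trans ?_
        gcongr
        refine s3.trans ?_
        gcongr
        refine s4.trans ?_
        gcongr
    _ = _ := by
        rw [ENNReal.mul_rpow_of_nonneg _ _ (by norm_num), ENNReal.mul_rpow_of_nonneg c4 _ (by norm_num)]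
        ring


end

end Dcp

end


section
open MeasureTheory Real
open scoped RealInnerProductSpace ENNReal NNReal

set_option linter.all false
namespace Dcp

section
variable {d : ℕ}

lemma sqrt_alg (C1 : ℝ≥0∞) (l : ℝ≥0∞) (j : ℕ) {x y z : ℝ} (hx : 0 ≤ x) (hy : 0 ≤ y) (hz : 0 ≤ z) (h : x * y = z ^ 2) (Y : ℝ≥0∞) :
    (C1 * l ^ (2 * j) * (ENNReal.ofReal x * Y)) ^ (1 / 2 : ℝ) * (ENNReal.ofReal y * Y) ^ (1 / 2 : ℝ) =
      C1 ^ (1 / 2 : ℝ) * l ^ j * (ENNReal.ofReal z * Y) := by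
  rw [← ENNReal.mul_rpow_of_nonneg _ _ (by norm_num)]
  have e : C1 * l ^ (2 * j) * (ENNReal.ofReal x * Y) * (ENNReal.ofReal y * Y) = C1 * (l ^ j * (ENNReal.ofReal z * Y)) ^ 2 := by
    have : ENNReal.ofReal x * ENNReal.ofReal y = ENNReal.ofReal z ^ 2 := by
      rw [← ENNReal.ofReal_mul hx, h, ENNReal.ofReal_pow hz]
    calc _ = C1 * l ^ (2 * j) * Y ^ 2 * (ENNReal.ofReal x * ENNReal.ofReal y) := by ring
      _ = _ := by rw [this]; ring
  rw [e, ENNReal.mul_rpow_of_nonneg _ _ (by norm_num), ← ENNReal.rpow_natCast (_ * _), ← ENNReal.rpow_mul]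
  norm_num
  ring

lemma iterB (d : ℕ) {p : ℝ} (hp : 2 ≤ p) (hpd : p * d ≤ 2 * (d + 2)) (E B : ℕ) (A : ℝ) (hA : (d : ℝ) ≤ A)
    (K : ℝ) (Mx : ℕ) : ∀ k : ℕ, E + (d + 2) + 2 * (d + 2) * k ≤ Mx → ∃ C : ℝ≥0,
    ∀ (N0 m N : ℕ) (s : ℝ), 0 < N0 → 2 * (1 + 2 * K) ≤ N0 → N = N0 ^ m → 0 < s → s * (N : ℝ) ^ (2 ^ k) ≤ 1 →
    ∀ Ω : X d → ℝ≥0∞, Wt E (s ^ 2) Ω → ∀ (ι : Type) (S0 : Finset ι) (c : ι → V d)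
    (F : ι → X d → ℂ), Fam A s B S0 c F → ∀ S : Fin (d + 1) → Finset ι, (∀ i, S i ⊆ S0) → Trans K N0 c S →
    ∀ (C0 : ℝ≥0∞) (η : ℝ), (∀ t : ℝ, s ≤ t → t ≤ 1 → Dec d p E B A t (C0 * ENNReal.ofReal (t ^ (-η)))) →
    Bq p Ω c F S N (E + (d + 2) + 2 * (d + 2) * k) ≤ C * Lam d p E K Mx ^ (m * k) *
      (ENNReal.ofReal (s ^ (-η) * (N : ℝ) ^ (-((1 + k / 2) * η))) * (C0 * ∑ θ ∈ S0, nq p Ω (F θ))) := by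
  intro k
  have hYe : ∀ (C0 : ℝ≥0∞) (s η : ℝ) (N : ℕ) (R : ℝ≥0∞), 0 < s → 0 < N → C0 * ENNReal.ofReal ((s * N) ^ (-η)) * R =
      ENNReal.ofReal (s ^ (-η) * (N : ℝ) ^ (-η)) * (C0 * R) := by
    intro C0 s η N R hs hN
    rw [Real.mul_rpow hs.le (by positivity)]; ring
  induction k with
  | zero =>
    intro _
    obtain ⟨C, hC⟩ := base d hp E B (d + 2) le_rfl A hA
    refine ⟨C, ?_⟩
    intro N0 m N s hN0 hK hN hs hsN Ω hΩ ι S0 c F hF S hS hT C0 η hD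
    have hNp : 0 < N := by rw [hN]; positivity
    have hN1 : (1 : ℝ) ≤ N := by exact_mod_cast hNp
    have h1 : s * N ≤ 1 := by simpa using hsN
    have h := hC N s hNp hs h1 Ω hΩ ι S0 c F hF S hS _ (hD (s * N) (by nlinarith) h1)
    rw [hYe _ _ _ _ _ hs hNp] at h
    simpa using h
  | succ k ih =>
    intro hMx
    obtain ⟨C1, hC1⟩ := ih (by rw [mul_add] at hMx; omega)
    obtain ⟨C2, hC2⟩ := round d hp hpd E B (d + 2 + 2 * (d + 2) * k) (by omega) A hA K Mx (by rw [mul_add] at hMx; omega)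
    refine ⟨C2 * (C1 ^ (1 / 2 : ℝ)), ?_⟩
    intro N0 m N s hN0 hK hN hs hsN Ω hΩ ι S0 c F hF S hS hT C0 η hD
    have hNp : 0 < N := by rw [hN]; positivity
    have hN1 : (1 : ℝ) ≤ N := by exact_mod_cast hNp
    have hsN2 : s * (N * N : ℕ) ≤ 1 := by
      refine le_trans ?_ hsN
      push_cast
      rw [← sq]
      gcongr
      · rw [pow_succ]; exact Nat.le_mul_of_pos_left _ (by positivity)
    have h1 : s * N ≤ 1 := by
      refine le_trans ?_ hsN2; push_cast; gcongr; nlinarith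
    have h := hC2 N0 m N s hN0 hK hN hs hsN2 Ω hΩ ι S0 c F hF S hS hT _ (hD (s * N) (by nlinarith) h1)
    have h' := hC1 N0 (2 * m) (N * N) s hN0 hK (by rw [hN]; ring) hs (by
      refine le_trans (le_of_eq ?_) hsN; push_cast; rw [← sq, ← pow_mul]; congr 2; ring) Ω hΩ ι S0 c F hF S hS hT C0 η hD
    rw [hYe _ _ _ _ _ hs hNp] at h
    have e0 : E + (d + 2) + 2 * (d + 2) * (k + 1) = E + (d + 2 + 2 * (d + 2) * k) + (d + 2) + (d + 2) := by ring
    have e1 : E + (d + 2) + 2 * (d + 2) * k = E + (d + 2 + 2 * (d + 2) * k) := by ring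
    rw [e1] at h'
    rw [e0]
    refine h.trans ?_
    refine le_trans (mul_le_mul_right (mul_le_mul_left (ENNReal.rpow_le_rpow h' (by norm_num)) _) _) (le_of_eq ?_)
    rw [show 2 * m * k = 2 * (m * k) by ring,
      sqrt_alg (C1 : ℝ≥0∞) (Lam d p E K Mx) (m * k) (z := s ^ (-η) * (N : ℝ) ^ (-((1 + ((k + 1 : ℕ) : ℝ) / 2) * η))) (by positivity) (by positivity) (by positivity)]
    · push_cast
      rw [ENNReal.coe_rpow_of_nonneg _ (by norm_num), show m * (k + 1) = m + m * k by ring, pow_add]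
      ring
    · push_cast
      have hN' : (0 : ℝ) < N := by linarith
      rw [Real.mul_rpow hN'.le hN'.le, mul_pow, ← Real.rpow_natCast (s ^ _), ← Real.rpow_natCast (_ ^ _), ← Real.rpow_mul hs.le, ← Real.rpow_mul hN'.le]
      have e2 : s ^ (-η) * (((N : ℝ) ^ (-((1 + k / 2) * η))) * ((N : ℝ) ^ (-((1 + k / 2) * η)))) * (s ^ (-η) * (N : ℝ) ^ (-η)) =
        (s ^ (-η) * s ^ (-η)) * (((N : ℝ) ^ (-((1 + k / 2) * η))) * ((N : ℝ) ^ (-((1 + k / 2) * η))) * (N : ℝ) ^ (-η)) := by ring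
      rw [e2, ← Real.rpow_add hs, ← Real.rpow_add hN', ← Real.rpow_add hN']
      congr 2 <;> (push_cast; ring)

end

end Dcp

end


section
open MeasureTheory Real
open scoped RealInnerProductSpace ENNReal NNReal

set_option linter.all false
namespace Dcp

section
variable {d : ℕ}

lemma exists_unit_dual {Y : Type*} [NormedAddCommGroup Y] [NormedSpace ℝ Y] [FiniteDimensional ℝ Y] {W : Submodule ℝ Y}
    (hW : W < ⊤) : ∃ f : Y →L[ℝ] ℝ, ‖f‖ = 1 ∧ ∀ w ∈ W, f w = 0 := by
  obtain ⟨f, hf0, hf⟩ := W.exists_le_ker_of_lt_top hW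
  let g : Y →L[ℝ] ℝ := LinearMap.toContinuousLinearMap f
  have hg : g ≠ 0 := by
    intro h; apply hf0; ext y; exact congrArg (fun k : Y →L[ℝ] ℝ => k y) h
  have hgn : ‖g‖ ≠ 0 := by simpa using hg
  refine ⟨‖g‖⁻¹ • g, ?_, fun w hw => ?_⟩
  · rw [norm_smul, norm_inv, norm_norm, inv_mul_cancel₀ hgn]
  · have : f w = 0 := hf hw
    simp [g, this]

/-- greedy selection -/
lemma greedy {Y : Type*} [NormedAddCommGroup Y] [NormedSpace ℝ Y] [FiniteDimensional ℝ Y] {κ : Type} (S : Finset κ) (v : κ → Y)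
    {A1 t : ℝ} (hA1 : 0 ≤ A1) (ht : 0 < t) (hv : ∀ q ∈ S, ‖v q‖ ≤ A1) (hno : ∀ f : Y →L[ℝ] ℝ, ‖f‖ = 1 → ∃ q ∈ S, t ≤ |f (v q)|) :
    ∀ j : ℕ, j ≤ Module.finrank ℝ Y → ∃ τ : Fin j → κ, (∀ i, τ i ∈ S) ∧
      ∀ z : Fin j → ℝ, ‖z‖ ≤ (1 / t + 1 + A1 / t) ^ j * ‖∑ i, z i • v (τ i)‖ := by
  intro j
  induction j with
  | zero =>
    intro _
    refine ⟨Fin.elim0, fun i => i.elim0, fun z => ?_⟩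
    have : z = 0 := Subsingleton.elim _ _
    rw [this]; simp
  | succ j ih =>
    intro hj
    obtain ⟨τ, hτ, hb⟩ := ih (by omega)
    have hW : Submodule.span ℝ (Set.range fun i => v (τ i)) < ⊤ := by
      rw [lt_top_iff_ne_top]
      intro h
      have := finrank_range_le_card (R := ℝ) (fun i => v (τ i))
      rw [Set.finrank, h, finrank_top, Fintype.card_fin] at this
      omega
    obtain ⟨f, hf1, hf⟩ := exists_unit_dual hW
    obtain ⟨q, hq, hqt⟩ := hno f hf1
    refine ⟨Fin.snoc τ q, ?_, ?_⟩
    · intro i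
      refine Fin.lastCases ?_ (fun i => ?_) i
      · simpa using hq
      · simpa using hτ i
    · intro z
      set w : Y := ∑ i, z i • v ((Fin.snoc τ q : Fin (j + 1) → κ) i) with hw
      have hw' : w = ∑ i : Fin j, z i.castSucc • v (τ i) + z (Fin.last j) • v q := by
        rw [hw, Fin.sum_univ_castSucc]; simp
      have hfw : f w = z (Fin.last j) * f (v q) := by
        rw [hw', map_add, map_sum]
        have : ∑ i : Fin j, f (z i.castSucc • v (τ i)) = 0 := Finset.sum_eq_zero fun i _ => by
          rw [map_smul, hf _ (Submodule.subset_span ⟨i, rfl⟩), smul_zero]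
        rw [this, zero_add, map_smul, smul_eq_mul]
      have h1 : |z (Fin.last j)| * t ≤ ‖w‖ := by
        calc |z (Fin.last j)| * t ≤ |z (Fin.last j)| * |f (v q)| := by gcongr
          _ = ‖f w‖ := by rw [hfw, Real.norm_eq_abs, abs_mul]
          _ ≤ ‖w‖ := by have := f.le_opNorm w; rwa [hf1, one_mul] at this
      have h1' : |z (Fin.last j)| ≤ ‖w‖ / t := by rwa [le_div_iff₀ ht]
      have h2 : ‖∑ i : Fin j, z i.castSucc • v (τ i)‖ ≤ (1 + A1 / t) * ‖w‖ := by
        have : ∑ i : Fin j, z i.castSucc • v (τ i) = w - z (Fin.last j) • v q := by rw [hw']; abel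
        rw [this]
        calc _ ≤ ‖w‖ + ‖z (Fin.last j) • v q‖ := norm_sub_le _ _
          _ ≤ ‖w‖ + (‖w‖ / t) * A1 := by
            rw [norm_smul]; gcongr
            · exact h1'
            · exact hv q hq
          _ = _ := by ring
      set D : ℝ := 1 / t + 1 + A1 / t with hD
      have hD1 : 1 ≤ D := by rw [hD]; have : 0 < 1 / t := by positivity
                             have : 0 ≤ A1 / t := by positivity
                             linarith
      refine (pi_norm_le_iff_of_nonneg (by positivity)).2 fun i => ?_
      refine Fin.lastCases ?_ (fun i => ?_) i
      · rw [Real.norm_eq_abs]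
        refine h1'.trans ?_
        rw [div_eq_mul_one_div, mul_comm]
        gcongr
        calc 1 / t ≤ D := by rw [hD]; have : 0 ≤ A1 / t := by positivity
                             linarith
          _ ≤ D ^ (j + 1) := le_self_pow₀ hD1 (by omega)
      · have := hb fun i => z i.castSucc
        refine (norm_le_pi_norm (fun i : Fin j => z i.castSucc) i).trans (this.trans ?_)
        rw [pow_succ, mul_assoc]
        gcongr
        refine h2.trans ?_
        gcongr
        rw [hD]; have : 0 < 1 / t := by positivity
        linarith

def KT (d : ℕ) (A w : ℝ) : ℝ := (d + 1) * (2 * A + 1) + (1 / (w / (1 + 2 * A)) + 1 + (2 * A + 1) / (w / (1 + 2 * A))) ^ (d + 1)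

lemma alt {κ : Type} (S : Finset κ) (hS : S.Nonempty) (c : κ → V d) {A w : ℝ} (hA : 0 ≤ A) (hw : 0 < w) (hw1 : w ≤ 1 / 2)
    (hc : ∀ q ∈ S, ‖c q‖ ≤ A) :
    (∃ (h : V d) (b : ℝ), ‖h‖ = 1 ∧ |b| ≤ A + 1 ∧ ∀ q ∈ S, |⟪h, c q⟫ + b| ≤ w) ∨
    ∃ τ : Fin (d + 1) → κ, (∀ i, τ i ∈ S) ∧ ∃ L : (Fin (d + 1) → ℝ) ≃L[ℝ] X d, ‖(L : (Fin (d + 1) → ℝ) →L[ℝ] X d)‖ ≤ KT d A w ∧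
    ‖(L.symm : X d →L[ℝ] (Fin (d + 1) → ℝ))‖ ≤ KT d A w ∧ (∀ i, L (Pi.single i 1) = ((-2 : ℝ) • c (τ i), 1)) := by
  set t := w / (1 + 2 * A) with ht
  have hA' : 0 < 1 + 2 * A := by linarith
  have ht0 : 0 < t := by positivity
  have hwt : w = t * (1 + 2 * A) := by rw [ht]; field_simp
  let v : κ → X d := fun q => ((-2 : ℝ) • c q, 1)
  have hv : ∀ q ∈ S, ‖v q‖ ≤ 2 * A + 1 := by
    intro q hq
    simp only [v, Prod.norm_def, norm_smul, norm_neg, Real.norm_ofNat, norm_one]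
    refine max_le ?_ (by linarith)
    linarith [hc q hq]
  by_cases hno : ∀ f : X d →L[ℝ] ℝ, ‖f‖ = 1 → ∃ q ∈ S, t ≤ |f (v q)|
  · right
    obtain ⟨τ, hτ, hb⟩ := greedy S v (by linarith) ht0 hv hno (d + 1) (by rw [finrank_X])
    refine ⟨τ, hτ, ?_⟩
    let L0 : (Fin (d + 1) → ℝ) →ₗ[ℝ] X d := Fintype.linearCombination ℝ (fun i => v (τ i))
    have hL0 : ∀ z, L0 z = ∑ i, z i • v (τ i) := fun z => Fintype.linearCombination_apply _ _ _
    have hinj : Function.Injective L0 := by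
      rw [injective_iff_map_eq_zero]
      intro z hz
      have := hb z
      rw [← hL0, hz, norm_zero, mul_zero] at this
      exact norm_le_zero_iff.1 this
    let L : (Fin (d + 1) → ℝ) ≃L[ℝ] X d := (LinearEquiv.ofInjectiveOfFinrankEq L0 hinj (by simp [finrank_X])).toContinuousLinearEquiv
    have hL : ∀ z, L z = ∑ i, z i • v (τ i) := fun z => by rw [← hL0]; rfl
    have hp1 : 0 ≤ (d + 1) * (2 * A + 1) := by positivity
    have hp2 : 0 ≤ (1 / t + 1 + (2 * A + 1) / t) ^ (d + 1) := by positivity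
    refine ⟨L, ?_, ?_, ?_⟩
    · refine ContinuousLinearMap.opNorm_le_bound _ (by unfold KT; positivity) fun z => ?_
      calc ‖L z‖ ≤ ∑ i : Fin (d + 1), ‖z‖ * (2 * A + 1) := by
            rw [hL]
            refine norm_sum_le_of_le _ fun i _ => ?_
            rw [norm_smul]; gcongr
            · exact norm_le_pi_norm z i
            · exact hv _ (hτ i)
        _ = ((d + 1) * (2 * A + 1)) * ‖z‖ := by
            rw [Finset.sum_const, Finset.card_univ, Fintype.card_fin]; simp; ring
        _ ≤ _ := by gcongr; unfold KT; rw [← ht]; linarith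
    · refine ContinuousLinearMap.opNorm_le_bound _ (by unfold KT; positivity) fun y => ?_
      have := hb (L.symm y)
      rw [← hL, L.apply_symm_apply] at this
      refine this.trans ?_
      gcongr; unfold KT; rw [← ht]; linarith
    · intro i
      rw [hL]
      simp [Pi.single_apply, v]
  · left
    push Not at hno
    obtain ⟨f, hf1, hf⟩ := hno
    obtain ⟨q0, hq0⟩ := hS
    let g : V d →L[ℝ] ℝ := f.comp (ContinuousLinearMap.inl ℝ (V d) ℝ)
    set a : ℝ := f (0, 1) with ha
    have hfe : ∀ (ξ : V d) (τ : ℝ), f (ξ, τ) = g ξ + τ * a := by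
      intro ξ τ
      have : ((ξ, τ) : X d) = (ξ, 0) + τ • (0, 1) := by simp
      rw [this, map_add, map_smul]; rfl
    have hfn : 1 ≤ ‖g‖ + |a| := by
      rw [← hf1]
      refine ContinuousLinearMap.opNorm_le_bound _ (by positivity) fun x => ?_
      obtain ⟨ξ, τ⟩ := x
      rw [hfe]
      have h1 : ‖ξ‖ ≤ ‖((ξ, τ) : X d)‖ := norm_fst_le (ξ, τ)
      have h2 : ‖τ‖ ≤ ‖((ξ, τ) : X d)‖ := norm_snd_le (ξ, τ)
      calc _ ≤ ‖g ξ‖ + ‖τ * a‖ := norm_add_le _ _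
        _ ≤ ‖g‖ * ‖((ξ, τ) : X d)‖ + ‖((ξ, τ) : X d)‖ * |a| := by
          rw [norm_mul, Real.norm_eq_abs a]; gcongr
          exact g.le_opNorm_of_le h1
        _ = _ := by ring
    have hfq : ∀ q ∈ S, |(-2) * g (c q) + a| < t := by
      intro q hq
      have := hf q hq
      simp only [v] at this
      rw [hfe, map_smul, smul_eq_mul, one_mul] at this; exact this
    have hgc : ∀ q ∈ S, |g (c q)| ≤ ‖g‖ * A := fun q hq => g.le_opNorm_of_le (hc q hq)
    have hβ : 1 ≤ 2 * (1 + 2 * A) * ‖g‖ := by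
      have h1 := hfq q0 hq0
      have h2 := hgc q0 hq0
      have h3 : |a| ≤ t + 2 * (‖g‖ * A) := by
        have : a = ((-2) * g (c q0) + a) + 2 * g (c q0) := by ring
        calc |a| ≤ |(-2) * g (c q0) + a| + |2 * g (c q0)| := by conv_lhs => rw [this]
                                                                exact abs_add_le _ _
          _ ≤ _ := by rw [abs_mul 2, abs_two]; linarith
      have h4 : t ≤ 1 / 2 := by
        refine le_trans ?_ hw1
        rw [hwt]; nlinarith
      nlinarith
    have hg0 : 0 < ‖g‖ := by
      by_contra h
      have : ‖g‖ = 0 := le_antisymm (not_lt.1 h) (norm_nonneg _)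
      rw [this] at hβ; linarith
    have hgw : t / (2 * ‖g‖) ≤ w := by
      rw [hwt, div_le_iff₀ (by positivity)]
      nlinarith
    let h0 := (InnerProductSpace.toDual ℝ (V d)).symm g
    have hh0 : ∀ y, ⟪h0, y⟫ = g y := fun y => InnerProductSpace.toDual_symm_apply
    have hb : ∀ q ∈ S, |⟪‖g‖⁻¹ • h0, c q⟫ + (-a / (2 * ‖g‖))| ≤ w := by
      intro q hq
      rw [real_inner_smul_left, hh0]
      have e : ‖g‖⁻¹ * g (c q) + -a / (2 * ‖g‖) = -((-2) * g (c q) + a) / (2 * ‖g‖) := by field_simp; ring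
      rw [e, abs_div, abs_neg, abs_of_pos (show 0 < 2 * ‖g‖ by positivity)]
      refine le_trans ?_ hgw
      gcongr
      exact (hfq q hq).le
    have hn : ‖‖g‖⁻¹ • h0‖ = 1 := by
      rw [norm_smul, norm_inv, norm_norm, LinearIsometryEquiv.norm_map, inv_mul_cancel₀ hg0.ne']
    refine ⟨‖g‖⁻¹ • h0, -a / (2 * ‖g‖), hn, ?_, hb⟩
    have h1 := hb q0 hq0
    have h2 : |⟪‖g‖⁻¹ • h0, c q0⟫| ≤ A := by
      refine (abs_real_inner_le_norm _ _).trans ?_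
      rw [hn, one_mul]; exact hc q0 hq0
    rw [abs_le] at *
    constructor <;> linarith [h1.1, h1.2, h2.1, h2.2]

end

end Dcp

end


section
open MeasureTheory Real
open scoped RealInnerProductSpace ENNReal NNReal

set_option linter.all false
namespace Dcp

section
variable {d : ℕ}

lemma hyper (e : ℕ) (h : V (e + 1)) (hh : ‖h‖ = 1) : ∃ (J : V e →ₗᵢ[ℝ] V (e + 1)) (P : V (e + 1) → V e), (∀ y, ⟪h, J y⟫ = 0) ∧
    ∀ ξ, ξ = ⟪h, ξ⟫ • h + J (P ξ) := by
  have h0 : h ≠ 0 := by rintro rfl; simp at hh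
  haveI : Fact (Module.finrank ℝ (V (e + 1)) = e + 1) := ⟨by simp⟩
  let bs := OrthonormalBasis.fromOrthogonalSpanSingleton (𝕜 := ℝ) e h0
  let J : V e →ₗᵢ[ℝ] V (e + 1) := (Submodule.span ℝ {h})ᗮ.subtypeₗᵢ.comp bs.repr.symm.toLinearIsometry
  have hm : ∀ ξ : V (e + 1), ξ - ⟪h, ξ⟫ • h ∈ (Submodule.span ℝ {h})ᗮ := by
    intro ξ
    rw [Submodule.mem_orthogonal_singleton_iff_inner_right, inner_sub_right, real_inner_smul_right, real_inner_self_eq_norm_sq, hh]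
    ring
  refine ⟨J, fun ξ => bs.repr ⟨_, hm ξ⟩, fun y => ?_, fun ξ => ?_⟩
  · have : J y ∈ (Submodule.span ℝ {h})ᗮ := (bs.repr.symm y).2
    rwa [Submodule.mem_orthogonal_singleton_iff_inner_right] at this
  · simp [J]

lemma nq_congr {p : ℝ} {Ω : X d → ℝ≥0∞} {F G : X d → ℂ} (h : ∀ x, ‖F x‖ₑ = ‖G x‖ₑ) : nq p Ω F = nq p Ω G := by
  unfold nq; simp_rw [h]

lemma cyl (e : ℕ) {p : ℝ} (hp : 2 ≤ p) {E B : ℕ} {A r w b : ℝ} {X' : ℝ≥0∞} (hr : 0 < r) (hw0 : 0 ≤ w) (hwr : w ≤ r)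
    (hw : w * (2 * |b| + w) ≤ r ^ 2) (hD : Dec e p E B A (2 * r) X') {h : V (e + 1)} (hh : ‖h‖ = 1)
    {Ω : X (e + 1) → ℝ≥0∞} (hΩ : Wt E ((2 * r) ^ 2) Ω) {ι : Type} (T : Finset ι) (c : ι → V (e + 1)) (G : ι → X (e + 1) → ℂ)
    (hc : ∀ Q ∈ T, ‖c Q‖ ≤ A ∧ |⟪h, c Q⟫ + b| ≤ w) (hcount : ∀ v, {Q | Q ∈ T ∧ ‖c Q - v‖ ≤ 6 * r}.ncard ≤ B)
    (hG : ∀ Q ∈ T, G Q ∈ ES {ω : X (e + 1) | ‖ω.1 - c Q‖ ≤ r ∧ |⟪h, ω.1⟫ + b| ≤ w ∧ |ω.2 - ‖ω.1‖ ^ 2| ≤ r ^ 2})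
    (hG0 : ∀ Q, G Q ∈ ES Set.univ) : nq p Ω (∑ Q ∈ T, G Q) ≤ X' * ∑ Q ∈ T, nq p Ω (G Q) := by
  have hp0 : 0 < p := by linarith
  obtain ⟨J, P, hJ0, hP⟩ := hyper e h hh
  have hJP : ∀ ξ y, ⟪J y, ξ⟫ = ⟪y, P ξ⟫ := by
    intro ξ y
    conv_lhs => rw [hP ξ]
    rw [inner_add_right, real_inner_smul_right, real_inner_comm h (J y), hJ0, mul_zero, zero_add, J.inner_map_map]
  have hnorm : ∀ (a : ℝ) (y : V e), ‖a • h + J y‖ ^ 2 = a ^ 2 + ‖y‖ ^ 2 := by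
    intro a y
    rw [norm_add_sq_real, real_inner_smul_left, hJ0, norm_smul, hh, J.norm_map, Real.norm_eq_abs, mul_one, sq_abs]; ring
  have hPn : ∀ ξ, ‖ξ‖ ^ 2 = ⟪h, ξ⟫ ^ 2 + ‖P ξ‖ ^ 2 := fun ξ => by conv_lhs => rw [hP ξ, hnorm]
  have hPd : ∀ ξ ξ', ‖ξ - ξ'‖ ^ 2 = (⟪h, ξ⟫ - ⟪h, ξ'⟫) ^ 2 + ‖P ξ - P ξ'‖ ^ 2 := by
    intro ξ ξ'
    rw [← hnorm]
    congr 2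
    conv_lhs => rw [hP ξ, hP ξ']
    rw [map_sub, sub_smul]; abel
  have hPd1 : ∀ ξ ξ', ‖P ξ - P ξ'‖ ≤ ‖ξ - ξ'‖ := fun ξ ξ' => by
    apply le_of_sq_le_sq _ (norm_nonneg _)
    rw [hPd]; nlinarith [sq_nonneg (⟪h, ξ⟫ - ⟪h, ξ'⟫)]
  have hPd2 : ∀ ξ ξ', ‖ξ - ξ'‖ ≤ |⟪h, ξ⟫ - ⟪h, ξ'⟫| + ‖P ξ - P ξ'‖ := fun ξ ξ' => by
    apply le_of_sq_le_sq _ (by positivity)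
    rw [hPd, add_sq, sq_abs]
    have := mul_nonneg (abs_nonneg (⟪h, ξ⟫ - ⟪h, ξ'⟫)) (norm_nonneg (P ξ - P ξ'))
    linarith
  have hP1 : ∀ ξ, ‖P ξ‖ ≤ ‖ξ‖ := fun ξ => by
    apply le_of_sq_le_sq _ (norm_nonneg _)
    rw [hPn]; nlinarith [sq_nonneg (⟪h, ξ⟫)]
  -- the coordinate map
  let T0 : ℝ × X e →ₗ[ℝ] X (e + 1) :=
    { toFun := fun y => (y.1 • h + J y.2.1, y.2.2)
      map_add' := by intro x y; ext1 <;> simp [add_smul]; abel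
      map_smul' := by intro a y; ext1 <;> simp [mul_smul] }
  have hinj : Function.Injective T0 := by
    rw [injective_iff_map_eq_zero]
    rintro ⟨u, y, t⟩ hz
    simp only [T0, LinearMap.coe_mk, AddHom.coe_mk, Prod.mk_eq_zero] at hz
    have := hnorm u y
    rw [hz.1] at this
    simp only [norm_zero] at this
    have h1 : u ^ 2 = 0 := by nlinarith [sq_nonneg u, sq_nonneg ‖y‖]
    have h2 : ‖y‖ ^ 2 = 0 := by nlinarith [sq_nonneg u, sq_nonneg ‖y‖]
    simp at h1 h2
    simp [h1, h2, hz.2]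
  let Tm : (ℝ × X e) ≃L[ℝ] X (e + 1) := (LinearEquiv.ofInjectiveOfFinrankEq T0 hinj (by
    rw [Module.finrank_prod, finrank_X, finrank_X]; simp; ring)).toContinuousLinearEquiv
  have hTm : ∀ u y t, Tm (u, (y, t)) = (u • h + J y, t) := fun u y t => rfl
  haveI : (volume : Measure (ℝ × X e)).IsAddHaarMeasure :=
    inferInstanceAs ((volume : Measure ℝ).prod (volume : Measure (X e))).IsAddHaarMeasure
  obtain ⟨cT, hcT0, hcTt, hcT⟩ := change_var Tm
  have hIntg : ∀ f : X (e + 1) → ℝ≥0∞, Measurable f → cT * ∫⁻ x, f x = ∫⁻ u : ℝ, ∫⁻ z : X e, f (Tm (u, z)) := by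
    intro f hf
    rw [← hcT]
    exact lintegral_prod _ (hf.comp Tm.continuous.measurable).aemeasurable
  -- modulated slices
  let md : (X (e + 1) → ℂ) → ℝ → X e → ℂ := fun F u z => ee (-(b ^ 2) * z.2) * F (Tm (u, z))
  have hmdn : ∀ F u z, ‖md F u z‖ₑ = ‖F (Tm (u, z))‖ₑ := by
    intro F u z
    simp only [md]
    rw [enorm_mul, ← ofReal_norm (ee _), norm_ee]; simp
  have hmd : ∀ (S : Set (X (e + 1))) (S' : Set (X e)), (∀ ω ∈ S, (P ω.1, ω.2 - b ^ 2) ∈ S') → ∀ F ∈ ES S, ∀ u, md F u ∈ ES S' := by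
    intro S S' hS F hF u
    induction hF using Submodule.span_induction with
    | mem F hF =>
      obtain ⟨ω, hω, rfl⟩ := hF
      have : md (chr ω) u = ee (u * ⟪h, ω.1⟫) • chr (P ω.1, ω.2 - b ^ 2) := by
        ext z
        obtain ⟨y, t⟩ := z
        simp only [md, chr, Pi.smul_apply, smul_eq_mul, ← ee_add, hTm]
        congr 1
        simp only [ph, inner_add_left, real_inner_smul_left, hJP]
        ring
      rw [this]
      exact Submodule.smul_mem _ _ (Submodule.subset_span ⟨_, hS ω hω, rfl⟩)
    | zero => convert (ES S').zero_mem using 1; ext z; simp [md]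
    | add F G _ _ h1 h2 => convert (ES S').add_mem h1 h2 using 1; ext z; simp [md, mul_add]
    | smul a F _ h1 => convert (ES S').smul_mem a h1 using 1; ext z; simp [md]; ring
  -- slice family
  have hFam : ∀ u, Fam A (2 * r) B T (fun Q => P (c Q)) (fun Q => md (G Q) u) := by
    intro u
    refine ⟨fun Q hQ => (hP1 _).trans (hc Q hQ).1, fun v => ?_, fun Q hQ => ?_, fun Q => hmd Set.univ Set.univ (fun _ _ => trivial) _ (hG0 Q) u⟩
    · by_cases he : ∃ Q0, Q0 ∈ T ∧ ‖P (c Q0) - v‖ ≤ 2 * r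
      · obtain ⟨Q0, hQ0, hQ0v⟩ := he
        refine le_trans (Set.ncard_le_ncard ?_ ?_) (hcount (c Q0))
        · rintro Q ⟨hQ, hQv⟩
          refine ⟨hQ, (hPd2 _ _).trans ?_⟩
          have h1 : ‖P (c Q) - P (c Q0)‖ ≤ 2 * r + 2 * r := by
            have : P (c Q) - P (c Q0) = (P (c Q) - v) - (P (c Q0) - v) := by abel
            rw [this]; exact (norm_sub_le _ _).trans (add_le_add hQv hQ0v)
          have h2 : |⟪h, c Q⟫ - ⟪h, c Q0⟫| ≤ w + w := by
            have : ⟪h, c Q⟫ - ⟪h, c Q0⟫ = (⟪h, c Q⟫ + b) - (⟪h, c Q0⟫ + b) := by ring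
            rw [this]; exact (abs_sub _ _).trans (add_le_add (hc Q hQ).2 (hc Q0 hQ0).2)
          linarith
        · exact T.finite_toSet.subset fun θ hθ => hθ.1
      · push Not at he
        have : {Q | Q ∈ T ∧ ‖P (c Q) - v‖ ≤ 2 * r} = ∅ := by
          ext Q; simp; intro hQ; exact he Q hQ
        rw [this]; simp
    · refine hmd _ _ ?_ _ (hG Q hQ) u
      rintro ω ⟨h1, h2, h3⟩
      refine ⟨((hPd1 _ _).trans h1).trans (by linarith), ?_⟩
      have e1 : ω.2 - b ^ 2 - ‖P ω.1‖ ^ 2 = (ω.2 - ‖ω.1‖ ^ 2) + (⟪h, ω.1⟫ + b) * (⟪h, ω.1⟫ - b) := by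
        rw [hPn ω.1]; ring
      have h4 : |⟪h, ω.1⟫ - b| ≤ 2 * |b| + w := by
        have : ⟪h, ω.1⟫ - b = (⟪h, ω.1⟫ + b) - 2 * b := by ring
        rw [this]
        refine (abs_sub _ _).trans ?_
        rw [abs_mul, abs_two]; linarith
      show |ω.2 - b ^ 2 - ‖P ω.1‖ ^ 2| ≤ (2 * r) ^ 2
      rw [e1]
      calc _ ≤ |ω.2 - ‖ω.1‖ ^ 2| + |⟪h, ω.1⟫ + b| * |⟪h, ω.1⟫ - b| := by rw [← abs_mul]; exact abs_add_le _ _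
        _ ≤ r ^ 2 + w * (2 * |b| + w) := by gcongr
        _ ≤ _ := by nlinarith [sq_nonneg r]
  have hWt : ∀ u, Wt E ((2 * r) ^ 2) (fun z : X e => Ω (Tm (u, z))) := by
    intro u
    refine ⟨hΩ.1.comp (Tm.continuous.measurable.comp (by fun_prop)), fun z z' => ?_⟩
    have e1 : Tm (u, z + z') = Tm (u, z) + Tm (0, z') := by rw [← map_add]; simp
    have e2 : ‖Tm (0, z')‖ = ‖z'‖ := by
      obtain ⟨y, t⟩ := z'
      rw [hTm, Prod.norm_def, Prod.norm_def]; simp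
    simp only
    rw [e1, ← e2]
    exact hΩ.2 _ _
  have hms : ∀ F : X (e + 1) → ℂ, F ∈ ES (Set.univ : Set (X (e + 1))) → Measurable fun x => ‖F x‖ₑ ^ p * Ω x :=
    fun F hF => (ES_meas hF p).mul hΩ.1
  have hsum : (∑ Q ∈ T, G Q) ∈ ES (Set.univ : Set (X (e + 1))) := Submodule.sum_mem _ fun Q _ => hG0 Q
  have hslice : ∀ u, ∫⁻ z : X e, ‖(∑ Q ∈ T, G Q) (Tm (u, z))‖ₑ ^ p * Ω (Tm (u, z)) ≤
      X' ^ (p / 2) * (∑ Q ∈ T, (∫⁻ z : X e, ‖G Q (Tm (u, z))‖ₑ ^ p * Ω (Tm (u, z))) ^ (1 / (p / 2))) ^ (p / 2) := by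
    intro u
    have := hD _ (hWt u) ι T _ _ (hFam u)
    have e1 : nq p (fun z : X e => Ω (Tm (u, z))) (∑ Q ∈ T, md (G Q) u) = (∫⁻ z : X e, ‖(∑ Q ∈ T, G Q) (Tm (u, z))‖ₑ ^ p * Ω (Tm (u, z))) ^ (2 / p) := by
      unfold nq
      congr 2; ext z
      have : (∑ Q ∈ T, md (G Q) u) z = md (∑ Q ∈ T, G Q) u z := by
        simp only [md, Finset.sum_apply, Finset.mul_sum]
      rw [this, hmdn]
    have e2 : ∀ Q, nq p (fun z : X e => Ω (Tm (u, z))) (md (G Q) u) = (∫⁻ z : X e, ‖G Q (Tm (u, z))‖ₑ ^ p * Ω (Tm (u, z))) ^ (1 / (p / 2)) := by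
      intro Q
      unfold nq; simp_rw [hmdn]; congr 1; field_simp
    rw [e1] at this
    simp_rw [e2] at this
    have := ENNReal.rpow_le_rpow this (show 0 ≤ p / 2 by positivity)
    rwa [← ENNReal.rpow_mul, div_mul_div_cancel₀ hp0.ne', div_self two_ne_zero, ENNReal.rpow_one,
      ENNReal.mul_rpow_of_nonneg _ _ (by positivity)] at this
  have hmeas : ∀ Q, Measurable fun u : ℝ => ∫⁻ z : X e, ‖G Q (Tm (u, z))‖ₑ ^ p * Ω (Tm (u, z)) := by
    intro Q
    exact Measurable.lintegral_prod_right' (f := fun y : ℝ × X e => ‖G Q (Tm y)‖ₑ ^ p * Ω (Tm y)) ((hms _ (hG0 Q)).comp Tm.continuous.measurable)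
  have hmk := minkowski' (volume : Measure ℝ) T hmeas (w := fun _ => 1) measurable_const (r := p / 2) (by linarith)
  simp only [mul_one] at hmk
  have key : cT * ∫⁻ x, ‖(∑ Q ∈ T, G Q) x‖ₑ ^ p * Ω x ≤ X' ^ (p / 2) * (∑ Q ∈ T, (cT * ∫⁻ x, ‖G Q x‖ₑ ^ p * Ω x) ^ (1 / (p / 2))) ^ (p / 2) := by
    rw [hIntg _ (hms _ hsum)]
    simp_rw [fun Q => hIntg _ (hms _ (hG0 Q))]
    refine (lintegral_mono hslice).trans ?_
    rw [lintegral_const_mul _ ((Finset.measurable_sum _ fun Q _ => (hmeas Q).pow_const _).pow_const _)]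
    exact mul_le_mul_right hmk _
  have key2 := ENNReal.rpow_le_rpow key (show 0 ≤ 2 / p by positivity)
  have e3 : 1 / (p / 2) = 2 / p := by field_simp
  simp_rw [e3, ENNReal.mul_rpow_of_nonneg _ _ (show 0 ≤ 2 / p by positivity)] at key2
  rw [← ENNReal.rpow_mul, ← ENNReal.rpow_mul, div_mul_div_cancel₀ two_ne_zero, div_self hp0.ne', ENNReal.rpow_one, ENNReal.rpow_one,
    ← Finset.mul_sum, mul_left_comm] at key2
  have hc0 : cT ^ (2 / p) ≠ 0 := by simp [ENNReal.rpow_eq_zero_iff, hcT0, hcTt]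
  have hct : cT ^ (2 / p) ≠ ∞ := ENNReal.rpow_ne_top_of_nonneg (by positivity) hcTt
  exact (ENNReal.mul_le_mul_iff_right hc0 hct).1 key2

end

end Dcp

end


section
open MeasureTheory Real
open scoped RealInnerProductSpace ENNReal NNReal

set_option linter.all false
namespace Dcp

section
variable {d : ℕ}

lemma lcond_iso {A : ℝ} {N : ℕ} (hN : 0 < N) {c : V d} (hc : ‖c‖ ≤ A) :
    LCond (iso d N) (cap ((d + 1) / N) c) (2 * (d + 1) ^ 2 + 2 * A * (d + 1)) := by
  have hA : 0 ≤ A := (norm_nonneg _).trans hc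
  have hN' : (1 : ℝ) ≤ N := by exact_mod_cast hN
  have hN0 : (0 : ℝ) < N := by linarith
  refine ⟨(c, ‖c‖ ^ 2), fun ω hω => ⟨(N : ℝ) • (ω - (c, ‖c‖ ^ 2)), ?_, fun y => ?_⟩⟩
  · have h1 : (N : ℝ) * ‖ω.1 - c‖ ≤ d + 1 := by rw [← le_div_iff₀' hN0]; exact hω.1
    have h2 : (N : ℝ) ^ 2 * |ω.2 - ‖ω.1‖ ^ 2| ≤ (d + 1) ^ 2 := by
      rw [← le_div_iff₀' (by positivity), ← div_pow]; exact hω.2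
    have hd : (0 : ℝ) ≤ d := Nat.cast_nonneg d
    rw [norm_smul, Real.norm_eq_abs, abs_of_pos hN0, Prod.norm_def, mul_max_of_nonneg _ _ hN0.le]
    apply max_le
    · show (N : ℝ) * ‖ω.1 - c‖ ≤ _
      nlinarith [mul_nonneg hA hd]
    · show (N : ℝ) * |ω.2 - ‖c‖ ^ 2| ≤ _
      have h3 : (N : ℝ) * |ω.2 - ‖ω.1‖ ^ 2| ≤ (d + 1) ^ 2 := by
        refine le_trans ?_ h2
        have := abs_nonneg (ω.2 - ‖ω.1‖ ^ 2)
        gcongr; nlinarith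
      have h4 : |‖ω.1‖ ^ 2 - ‖c‖ ^ 2| ≤ ‖ω.1 - c‖ * (‖ω.1 - c‖ + 2 * A) := by
        have e1 : ‖ω.1‖ ^ 2 - ‖c‖ ^ 2 = (‖ω.1‖ - ‖c‖) * (‖ω.1‖ + ‖c‖) := by ring
        rw [e1, abs_mul]
        have := norm_sub_norm_le ω.1 c
        have h5 : |‖ω.1‖ + ‖c‖| = ‖ω.1‖ + ‖c‖ := abs_of_nonneg (by positivity)
        rw [h5]
        exact mul_le_mul (abs_norm_sub_norm_le _ _) (by linarith) (by positivity) (norm_nonneg _)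
      have h6 : ‖ω.1 - c‖ ≤ d + 1 := by nlinarith [norm_nonneg (ω.1 - c)]
      have h7 : |ω.2 - ‖c‖ ^ 2| ≤ |ω.2 - ‖ω.1‖ ^ 2| + |‖ω.1‖ ^ 2 - ‖c‖ ^ 2| := abs_sub_le _ _ _
      calc (N : ℝ) * |ω.2 - ‖c‖ ^ 2| ≤ (N : ℝ) * (|ω.2 - ‖ω.1‖ ^ 2| + ‖ω.1 - c‖ * (‖ω.1 - c‖ + 2 * A)) := by gcongr; linarith
        _ = (N : ℝ) * |ω.2 - ‖ω.1‖ ^ 2| + ((N : ℝ) * ‖ω.1 - c‖) * (‖ω.1 - c‖ + 2 * A) := by ring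
        _ ≤ (d + 1) ^ 2 + (d + 1) * ((d + 1) + 2 * A) := by gcongr
        _ = _ := by ring
  · rw [iso_apply, ph_smul_left, ph_smul_right]

/-- local `L^1` average -/
def cq {ι : Type} (M N : ℕ) (F : ι → X d → ℂ) (q : Finset ι) (x : X d) : ℝ≥0∞ :=
  avg M (iso d N) (fun y => ‖FS F q y‖ₑ ^ (1 : ℝ)) x

/-- local squared `L^p` average -/
def AA (p : ℝ) (M K : ℕ) (G : X d → ℂ) (x : X d) : ℝ≥0∞ := (avg M (iso d K) (fun y => ‖G y‖ₑ ^ p) x) ^ (2 / p)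

lemma cq_harn {ι : Type} {M N K : ℕ} (hK : K ≤ N) (hN : 0 < N) {F : ι → X d → ℂ} {q : Finset ι}
    (hF : FS F q ∈ ES (Set.univ : Set (X d))) (x y : X d) : cq M N F q (x + iso d K y) ≤ br ‖y‖ ^ M * cq M N F q x := by
  have hN0 : (0 : ℝ) < N := by exact_mod_cast hN
  have h := avg_harn M (iso d N) (ES_meas hF 1) x (((K : ℝ) / N) • y)
  rw [iso_apply, smul_smul, mul_div_cancel₀ _ hN0.ne', one_mul] at h
  refine h.trans ?_
  refine mul_le_mul_left (pow_le_pow_left' (br_mono ?_) M) _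
  rw [norm_smul, Real.norm_eq_abs, abs_of_nonneg (by positivity)]
  refine mul_le_of_le_one_left (norm_nonneg _) ((div_le_one hN0).2 (by exact_mod_cast hK))

lemma AA_le {p : ℝ} (hp : 2 ≤ p) {M M1 K : ℕ} (hM : ⌈p⌉₊ * M1 + (d + 2) ≤ M) {G : X d → ℂ} {x : X d} {a : ℝ≥0∞}
    (h : ∀ y, ‖G (x + iso d K y)‖ₑ ≤ br ‖y‖ ^ M1 * a) : AA p M K G x ≤ (∫⁻ y : X d, Phi (d + 2) y) ^ (2 / p) * a ^ 2 := by
  have hp0 : 0 < p := by linarith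
  have h1 : avg M (iso d K) (fun y => ‖G y‖ₑ ^ p) x ≤ (∫⁻ y : X d, Phi (d + 2) y) * a ^ p := by
    unfold avg
    rw [← lintegral_mul_const _ (measurable_Phi _)]
    refine lintegral_mono fun y => ?_
    have h2 : ‖G (x + iso d K y)‖ₑ ^ p ≤ br ‖y‖ ^ (⌈p⌉₊ * M1) * a ^ p := by
      refine (ENNReal.rpow_le_rpow (h y) hp0.le).trans ?_
      rw [ENNReal.mul_rpow_of_nonneg _ _ hp0.le]
      refine mul_le_mul_left ?_ _
      have h3 : (1 : ℝ≥0∞) ≤ br ‖y‖ ^ M1 := one_le_pow₀ (one_le_br (norm_nonneg _))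
      calc (br ‖y‖ ^ M1) ^ p ≤ (br ‖y‖ ^ M1) ^ ((⌈p⌉₊ : ℕ) : ℝ) := ENNReal.rpow_le_rpow_of_exponent_le h3 (Nat.le_ceil p)
        _ = _ := by rw [ENNReal.rpow_natCast, ← pow_mul, mul_comm]
    calc ‖G (x + iso d K y)‖ₑ ^ p * Phi M y ≤ (br ‖y‖ ^ (⌈p⌉₊ * M1) * a ^ p) * Phi (⌈p⌉₊ * M1 + (d + 2)) y :=
          mul_le_mul' h2 (Phi_anti hM y)
      _ = (br ‖y‖ ^ (⌈p⌉₊ * M1) * Phi (⌈p⌉₊ * M1 + (d + 2)) y) * a ^ p := by ring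
      _ = _ := by rw [br_mul_Phi]
  refine (ENNReal.rpow_le_rpow h1 (show 0 ≤ 2 / p by positivity)).trans ?_
  rw [ENNReal.mul_rpow_of_nonneg _ _ (by positivity), ← ENNReal.rpow_mul, mul_div_cancel₀ _ hp0.ne', ENNReal.rpow_two]

lemma AA_add {p : ℝ} (hp : 2 ≤ p) (M K : ℕ) {G H : X d → ℂ} (hG : G ∈ ES (Set.univ : Set (X d))) (hH : H ∈ ES (Set.univ : Set (X d)))
    (x : X d) : AA p M K (G + H) x ≤ 4 * (AA p M K G x + AA p M K H x) := by
  have hp0 : 0 < p := by linarith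
  have h1 : avg M (iso d K) (fun y => ‖(G + H) y‖ₑ ^ p) x ≤ 2 ^ p * (avg M (iso d K) (fun y => ‖G y‖ₑ ^ p) x +
      avg M (iso d K) (fun y => ‖H y‖ₑ ^ p) x) := by
    have hmG := ES_meas hG p
    have hmH := ES_meas hH p
    have e : avg M (iso d K) (fun y => ‖G y‖ₑ ^ p) x + avg M (iso d K) (fun y => ‖H y‖ₑ ^ p) x =
        avg M (iso d K) (fun y => ‖G y‖ₑ ^ p + ‖H y‖ₑ ^ p) x := by
      unfold avg
      have hm : Measurable fun y : X d => ‖G (x + iso d K y)‖ₑ ^ p * Phi M y :=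
        (hmG.comp (show Measurable fun y : X d => x + iso d K y by fun_prop)).mul (measurable_Phi M)
      rw [← lintegral_add_left hm]
      congr 1; ext y; rw [add_mul]
    have hmm : Measurable fun y => ‖G y‖ₑ ^ p + ‖H y‖ₑ ^ p := hmG.add hmH
    rw [e, ← avg_const_mul _ _ hmm]
    refine avg_mono _ _ (fun y => ?_) x
    have h2 : ‖(G + H) y‖ₑ ≤ 2 * max ‖G y‖ₑ ‖H y‖ₑ := by
      refine (enorm_add_le _ _).trans ?_
      rw [two_mul]
      exact add_le_add (le_max_left _ _) (le_max_right _ _)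
    refine (ENNReal.rpow_le_rpow h2 hp0.le).trans ?_
    rw [ENNReal.mul_rpow_of_nonneg _ _ hp0.le]
    refine mul_le_mul_right ?_ _
    rcases le_total ‖G y‖ₑ ‖H y‖ₑ with h | h
    · rw [max_eq_right h]; exact le_add_self
    · rw [max_eq_left h]; exact le_self_add
  have h2 : (0 : ℝ) ≤ 2 / p := by positivity
  refine (ENNReal.rpow_le_rpow h1 h2).trans ?_
  rw [ENNReal.mul_rpow_of_nonneg _ _ h2, ← ENNReal.rpow_mul, mul_div_cancel₀ _ hp0.ne']
  refine mul_le_mul' (by norm_num) (ENNReal.rpow_add_le_add_rpow _ _ h2 ((div_le_one hp0).2 hp))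

lemma AA_dec {p : ℝ} (hp : 2 ≤ p) {M K : ℕ} (hK : 0 < K) {κ : ℝ} (hκ : (K : ℝ)⁻¹ ≤ κ) {ι : Type} (T : Finset ι) (G : ι → X d → ℂ) {X' : ℝ≥0∞}
    (h : ∀ Ω : X d → ℝ≥0∞, Wt M κ Ω → nq p Ω (∑ Q ∈ T, G Q) ≤ X' * ∑ Q ∈ T, nq p Ω (G Q)) (x : X d) :
    AA p M K (∑ Q ∈ T, G Q) x ≤ X' * ∑ Q ∈ T, AA p M K (G Q) x := by
  have hp0 : 0 < p := by linarith
  have hK0 : (0 : ℝ) < K := by exact_mod_cast hK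
  set Ω : X d → ℝ≥0∞ := fun z => Phi M ((K : ℝ)⁻¹ • (z - x)) with hΩ
  have hW : Wt M κ Ω := by
    refine ⟨(measurable_Phi M).comp (by fun_prop), fun z y => ?_⟩
    have h1 := Phi_shift M ((K : ℝ)⁻¹ • (z + y - x)) (-((K : ℝ)⁻¹ • y))
    have e1 : (K : ℝ)⁻¹ • (z + y - x) + -((K : ℝ)⁻¹ • y) = (K : ℝ)⁻¹ • (z - x) := by
      rw [← smul_neg, ← smul_add]; congr 1; abel
    rw [e1] at h1
    refine h1.trans (mul_le_mul_left (pow_le_pow_left' (br_mono ?_) M) _)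
    rw [norm_neg, norm_smul, Real.norm_eq_abs, abs_of_pos (by positivity)]
    gcongr
  let T0 : X d ≃L[ℝ] X d := ContinuousLinearEquiv.smulLeft (Units.mk0 (K : ℝ) hK0.ne')
  obtain ⟨cT, hc0, hct, hcv⟩ := change_var T0
  have hIntg : ∀ H : X d → ℂ, avg M (iso d K) (fun y => ‖H y‖ₑ ^ p) x = cT * ∫⁻ z, ‖H z‖ₑ ^ p * Ω z := by
    intro H
    rw [← lintegral_add_left_eq_self (fun z => ‖H z‖ₑ ^ p * Ω z) x, ← hcv]
    unfold avg
    congr 1; ext y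
    have e1 : T0 y = (K : ℝ) • y := rfl
    simp only [hΩ, e1, iso_apply]
    congr 2
    rw [add_sub_cancel_left, smul_smul, inv_mul_cancel₀ hK0.ne', one_smul]
  have hA : ∀ H : X d → ℂ, AA p M K H x = cT ^ (2 / p) * nq p Ω H := by
    intro H
    unfold AA nq
    rw [hIntg, ENNReal.mul_rpow_of_nonneg _ _ (by positivity)]
  simp_rw [hA, ← Finset.mul_sum]
  rw [mul_left_comm]
  exact mul_le_mul_right (h Ω hW) _

end

end Dcp

end


section
open MeasureTheory Real
open scoped RealInnerProductSpace ENNReal NNReal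

set_option linter.all false
namespace Dcp

section
variable {d : ℕ}

lemma AA_cq (d : ℕ) {p : ℝ} (hp : 2 ≤ p) (A : ℝ) (M1 : ℕ) (hM1 : d + 2 ≤ M1) : ∃ C : ℝ≥0, ∀ (M2 K N1 B : ℕ) (s : ℝ), ⌈p⌉₊ * M1 + (d + 2) ≤ M2 →
    K ≤ N1 → 0 < N1 → 0 ≤ s → s * N1 ≤ 1 → ∀ (ι : Type) (S0 : Finset ι) (c : ι → V d) (F : ι → X d → ℂ), Fam A s B S0 c F →
    ∀ 𝒜 ⊆ gc c N1 S0, ∀ x, AA p M2 K (∑ q ∈ 𝒜, FS F q) x ≤ C * (∑ q ∈ 𝒜, cq M1 N1 F q x) ^ 2 := by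
  obtain ⟨C, hC⟩ := loc_const d (2 * (d + 1) ^ 2 + 2 * A * (d + 1)) M1 hM1 le_rfl
  refine ⟨(∫⁻ y : X d, Phi (d + 2) y).toNNReal ^ (2 / p) * C ^ 2, ?_⟩
  intro M2 K N1 B s hM2 hK hN1 hs hsN ι S0 c F hF 𝒜 h𝒜 x
  have hI : ((∫⁻ y : X d, Phi (d + 2) y).toNNReal : ℝ≥0∞) = ∫⁻ y : X d, Phi (d + 2) y := ENNReal.coe_toNNReal (I_ne_top d le_rfl)
  have key := AA_le (d := d) hp (M := M2) (M1 := M1) (K := K) hM2 (G := ∑ q ∈ 𝒜, FS F q) (x := x) (a := C * ∑ q ∈ 𝒜, cq M1 N1 F q x) (by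
    intro y
    rw [Finset.sum_apply]
    refine (enorm_sum_le _ _).trans ?_
    rw [Finset.mul_sum, Finset.mul_sum]
    refine Finset.sum_le_sum fun q hq => ?_
    have hq' := h𝒜 hq
    have hb : ‖ctr c q‖ ≤ A := by
      obtain ⟨θ, hθ, e⟩ := ctr_spec c (cells_nonempty hq')
      rw [e]; exact hF.1 θ (cells_sub hq' hθ)
    have h1 := hC _ _ (lcond_iso hN1 hb) _ (gc_mem hF hs hN1 hsN hq') (x + iso d K y)
    rw [ENNReal.rpow_one] at h1
    refine h1.trans ?_
    have h2 := cq_harn (M := M1) hK hN1 (FS_mem0 hF q) x y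
    calc C * cq M1 N1 F q (x + iso d K y) ≤ C * (br ‖y‖ ^ M1 * cq M1 N1 F q x) := mul_le_mul_right h2 _
      _ = _ := by ring)
  refine key.trans (le_of_eq ?_)
  rw [mul_pow, ← mul_assoc]
  push_cast
  rw [ENNReal.coe_rpow_of_nonneg _ (by positivity), hI]

lemma narrow (e : ℕ) {p : ℝ} (hp : 2 ≤ p) {A s : ℝ} (hA : 0 ≤ A) {B M2 NQ k : ℕ} (hNQ : e + 2 ≤ NQ) (hk : e + 2 ≤ k) (hs : 0 ≤ s)
    (hsN : s * (NQ * k : ℕ) ≤ 1) {r w : ℝ} (hr : r = (e + 2) / NQ) (hw : w = r ^ 2 / (2 * A + 4)) (hw2 : ((e + 2) : ℝ) / (NQ * k : ℕ) ≤ w / 2) {X' : ℝ≥0∞}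
    (hD : Dec e p M2 ((2 * (12 * (e + 2) + 1) + 1) ^ (e + 1)) A (2 * r) X')
    {ι : Type} {S0 : Finset ι} {c : ι → V (e + 1)} {F : ι → X (e + 1) → ℂ} (hF : Fam A s B S0 c F)
    (P : Finset ι → Prop) [DecidablePred P] (h : V (e + 1)) (b : ℝ) (hh : ‖h‖ = 1) (hb : |b| ≤ A + 1)
    (hP : ∀ q ∈ gc c (NQ * k) S0, P q → |⟪h, ctr c q⟫ + b| ≤ w / 2) (x : X (e + 1)) :
    AA p M2 (NQ ^ 2) (∑ q ∈ (gc c (NQ * k) S0).filter P, FS F q) x ≤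
      X' * ∑ Q ∈ gc c NQ S0, AA p M2 (NQ ^ 2) (∑ q ∈ (gc c (NQ * k) Q).filter P, FS F q) x := by
  classical
  have hp0 : 0 < p := by linarith
  have hNQ0 : 0 < NQ := by omega
  have hk0 : 0 < k := by omega
  have hN1 : 0 < NQ * k := Nat.mul_pos hNQ0 hk0
  have hNQr : (0 : ℝ) < NQ := by exact_mod_cast hNQ0
  have hkr : ((e : ℝ) + 2) ≤ k := by exact_mod_cast hk
  have hr0 : 0 < r := by rw [hr]; positivity
  have hr1 : r ≤ 1 := by rw [hr, div_le_one hNQr]; exact_mod_cast hNQ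
  have hw0 : 0 < w := by rw [hw]; positivity
  have hwr2 : w * (2 * A + 4) = r ^ 2 := by rw [hw]; field_simp
  have hwr : w ≤ r := by nlinarith
  have hw1 : w ≤ 1 := by linarith
  have hsub : ∀ Q ∈ gc c NQ S0, gc c (NQ * k) Q ⊆ gc c (NQ * k) S0 := fun Q hQ q hq =>
    ((cells_cells_iff (fun θ θ' h => lab_refine hk0 h) hQ).1 hq).1
  set G : Finset ι → X (e + 1) → ℂ := fun Q => ∑ q ∈ (gc c (NQ * k) Q).filter P, FS F q with hG
  set T := (gc c NQ S0).filter (fun Q => ((gc c (NQ * k) Q).filter P).Nonempty) with hT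
  have hsum : ∑ q ∈ (gc c (NQ * k) S0).filter P, FS F q = ∑ Q ∈ T, G Q := by
    rw [Finset.sum_filter, ← gc_refine c NQ hk0, hT, Finset.sum_filter_of_ne]
    · refine Finset.sum_congr rfl fun Q _ => ?_
      simp only [hG]; rw [Finset.sum_filter]
    · intro Q hQ hne
      by_contra hcon
      rw [Finset.not_nonempty_iff_eq_empty] at hcon
      exact hne (by simp only [hG]; rw [hcon, Finset.sum_empty])
  let qq : Finset ι → Finset ι := fun Q => if hQ : ((gc c (NQ * k) Q).filter P).Nonempty then hQ.choose else ∅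
  have hqq : ∀ Q ∈ T, qq Q ∈ gc c (NQ * k) Q ∧ P (qq Q) := by
    intro Q hQ
    have hne := (Finset.mem_filter.1 hQ).2
    have := hne.choose_spec
    have e1 : qq Q = hne.choose := dif_pos hne
    rw [e1]
    exact Finset.mem_filter.1 this
  let cc : Finset ι → V (e + 1) := fun Q => ctr c (qq Q)
  have hcc : ∀ Q ∈ T, ∃ θ ∈ Q, cc Q = c θ := by
    intro Q hQ
    obtain ⟨θ, hθ, e1⟩ := ctr_spec c (cells_nonempty (hqq Q hQ).1)
    exact ⟨θ, cells_sub (hqq Q hQ).1 hθ, e1⟩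
  rw [hsum]
  refine (AA_dec hp (by positivity) (κ := (2 * r) ^ 2) ?_ T G (X' := X') ?_ x).trans ?_
  · rw [hr]; push_cast
    rw [mul_pow, div_pow, ← mul_div_assoc, inv_eq_one_div]
    have : (0 : ℝ) ≤ e := Nat.cast_nonneg e
    gcongr; nlinarith
  · intro Ω hΩ
    refine cyl e (b := b) hp hr0 hw0.le hwr ?_ hD hh hΩ T cc G ?_ ?_ ?_ ?_
    · nlinarith [abs_nonneg b]
    · intro Q hQ
      obtain ⟨θ, hθ, e1⟩ := hcc Q hQ
      have hQS := (Finset.mem_filter.1 hQ).1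
      refine ⟨?_, ?_⟩
      · rw [e1]; exact hF.1 θ (cells_sub hQS hθ)
      · exact (hP _ (hsub Q hQS (hqq Q hQ).1) (hqq Q hQ).2).trans (by linarith)
    · intro v
      set m := 12 * (e + 2) + 1 with hm
      set Z := T.filter (fun Q => ‖cc Q - v‖ ≤ 6 * r) with hZ
      have e1 : {Q | Q ∈ T ∧ ‖cc Q - v‖ ≤ 6 * r} = (Z : Set (Finset ι)) := by ext Q; simp [hZ]
      rw [e1, Set.ncard_coe_finset]
      rcases Z.eq_empty_or_nonempty with hZe | ⟨Q0, hQ0⟩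
      · rw [hZe]; simp
      · have hcard : (Fintype.piFinset fun i : Fin (e + 1) => Finset.Icc (lab NQ (cc Q0) i - m) (lab NQ (cc Q0) i + m)).card =
            (2 * m + 1) ^ (e + 1) := by
          simp only [Fintype.card_piFinset, Int.card_Icc]
          have : ∀ i, (lab NQ (cc Q0) i + (m : ℤ) + 1 - (lab NQ (cc Q0) i - m)).toNat = 2 * m + 1 := by intro i; omega
          simp [this]
        rw [← hcard]
        refine Finset.card_le_card_of_injOn (fun Q => lab NQ (cc Q)) ?_ ?_
        · intro Q hQ
          have hQ' := (Finset.mem_filter.1 hQ)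
          have hQ0' := (Finset.mem_filter.1 hQ0)
          have hfar : ∀ i, |lab NQ (cc Q) i - lab NQ (cc Q0) i| ≤ (m : ℤ) := by
            by_contra hcon
            have h1 := lab_far hcon
            have h2 : ‖cc Q - cc Q0‖ ≤ 12 * r := by
              have := norm_sub_le (cc Q - v) (cc Q0 - v)
              rw [sub_sub_sub_cancel_right] at this
              linarith [hQ'.2, hQ0'.2]
            have h3 : (NQ : ℝ) * (12 * r) = 12 * (e + 2) := by rw [hr]; field_simp
            have h4 : (m : ℝ) = 12 * (e + 2) + 1 := by rw [hm]; push_cast; ring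
            have h5 := mul_le_mul_of_nonneg_left h2 hNQr.le
            linarith
          simp only [Fintype.coe_piFinset, Set.mem_pi, Set.mem_univ, forall_const, Finset.coe_Icc, Set.mem_Icc]
          intro i
          have := abs_le.1 (hfar i)
          constructor <;> linarith
        · intro Q hQ Q' hQ' heq
          have hQ1 := (Finset.mem_filter.1 hQ).1
          have hQ2 := (Finset.mem_filter.1 hQ').1
          obtain ⟨θ, hθ, e2⟩ := hcc Q hQ1
          obtain ⟨θ', hθ', e3⟩ := hcc Q' hQ2
          simp only [e2, e3] at heq
          rw [cells_filter (Finset.mem_filter.1 hQ1).1 hθ, cells_filter (Finset.mem_filter.1 hQ2).1 hθ', heq]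
    · intro Q hQ
      have hQS := (Finset.mem_filter.1 hQ).1
      refine Submodule.sum_mem _ fun q hq => ?_
      have hq1 := Finset.mem_filter.1 hq
      have hqS := hsub Q hQS hq1.1
      refine ES_mono ?_ (gc_mem hF hs hN1 hsN hqS)
      intro ω hω
      have hc1 : ((((e + 1 : ℕ) : ℝ) + 1) / (NQ * k : ℕ)) = ((e : ℝ) + 2) / (NQ * k : ℕ) := by push_cast; ring
      have hω1 := hω.1
      have hω2 := hω.2
      rw [hc1] at hω1 hω2
      have hk1 : ((e : ℝ) + 2) / (NQ * k : ℕ) ≤ 1 / NQ := by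
        push_cast
        rw [div_le_div_iff₀ (by positivity) hNQr]
        nlinarith
      have hr2 : r = (e + 1) / NQ + 1 / NQ := by rw [hr]; ring
      refine ⟨?_, ?_, ?_⟩
      · obtain ⟨θ, hθ, e1⟩ := hcc Q hQ
        obtain ⟨θ', hθ', e2⟩ := ctr_spec c (cells_nonempty hqS)
        have h1 := gc_close hNQ0 hQS (cells_sub hq1.1 hθ') hθ
        rw [← e1, ← e2] at h1
        have h2 : ‖ctr c q - cc Q‖ ≤ (e + 1) / NQ := by rw [le_div_iff₀' hNQr]; exact_mod_cast h1
        have h3 := norm_add_le (ω.1 - ctr c q) (ctr c q - cc Q)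
        rw [sub_add_sub_cancel] at h3
        linarith
      · have h1 := hP q hqS hq1.2
        have h2 : ⟪h, ω.1⟫ + b = (⟪h, ctr c q⟫ + b) + ⟪h, ω.1 - ctr c q⟫ := by rw [inner_sub_right]; ring
        rw [h2]
        have h3 := abs_real_inner_le_norm h (ω.1 - ctr c q)
        rw [hh, one_mul] at h3
        have := abs_add_le (⟪h, ctr c q⟫ + b) ⟪h, ω.1 - ctr c q⟫
        linarith
      · refine hω2.trans (pow_le_pow_left₀ (by positivity) ?_ 2)
        refine hk1.trans ?_
        rw [hr2]
        have : (0 : ℝ) ≤ (e + 1) / NQ := by positivity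
        linarith
    · intro Q
      exact Submodule.sum_mem _ fun q _ => FS_mem0 hF q
  · exact mul_le_mul_right (Finset.sum_le_sum_of_subset (Finset.filter_subset _ _)) _

end

end Dcp

end


section
open MeasureTheory Real
open scoped RealInnerProductSpace ENNReal NNReal

set_option linter.all false
namespace Dcp

section
variable {d : ℕ}
open Classical

/-- transversal tuples of cells -/
def TT {ι : Type} (c : ι → V d) (N : ℕ) (S : Finset ι) (Kt : ℝ) : Finset (Fin (d + 1) → Finset ι) :=
  (Fintype.piFinset fun _ => gc c N S).filter (fun τ => ∃ L : (Fin (d + 1) → ℝ) ≃L[ℝ] X d, ‖(L : (Fin (d + 1) → ℝ) →L[ℝ] X d)‖ ≤ Kt ∧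
    ‖(L.symm : X d →L[ℝ] (Fin (d + 1) → ℝ))‖ ≤ Kt ∧ (∀ i, L (Pi.single i 1) = ((-2 : ℝ) • ctr c (τ i), 1)))

lemma sum_sq_le {κ : Type} (s : Finset κ) (f : κ → ℝ≥0∞) : ∑ i ∈ s, f i ^ 2 ≤ (∑ i ∈ s, f i) ^ 2 := by
  calc ∑ i ∈ s, f i ^ 2 ≤ ∑ i ∈ s, f i * ∑ j ∈ s, f j := Finset.sum_le_sum fun i hi => by
        rw [sq]; exact mul_le_mul_right (Finset.single_le_sum (f := f) (fun _ _ => zero_le) hi) _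
    _ = _ := by rw [← Finset.sum_mul, sq]

lemma small_sum {κ : Type} (s : Finset κ) (f : κ → ℝ≥0∞) {NN : ℕ} (hNN : s.card ≤ NN) (hN1 : 1 ≤ NN) {p : ℝ} (hp : 2 ≤ p)
    (t : Finset κ) (ht : t ⊆ s) (h : ∀ q ∈ t, (NN : ℝ≥0∞) ^ 2 * f q ≤ ∑ q ∈ s, f q) :
    (∑ q ∈ t, f q) ^ 2 ≤ (∑ q ∈ s, f q ^ p) ^ (2 / p) := by
  have hp0 : 0 < p := by linarith
  set ρ := (∑ q ∈ s, f q ^ p) ^ (1 / p) with hρ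
  have hN0 : (NN : ℝ≥0∞) ≠ 0 := by simp; omega
  have hNt : (NN : ℝ≥0∞) ≠ ∞ := ENNReal.natCast_ne_top NN
  have h1 : ∀ q ∈ s, f q ≤ ρ := by
    intro q hq
    have := ENNReal.rpow_le_rpow (Finset.single_le_sum (f := fun q => f q ^ p) (fun _ _ => zero_le) hq) (show 0 ≤ 1 / p by positivity)
    rwa [← ENNReal.rpow_mul, mul_one_div_cancel hp0.ne', ENNReal.rpow_one] at this
  have h2 : ∑ q ∈ s, f q ≤ NN * ρ := by
    refine (Finset.sum_le_card_nsmul _ _ _ h1).trans ?_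
    rw [nsmul_eq_mul]; gcongr
  have h3 : ∀ q ∈ t, (NN : ℝ≥0∞) * f q ≤ ρ := by
    intro q hq
    have h4 := (h q hq).trans h2
    rw [sq, mul_assoc] at h4
    exact (ENNReal.mul_le_mul_iff_right hN0 hNt).1 h4
  have h5 : ∑ q ∈ t, f q ≤ ρ := by
    have h6 : (NN : ℝ≥0∞) * ∑ q ∈ t, f q ≤ NN * ρ := by
      rw [Finset.mul_sum]
      refine (Finset.sum_le_card_nsmul _ _ _ h3).trans ?_
      rw [nsmul_eq_mul]
      have : t.card ≤ NN := (Finset.card_le_card ht).trans hNN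
      gcongr
    exact (ENNReal.mul_le_mul_iff_right hN0 hNt).1 h6
  calc (∑ q ∈ t, f q) ^ 2 ≤ ρ ^ 2 := pow_le_pow_left' h5 2
    _ = _ := by rw [hρ, ← ENNReal.rpow_natCast, ← ENNReal.rpow_mul]; congr 1; push_cast; ring

lemma pw (e : ℕ) {p : ℝ} (hp : 2 ≤ p) {A : ℝ} (hA : 0 ≤ A) (M1 : ℕ) (hM1 : e + 3 ≤ M1) : ∃ C : ℝ≥0, ∀ (B M2 NQ k NN : ℕ) (s r w : ℝ) (X' : ℝ≥0∞),
    ⌈p⌉₊ * M1 + (e + 3) ≤ M2 → e + 2 ≤ NQ → e + 2 ≤ k → NQ ≤ k → 0 ≤ s → s * (NQ * k : ℕ) ≤ 1 → r = (e + 2) / NQ →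
    w = r ^ 2 / (2 * A + 4) → ((e + 2) : ℝ) / (NQ * k : ℕ) ≤ w / 2 → 1 ≤ NN → 1 ≤ X' →
    Dec e p M2 ((2 * (12 * (e + 2) + 1) + 1) ^ (e + 1)) A (2 * r) X' →
    ∀ (ι : Type) (S0 : Finset ι) (c : ι → V (e + 1)) (F : ι → X (e + 1) → ℂ), Fam A s B S0 c F → (gc c (NQ * k) S0).card ≤ NN → ∀ x,
    AA p M2 (NQ ^ 2) (FS F S0) x ≤ C * X' * (∑ Q ∈ gc c NQ S0, AA p M2 (NQ ^ 2) (FS F Q) x +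
      (∑ q ∈ gc c (NQ * k) S0, cq M1 (NQ * k) F q x ^ p) ^ (2 / p)) +
      C * NN ^ 4 * (∑ τ ∈ TT c (NQ * k) S0 (KT (e + 1) A (w / 2)), ∏ i, (cq M1 (NQ * k) F (τ i) x ^ (2 : ℝ)) ^ (p / (2 * (e + 1 + 1 : ℕ)))) ^ (2 / p) := by
  obtain ⟨C, hC⟩ := AA_cq (e + 1) hp A M1 hM1
  refine ⟨16 + 20 * C, ?_⟩
  intro B M2 NQ k NN s r w X' hM2 hNQ hk hNQk hs hsN hr hw hw2 hNN hX hD ι S0 c F hF hcard x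
  have hp0 : 0 < p := by linarith
  have hNQ0 : 0 < NQ := by omega
  have hk0 : 0 < k := by omega
  have hN1 : 0 < NQ * k := Nat.mul_pos hNQ0 hk0
  have hNQr : (0 : ℝ) < NQ := by exact_mod_cast hNQ0
  have hK : NQ ^ 2 ≤ NQ * k := by nlinarith
  have hr0 : 0 < r := by rw [hr]; positivity
  have hr1 : r ≤ 1 := by rw [hr, div_le_one hNQr]; exact_mod_cast hNQ
  have hw0 : 0 < w := by rw [hw]; positivity
  have hwr2 : w * (2 * A + 4) = r ^ 2 := by rw [hw]; field_simp
  have hw1 : w / 2 ≤ 1 / 2 := by nlinarith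
  have hCA : ∀ 𝒜 ⊆ gc c (NQ * k) S0, AA p M2 (NQ ^ 2) (∑ q ∈ 𝒜, FS F q) x ≤ C * (∑ q ∈ 𝒜, cq M1 (NQ * k) F q x) ^ 2 := fun 𝒜 h𝒜 =>
    hC M2 (NQ ^ 2) (NQ * k) B s hM2 hK hN1 hs hsN ι S0 c F hF 𝒜 h𝒜 x
  have hsub : ∀ Q ∈ gc c NQ S0, gc c (NQ * k) Q ⊆ gc c (NQ * k) S0 := fun Q hQ q hq =>
    ((cells_cells_iff (fun θ θ' h => lab_refine hk0 h) hQ).1 hq).1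
  set f : Finset ι → ℝ≥0∞ := fun q => cq M1 (NQ * k) F q x with hf
  set σ := ∑ q ∈ gc c (NQ * k) S0, f q with hσ
  set P : Finset ι → Prop := fun q => σ ≤ NN ^ 2 * f q with hP
  have hctr : ∀ q ∈ gc c (NQ * k) S0, ‖ctr c q‖ ≤ A := by
    intro q hq
    obtain ⟨θ, hθ, e1⟩ := ctr_spec c (cells_nonempty hq)
    rw [e1]; exact hF.1 θ (cells_sub hq hθ)
  have hES : ∀ 𝒜 : Finset (Finset ι), (∑ q ∈ 𝒜, FS F q) ∈ ES (Set.univ : Set (X (e + 1))) := fun 𝒜 =>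
    Submodule.sum_mem _ fun q _ => FS_mem0 hF q
  have halt : (∃ (h : V (e + 1)) (b : ℝ), ‖h‖ = 1 ∧ |b| ≤ A + 1 ∧ ∀ q ∈ (gc c (NQ * k) S0).filter P, |⟪h, ctr c q⟫ + b| ≤ w / 2) ∨
      ∃ τ : Fin (e + 1 + 1) → Finset ι, (∀ i, τ i ∈ (gc c (NQ * k) S0).filter P) ∧ τ ∈ TT c (NQ * k) S0 (KT (e + 1) A (w / 2)) := by
    rcases ((gc c (NQ * k) S0).filter P).eq_empty_or_nonempty with h0 | h0
    · left
      refine ⟨EuclideanSpace.single 0 1, 0, by simp, by rw [abs_zero]; linarith, ?_⟩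
      rw [h0]; simp
    · rcases alt _ h0 (fun q => ctr c q) hA (show 0 < w / 2 by positivity) hw1 (fun q hq => hctr q (Finset.mem_filter.1 hq).1) with h1 | h1
      · left; exact h1
      · right
        obtain ⟨τ, h2, L, h3⟩ := h1
        exact ⟨τ, h2, Finset.mem_filter.2 ⟨Fintype.mem_piFinset.2 fun i => (Finset.mem_filter.1 (h2 i)).1, L, h3⟩⟩
  set ρ2 := (∑ q ∈ gc c (NQ * k) S0, f q ^ p) ^ (2 / p) with hρ2
  rcases halt with ⟨h, b, hh, hb, hq⟩ | ⟨τ, hτ, hτT⟩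
  · refine le_trans ?_ le_self_add
    have hnar := narrow e hp hA hNQ hk hs hsN hr hw hw2 hD hF P h b hh hb (fun q hq1 hq2 => hq q (Finset.mem_filter.2 ⟨hq1, hq2⟩)) x
    have hsmall : (∑ q ∈ (gc c (NQ * k) S0).filter (fun q => ¬ P q), f q) ^ 2 ≤ ρ2 :=
      small_sum _ f hcard hNN hp _ (Finset.filter_subset _ _) fun q hq => (not_le.1 (Finset.mem_filter.1 hq).2).le
    have hsplit : ∀ S', FS F S' = ∑ q ∈ (gc c (NQ * k) S').filter P, FS F q + ∑ q ∈ (gc c (NQ * k) S').filter (fun q => ¬ P q), FS F q := by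
      intro S'
      rw [Finset.sum_filter_add_sum_filter_not, gc_FS]
    have h1 : AA p M2 (NQ ^ 2) (FS F S0) x ≤ 4 * (AA p M2 (NQ ^ 2) (∑ q ∈ (gc c (NQ * k) S0).filter P, FS F q) x + C * ρ2) := by
      conv_lhs => rw [hsplit S0]
      refine (AA_add hp _ _ (hES _) (hES _) x).trans ?_
      refine mul_le_mul_right (add_le_add_right ((hCA _ (Finset.filter_subset _ _)).trans (mul_le_mul_right hsmall _)) _) _
    have h2 : ∀ Q ∈ gc c NQ S0, AA p M2 (NQ ^ 2) (∑ q ∈ (gc c (NQ * k) Q).filter P, FS F q) x ≤ 4 * (AA p M2 (NQ ^ 2) (FS F Q) x +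
        C * (∑ q ∈ (gc c (NQ * k) Q).filter (fun q => ¬ P q), f q) ^ 2) := by
      intro Q hQ
      have e1 : ∑ q ∈ (gc c (NQ * k) Q).filter P, FS F q = FS F Q + -∑ q ∈ (gc c (NQ * k) Q).filter (fun q => ¬ P q), FS F q := by
        rw [hsplit Q]; abel
      rw [e1]
      refine (AA_add hp _ _ (FS_mem0 hF Q) (Submodule.neg_mem _ (hES _)) x).trans ?_
      refine mul_le_mul_right (add_le_add_right ?_ _) _
      have e2 : ∀ G : X (e + 1) → ℂ, AA p M2 (NQ ^ 2) (-G) x = AA p M2 (NQ ^ 2) G x := by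
        intro G; simp [AA]
      rw [e2]
      exact hCA _ ((Finset.filter_subset _ _).trans (hsub Q hQ))
    have h3 : ∑ Q ∈ gc c NQ S0, (∑ q ∈ (gc c (NQ * k) Q).filter (fun q => ¬ P q), f q) ^ 2 ≤ ρ2 := by
      refine (sum_sq_le _ _).trans (le_trans (le_of_eq ?_) hsmall)
      congr 1
      simp_rw [Finset.sum_filter]
      exact gc_refine c NQ hk0 S0 _
    have h4 : ∑ Q ∈ gc c NQ S0, AA p M2 (NQ ^ 2) (∑ q ∈ (gc c (NQ * k) Q).filter P, FS F q) x ≤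
        4 * (∑ Q ∈ gc c NQ S0, AA p M2 (NQ ^ 2) (FS F Q) x + C * ρ2) := by
      refine (Finset.sum_le_sum h2).trans ?_
      rw [← Finset.mul_sum, Finset.sum_add_distrib, ← Finset.mul_sum]
      exact mul_le_mul_right (add_le_add_right (mul_le_mul_right h3 _) _) _
    set Y := ∑ Q ∈ gc c NQ S0, AA p M2 (NQ ^ 2) (FS F Q) x
    calc AA p M2 (NQ ^ 2) (FS F S0) x ≤ 4 * (X' * (4 * (Y + C * ρ2)) + C * ρ2) :=
          h1.trans (mul_le_mul_right (add_le_add_left (hnar.trans (mul_le_mul_right h4 _)) _) _)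
      _ ≤ 4 * (X' * (4 * (Y + C * ρ2)) + X' * (C * ρ2)) := mul_le_mul_right (add_le_add_right (le_mul_of_one_le_left zero_le hX) _) _
      _ = 16 * X' * Y + 20 * C * X' * ρ2 := by ring
      _ ≤ (16 + 20 * C) * X' * Y + (16 + 20 * C) * X' * ρ2 := by gcongr; exact le_self_add; exact le_add_self
      _ = _ := by push_cast; ring
  · refine le_trans ?_ le_add_self
    have h1 : AA p M2 (NQ ^ 2) (FS F S0) x ≤ C * σ ^ 2 := by
      rw [← gc_FS c (NQ * k) S0 F]; exact hCA _ subset_rfl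
    have hn : (0 : ℝ) < (e + 1 + 1 : ℕ) := by positivity
    have hb : 0 ≤ p / (2 * (e + 1 + 1 : ℕ)) := by positivity
    have h2 : σ ^ p ≤ (NN ^ 4 : ℝ≥0∞) ^ (p / 2) * ∏ i, (f (τ i) ^ (2 : ℝ)) ^ (p / (2 * (e + 1 + 1 : ℕ))) := by
      have e1 : ∀ a : ℝ≥0∞, a ^ (p / 2) = ∏ i : Fin (e + 1 + 1), a ^ (p / (2 * (e + 1 + 1 : ℕ))) := by
        intro a
        rw [Finset.prod_const, Finset.card_univ, Fintype.card_fin, ← ENNReal.rpow_natCast, ← ENNReal.rpow_mul]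
        congr 1; field_simp
      have e2 : σ ^ p = (σ ^ (2 : ℝ)) ^ (p / 2) := by rw [← ENNReal.rpow_mul]; congr 1; ring
      rw [e2, e1, e1, ← Finset.prod_mul_distrib]
      refine Finset.prod_le_prod' fun i _ => ?_
      rw [← ENNReal.mul_rpow_of_nonneg _ _ hb]
      refine ENNReal.rpow_le_rpow ?_ hb
      have h3 : σ ≤ NN ^ 2 * f (τ i) := (Finset.mem_filter.1 (hτ i)).2
      rw [ENNReal.rpow_two, ENNReal.rpow_two]
      calc σ ^ 2 ≤ (NN ^ 2 * f (τ i)) ^ 2 := pow_le_pow_left' h3 2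
        _ = _ := by ring
    have h3 := ENNReal.rpow_le_rpow (h2.trans (mul_le_mul_right (Finset.single_le_sum (f := fun τ : Fin (e + 1 + 1) → Finset ι =>
      ∏ i, (f (τ i) ^ (2 : ℝ)) ^ (p / (2 * (e + 1 + 1 : ℕ)))) (fun _ _ => zero_le) hτT) _)) (show 0 ≤ 2 / p by positivity)
    rw [ENNReal.mul_rpow_of_nonneg _ _ (by positivity), ← ENNReal.rpow_mul, ← ENNReal.rpow_mul, mul_div_cancel₀ _ hp0.ne',
      div_mul_div_cancel₀ two_ne_zero, div_self hp0.ne', ENNReal.rpow_one, ENNReal.rpow_two] at h3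
    refine h1.trans ((mul_le_mul_right h3 _).trans ?_)
    rw [← mul_assoc]
    refine mul_le_mul_left (mul_le_mul_left ?_ _) _
    push_cast
    calc (C : ℝ≥0∞) ≤ 20 * C := le_mul_of_one_le_left zero_le (by norm_num)
      _ ≤ _ := le_add_self

end

end Dcp

end


section
open MeasureTheory Real
open scoped RealInnerProductSpace ENNReal NNReal

set_option linter.all false
namespace Dcp

section
variable {d : ℕ}
open Classical

lemma gc_sum {ι : Type} {β : Type*} [AddCommMonoid β] (c : ι → V d) (N : ℕ) (S : Finset ι) (g : ι → β) :
    ∑ J ∈ gc c N S, ∑ θ ∈ J, g θ = ∑ θ ∈ S, g θ := cells_sum _ _ _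

lemma sum_rescale {p : ℝ} (hp : 2 ≤ p) {E B : ℕ} {A s : ℝ} (hA : (d : ℝ) ≤ A) {N : ℕ} (hN : 0 < N) {Xc : ℝ≥0∞}
    (hD : Dec d p E B A (s * N) Xc) {Ω : X d → ℝ≥0∞} (hΩ : Wt E (s ^ 2) Ω) {ι : Type} {S : Finset ι} {c : ι → V d}
    {F : ι → X d → ℂ} (hF : Fam A s B S c F) :
    ∑ Q ∈ gc c N S, nq p Ω (FS F Q) ≤ ENNReal.ofReal (1 + 2 * A) ^ E * Xc * ∑ θ ∈ S, nq p Ω (F θ) := by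
  rw [← gc_sum c N S, Finset.mul_sum]
  refine Finset.sum_le_sum fun Q hQ => ?_
  obtain ⟨θ, hθ, e1⟩ := ctr_spec c (cells_nonempty hQ)
  refine rescale hp (by exact_mod_cast hN) (c0 := ctr c Q) ?_ hD hΩ (hF.subset (cells_sub hQ)) ?_
  · rw [e1]; exact hF.1 θ (cells_sub hQ hθ)
  · intro θ' hθ'
    rw [e1]
    exact (gc_close hN hQ hθ' hθ).trans hA

lemma norm_iso_le {ρ : ℝ} (h : 0 ≤ ρ) : ‖iso d ρ‖ ≤ ρ := by
  refine ContinuousLinearMap.opNorm_le_bound _ h fun y => ?_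
  rw [iso_apply, norm_smul, Real.norm_eq_abs, abs_of_nonneg h]

lemma AA_rpow {p : ℝ} (hp : 2 ≤ p) (M K : ℕ) (G : X d → ℂ) (x : X d) : AA p M K G x ^ (p / 2) = avg M (iso d K) (fun y => ‖G y‖ₑ ^ p) x := by
  unfold AA
  rw [← ENNReal.rpow_mul, div_mul_div_cancel₀ (by linarith : p ≠ 0), div_self two_ne_zero, ENNReal.rpow_one]

lemma avg_Wt_le {E : ℕ} {s : ℝ} {Ω : X d → ℝ≥0∞} (hΩ : Wt E (s ^ 2) Ω) (N : ℕ) {K : ℕ} (hK : s ^ 2 * K ≤ 1) {u : X d → ℝ≥0∞} (hu : Measurable u) :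
    ∫⁻ x, avg (E + N) (iso d K) u x * Ω x ≤ (∫⁻ y : X d, Phi N y) * ∫⁻ x, u x * Ω x := by
  have := hΩ.avg_le (sq_nonneg s) N (iso d K) (A := 1) ((mul_le_mul_of_nonneg_left (norm_iso_le (Nat.cast_nonneg K)) (sq_nonneg s)).trans hK) hu
  simpa using this

lemma le_avg_Wt {E : ℕ} {s : ℝ} {Ω : X d → ℝ≥0∞} (hΩ : Wt E (s ^ 2) Ω) (N : ℕ) {K : ℕ} (hK : s ^ 2 * K ≤ 1) {u : X d → ℝ≥0∞} (hu : Measurable u) :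
    (∫⁻ y : X d, Phi (E + N) y) * ∫⁻ x, u x * Ω x ≤ ∫⁻ x, avg N (iso d K) u x * Ω x := by
  have := hΩ.le_avg (sq_nonneg s) N (iso d K) (A := 1) ((mul_le_mul_of_nonneg_left (norm_iso_le (Nat.cast_nonneg K)) (sq_nonneg s)).trans hK) hu
  simpa using this

lemma cq_pow_int {p : ℝ} (hp : 2 ≤ p) {E N : ℕ} (hN : d + 2 ≤ N) {s : ℝ} {Ω : X d → ℝ≥0∞} (hΩ : Wt E (s ^ 2) Ω) {N1 : ℕ} (hK : s ^ 2 * N1 ≤ 1)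
    {ι : Type} {F : ι → X d → ℂ} {q : Finset ι} (hF : FS F q ∈ ES (Set.univ : Set (X d))) :
    ∫⁻ x, cq (E + N) N1 F q x ^ p * Ω x ≤ (∫⁻ y : X d, Phi (E + N) y) ^ (p - 1) * ((∫⁻ y : X d, Phi N y) * ∫⁻ x, ‖FS F q x‖ₑ ^ p * Ω x) := by
  have hp0 : 0 < p := by linarith
  have hm := ES_meas hF p
  have h1 : ∀ x, cq (E + N) N1 F q x ^ p ≤ (∫⁻ y : X d, Phi (E + N) y) ^ (p - 1) * avg (E + N) (iso d N1) (fun y => ‖FS F q y‖ₑ ^ p) x := by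
    intro x
    have h2 := avg_jensen (E + N) (iso d N1) hm (a := 1 / p) (by positivity) (by rw [div_le_one hp0]; linarith) x
    have e1 : (fun x => (‖FS F q x‖ₑ ^ p) ^ (1 / p)) = fun x => ‖FS F q x‖ₑ ^ (1 : ℝ) := by
      ext x; rw [← ENNReal.rpow_mul, mul_one_div_cancel hp0.ne']
    rw [e1] at h2
    refine (ENNReal.rpow_le_rpow h2 hp0.le).trans (le_of_eq ?_)
    rw [ENNReal.mul_rpow_of_nonneg _ _ hp0.le, ← ENNReal.rpow_mul, ← ENNReal.rpow_mul, one_div_mul_cancel hp0.ne', ENNReal.rpow_one]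
    congr 2; field_simp
  calc ∫⁻ x, cq (E + N) N1 F q x ^ p * Ω x ≤ ∫⁻ x, (∫⁻ y : X d, Phi (E + N) y) ^ (p - 1) * (avg (E + N) (iso d N1) (fun y => ‖FS F q y‖ₑ ^ p) x * Ω x) :=
        lintegral_mono fun x => by rw [← mul_assoc]; exact mul_le_mul_left (h1 x) _
    _ = (∫⁻ y : X d, Phi (E + N) y) ^ (p - 1) * ∫⁻ x, avg (E + N) (iso d N1) (fun y => ‖FS F q y‖ₑ ^ p) x * Ω x :=
        lintegral_const_mul _ ((measurable_avg _ _ hm).mul hΩ.1)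
    _ ≤ _ := mul_le_mul_right (avg_Wt_le hΩ N hK hm) _

lemma cq_sq (d : ℕ) (A : ℝ) (M : ℕ) (hM : d + 2 ≤ M) (N1 : ℕ) (hN1 : 1 ≤ N1) : ∃ C : ℝ≥0, ∀ (N B : ℕ) (s : ℝ), 0 < N → 0 ≤ s → s * N ≤ 1 → ∀ (ι : Type) (S0 : Finset ι)
    (c : ι → V d) (F : ι → X d → ℂ), Fam A s B S0 c F → ∀ q ⊆ S0, ∀ x, cq (M + (d + 2)) N1 F q x ^ (2 : ℝ) ≤
    C * N ^ d * ∑ J ∈ gc c N q, avg M (iso d N) (fun x => ‖FS F J x‖ₑ ^ (2 : ℝ)) x := by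
  obtain ⟨C, hC⟩ := loc_const d (2 * (d + 1) ^ 2 + 2 * A * (d + 1)) M hM (q := 2) one_le_two
  set M1 := M + (d + 2) with hM1
  set I1 := ∫⁻ y : X d, Phi M1 y with hI1
  set I2 := ∫⁻ y : X d, Phi (d + 2) y with hI2
  have hI1t : I1 ≠ ∞ := I_ne_top d (by omega)
  have hI2t : I2 ≠ ∞ := I_ne_top d le_rfl
  refine ⟨(2 * ⌈A⌉₊ + 1) ^ d * (I1.toNNReal * (C * (N1 ^ M * I2.toNNReal))), ?_⟩
  intro N B s hN hs hsN ι S0 c F hF q hq x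
  have hN0 : (0 : ℝ) < N := by exact_mod_cast hN
  have hNN1 : (1 : ℝ) ≤ N := by exact_mod_cast hN
  have hFq := hF.subset hq
  have hm : ∀ J r, Measurable fun y => ‖FS F J y‖ₑ ^ (r : ℝ) := fun J r => ES_meas (FS_mem0 hF J) r
  have h1 : cq M1 N1 F q x ≤ ∑ J ∈ gc c N q, cq M1 N1 F J x := by
    unfold cq
    rw [← avg_sum _ _ _ (fun J => hm J 1)]
    refine avg_mono _ _ (fun y => ?_) x
    rw [← gc_FS c N q F, Finset.sum_apply]
    simp only [ENNReal.rpow_one]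
    exact enorm_sum_le _ _
  have h2 : ∀ J ∈ gc c N q, cq M1 N1 F J x ^ 2 ≤ I1 * (C * (N1 ^ M * I2)) * avg M (iso d N) (fun x => ‖FS F J x‖ₑ ^ (2 : ℝ)) x := by
    intro J hJ
    have h3 := avg_jensen M1 (iso d N1) (hm J 2) (a := 1 / 2) (by norm_num) (by norm_num) x
    have e1 : (fun x => (‖FS F J x‖ₑ ^ (2 : ℝ)) ^ ((1 : ℝ) / 2)) = fun x => ‖FS F J x‖ₑ ^ (1 : ℝ) := by
      ext x; rw [← ENNReal.rpow_mul]; norm_num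
    rw [e1] at h3
    have h4 : cq M1 N1 F J x ^ 2 ≤ I1 * avg M1 (iso d N1) (fun x => ‖FS F J x‖ₑ ^ (2 : ℝ)) x := by
      refine (pow_le_pow_left' h3 2).trans (le_of_eq ?_)
      rw [mul_pow, ← ENNReal.rpow_natCast, ← ENNReal.rpow_natCast, ← ENNReal.rpow_mul, ← ENNReal.rpow_mul]
      norm_num [hI1]
    have hb : ‖ctr c J‖ ≤ A := by
      obtain ⟨θ, hθ, e⟩ := ctr_spec c (cells_nonempty hJ)
      rw [e]; exact hFq.1 θ (cells_sub hJ hθ)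
    have h5 := hC _ _ (lcond_iso hN hb) _ (gc_mem hFq hs hN hsN hJ)
    have h6 := avg_mono M1 (iso d N1) h5 x
    rw [avg_const_mul _ _ (measurable_avg _ _ (hm J 2))] at h6
    have e2 : iso d N1 = (iso d N).comp (iso d ((N1 : ℝ) / N)) := by
      apply ContinuousLinearMap.ext; intro y
      rw [ContinuousLinearMap.comp_apply, iso_apply, iso_apply, iso_apply, smul_smul, mul_div_cancel₀ _ hN0.ne']
    have hR : ‖iso d ((N1 : ℝ) / N)‖ ≤ N1 :=
      (norm_iso_le (by positivity)).trans (div_le_self (Nat.cast_nonneg _) hNN1)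
    have h7 := absorb (M := M) (N := d + 2) (iso d N) (iso d ((N1 : ℝ) / N)) hR (hm J 2) x
    rw [← e2, max_eq_right (by exact_mod_cast hN1), ENNReal.ofReal_natCast] at h7
    calc _ ≤ _ := h4
      _ ≤ I1 * (C * (N1 ^ M * I2 * avg M (iso d N) (fun x => ‖FS F J x‖ₑ ^ (2 : ℝ)) x)) :=
          mul_le_mul_right (h6.trans (mul_le_mul_right h7 _)) _
      _ = _ := by ring
  have hcard : (gc c N q).card ≤ (2 * N * ⌈A⌉₊ + 1) ^ d := by
    rw [← labBox_card]
    exact cells_card_le _ _ _ fun θ hθ => lab_mem ((hFq.1 θ hθ).trans (Nat.le_ceil A))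
  have hcard2 : (gc c N q).card ≤ (2 * ⌈A⌉₊ + 1) ^ d * N ^ d := by
    refine hcard.trans ?_
    rw [← mul_pow]
    exact Nat.pow_le_pow_left (by nlinarith) d
  have h8 : (∑ J ∈ gc c N q, cq M1 N1 F J x) ^ 2 ≤ (gc c N q).card * ∑ J ∈ gc c N q, cq M1 N1 F J x ^ 2 := by
    have := ENNReal.rpow_sum_le_const_mul_sum_rpow (gc c N q) (fun J => cq M1 N1 F J x) (p := 2) one_le_two
    norm_num at this
    exact this
  rw [ENNReal.rpow_two]
  calc cq M1 N1 F q x ^ 2 ≤ (∑ J ∈ gc c N q, cq M1 N1 F J x) ^ 2 := pow_le_pow_left' h1 2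
    _ ≤ _ := h8
    _ ≤ (((2 * ⌈A⌉₊ + 1) ^ d * N ^ d : ℕ) : ℝ≥0∞) * ∑ J ∈ gc c N q, I1 * (C * (N1 ^ M * I2)) * avg M (iso d N) (fun x => ‖FS F J x‖ₑ ^ (2 : ℝ)) x :=
        mul_le_mul' (by exact_mod_cast hcard2) (Finset.sum_le_sum h2)
    _ = _ := by
      rw [← Finset.mul_sum]
      push_cast
      rw [ENNReal.coe_toNNReal hI1t, ENNReal.coe_toNNReal hI2t]; ring

end

end Dcp

end


section
open MeasureTheory Real
open scoped RealInnerProductSpace ENNReal NNReal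

set_option linter.all false
namespace Dcp

section
variable {d : ℕ}
open Classical

lemma rsum_le {ι : Type} {q : ℝ} (hq : 0 < q) (hq1 : q ≤ 1) (S : Finset ι) (f : ι → ℝ≥0∞) : (∑ i ∈ S, f i) ^ q ≤ ∑ i ∈ S, f i ^ q := by
  induction S using Finset.induction_on with
  | empty => simp [ENNReal.zero_rpow_of_pos hq]
  | insert a S ha ih =>
    rw [Finset.sum_insert ha, Finset.sum_insert ha]
    exact (ENNReal.rpow_add_le_add_rpow _ _ hq.le hq1).trans (add_le_add_right ih _)

lemma gc_card {ι : Type} {A s : ℝ} {B : ℕ} {S : Finset ι} {c : ι → V d} {F : ι → X d → ℂ} (h : Fam A s B S c F) (N : ℕ) :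
    (gc c N S).card ≤ (2 * N * ⌈A⌉₊ + 1) ^ d := by
  rw [← labBox_card]
  exact cells_card_le _ _ _ fun θ hθ => lab_mem ((h.1 θ hθ).trans (Nat.le_ceil A))

lemma TT_card {ι : Type} {A s : ℝ} {B : ℕ} {S : Finset ι} {c : ι → V d} {F : ι → X d → ℂ} (h : Fam A s B S c F) (N : ℕ) (Kt : ℝ) :
    (TT c N S Kt).card ≤ ((2 * N * ⌈A⌉₊ + 1) ^ d) ^ (d + 1) := by
  refine (Finset.card_filter_le _ _).trans ?_
  rw [Fintype.card_piFinset, Finset.prod_const, Finset.card_univ, Fintype.card_fin]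
  exact Nat.pow_le_pow_left (gc_card h N) _

lemma TT_trans {ι : Type} {S : Finset ι} {c : ι → V d} {N N0 : ℕ} (hN : 0 < N) (hN0 : N0 * d ≤ N) {Kt : ℝ} {τ : Fin (d + 1) → Finset ι} (hτ : τ ∈ TT c N S Kt) :
    Trans Kt N0 c τ ∧ ∀ i, τ i ⊆ S := by
  obtain ⟨h1, L, h2, h3, h4⟩ := Finset.mem_filter.1 hτ
  have h1' := Fintype.mem_piFinset.1 h1
  refine ⟨⟨fun i => ctr c (τ i), L, h2, h3, h4, fun i θ hθ => ?_⟩, fun i => cells_sub (h1' i)⟩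
  obtain ⟨θ', hθ', e1⟩ := ctr_spec c (cells_nonempty (h1' i))
  have h5 := gc_close hN (h1' i) hθ hθ'
  show (N0 : ℝ) * ‖c θ - ctr c (τ i)‖ ≤ 1
  rw [e1]
  have hNr : (0 : ℝ) < N := by exact_mod_cast hN
  have h6 : (N0 : ℝ) * d ≤ N := by exact_mod_cast hN0
  by_contra hcon
  push Not at hcon
  have h7 := norm_nonneg (c θ - c θ')
  have h8 : (N0 : ℝ) * (d : ℝ) < (N0 : ℝ) * ((N : ℝ) * ‖c θ - c θ'‖) := by
    nlinarith
  have h9 : (0 : ℝ) ≤ N0 := Nat.cast_nonneg N0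
  nlinarith

lemma int_AA_le {p : ℝ} (hp : 2 ≤ p) {E : ℕ} {s : ℝ} {Ω : X d → ℝ≥0∞} (hΩ : Wt E (s ^ 2) Ω) (N : ℕ) {K : ℕ} (hK : s ^ 2 * K ≤ 1) {G : X d → ℂ}
    (hG : G ∈ ES (Set.univ : Set (X d))) :
    (∫⁻ x, AA p (E + N) K G x ^ (p / 2) * Ω x) ^ (2 / p) ≤ (∫⁻ y : X d, Phi N y) ^ (2 / p) * nq p Ω G := by
  simp_rw [AA_rpow hp]
  unfold nq
  rw [← ENNReal.mul_rpow_of_nonneg _ _ (by positivity)]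
  exact ENNReal.rpow_le_rpow (avg_Wt_le hΩ N hK (ES_meas hG p)) (by positivity)

lemma le_int_AA {p : ℝ} (hp : 2 ≤ p) {E : ℕ} {s : ℝ} {Ω : X d → ℝ≥0∞} (hΩ : Wt E (s ^ 2) Ω) (N : ℕ) {K : ℕ} (hK : s ^ 2 * K ≤ 1) {G : X d → ℂ}
    (hG : G ∈ ES (Set.univ : Set (X d))) :
    (∫⁻ y : X d, Phi (E + N) y) ^ (2 / p) * nq p Ω G ≤ (∫⁻ x, AA p N K G x ^ (p / 2) * Ω x) ^ (2 / p) := by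
  simp_rw [AA_rpow hp]
  unfold nq
  rw [← ENNReal.mul_rpow_of_nonneg _ _ (by positivity)]
  exact ENNReal.rpow_le_rpow (le_avg_Wt hΩ N hK (ES_meas hG p)) (by positivity)

lemma tri3 {p : ℝ} (hp : 2 ≤ p) {Ω : X d → ℝ≥0∞} (hΩ : Measurable Ω) {f g h : X d → ℝ≥0∞} (hf : Measurable f) (hg : Measurable g) (hh : Measurable h) (a b : ℝ≥0∞) {u : X d → ℝ≥0∞}
    (H : ∀ x, u x ≤ a * (f x + g x) + b * h x) :
    (∫⁻ x, u x ^ (p / 2) * Ω x) ^ (2 / p) ≤ a * ((∫⁻ x, f x ^ (p / 2) * Ω x) ^ (2 / p) + (∫⁻ x, g x ^ (p / 2) * Ω x) ^ (2 / p)) +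
      b * (∫⁻ x, h x ^ (p / 2) * Ω x) ^ (2 / p) := by
  have hp0 : 0 < p := by linarith
  set v : Fin 3 → X d → ℝ≥0∞ := fun i x => ![(a * f x) ^ (p / 2), (a * g x) ^ (p / 2), (b * h x) ^ (p / 2)] i with hv
  have hvm : ∀ i, Measurable (v i) := by
    intro i
    fin_cases i
    · exact (hf.const_mul a).pow_const _
    · exact (hg.const_mul a).pow_const _
    · exact (hh.const_mul b).pow_const _
  have e0 : ∀ z : ℝ≥0∞, (z ^ (p / 2)) ^ (1 / (p / 2)) = z := by
    intro z; rw [← ENNReal.rpow_mul, mul_one_div_cancel (by positivity), ENNReal.rpow_one]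
  have hmk := minkowski' (volume : Measure (X d)) Finset.univ hvm hΩ (r := p / 2) (by linarith)
  simp only [Fin.sum_univ_three] at hmk
  change (∫⁻ x, (((a * f x) ^ (p / 2)) ^ (1 / (p / 2)) + ((a * g x) ^ (p / 2)) ^ (1 / (p / 2)) + ((b * h x) ^ (p / 2)) ^ (1 / (p / 2))) ^ (p / 2) * Ω x) ≤
    ((∫⁻ x, (a * f x) ^ (p / 2) * Ω x) ^ (1 / (p / 2)) + (∫⁻ x, (a * g x) ^ (p / 2) * Ω x) ^ (1 / (p / 2)) + (∫⁻ x, (b * h x) ^ (p / 2) * Ω x) ^ (1 / (p / 2))) ^ (p / 2) at hmk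
  simp only [e0] at hmk
  have e1 : 1 / (p / 2) = 2 / p := by field_simp
  have e2 : ∀ (z : ℝ≥0∞), (z ^ (p / 2)) ^ (2 / p) = z := by rw [← e1]; exact e0
  have e3 : ∀ (z : ℝ≥0∞) (w : X d → ℝ≥0∞), Measurable w → (∫⁻ x, (z * w x) ^ (p / 2) * Ω x) ^ (2 / p) = z * (∫⁻ x, w x ^ (p / 2) * Ω x) ^ (2 / p) := by
    intro z w hw
    have : ∀ x, (z * w x) ^ (p / 2) * Ω x = z ^ (p / 2) * (w x ^ (p / 2) * Ω x) := by
      intro x; rw [ENNReal.mul_rpow_of_nonneg _ _ (by positivity), mul_assoc]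
    simp_rw [this]
    have hm : Measurable fun x => w x ^ (p / 2) * Ω x := (hw.pow_const _).mul hΩ
    rw [lintegral_const_mul _ hm, ENNReal.mul_rpow_of_nonneg _ _ (by positivity), e2]
  have h1 := ENNReal.rpow_le_rpow ((lintegral_mono fun x => mul_le_mul_left (ENNReal.rpow_le_rpow (H x) (show 0 ≤ p / 2 by positivity)) (Ω x)).trans
    (le_trans (le_of_eq (by congr 1; ext x; rw [mul_add])) hmk)) (show 0 ≤ 2 / p by positivity)
  rw [e1, e2, e3 _ _ hf, e3 _ _ hg, e3 _ _ hh, ← mul_add] at h1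
  exact h1

lemma bn (e : ℕ) {p : ℝ} (hp : 2 ≤ p) (E : ℕ) {A : ℝ} (hA : (e : ℝ) + 1 ≤ A) (j : ℕ) : ∃ (M2 : ℕ) (C : ℝ≥0), ∀ (NQ k : ℕ) (r w : ℝ), e + 2 ≤ NQ → e + 2 ≤ k → NQ ≤ k →
    r = (e + 2) / NQ → w = r ^ 2 / (2 * A + 4) → ((e + 2) : ℝ) / (NQ * k : ℕ) ≤ w / 2 → ∀ X' : ℝ≥0∞, 1 ≤ X' →
    Dec e p M2 ((2 * (12 * (e + 2) + 1) + 1) ^ (e + 1)) A (2 * r) X' → ∃ Cσ : ℝ≥0, ∀ (B : ℕ) (s : ℝ) (D1 D2 : ℝ≥0∞), 0 < s → s * (NQ * k : ℕ) ≤ 1 →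
    Dec (e + 1) p E B A (s * NQ) D1 → Dec (e + 1) p E B A (s * (NQ * k : ℕ)) D2 → ∀ Ω : X (e + 1) → ℝ≥0∞, Wt E (s ^ 2) Ω →
    ∀ (ι : Type) (S0 : Finset ι) (c : ι → V (e + 1)) (F : ι → X (e + 1) → ℂ), Fam A s B S0 c F → ∀ N : ℕ, 0 < N → s * N ≤ 1 →
    nq p Ω (FS F S0) ≤ C * X' * (D1 + D2) * ∑ θ ∈ S0, nq p Ω (F θ) + Cσ * N ^ (e + 1) *
      ∑ τ ∈ TT c (NQ * k) S0 (KT (e + 1) A (w / 2)), Bq p Ω c F τ N (E + (e + 3) + 2 * (e + 3) * j) := by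
  have hp0 : 0 < p := by linarith
  have h2p : 0 ≤ 2 / p := by positivity
  have h2p1 : 2 / p ≤ 1 := (div_le_one hp0).2 hp
  have hA0 : 0 ≤ A := by have : (0 : ℝ) ≤ e := Nat.cast_nonneg e; linarith
  set M := E + (e + 3) + 2 * (e + 3) * j with hM
  set M1 := M + (e + 1 + 2) with hM1
  set Nc := (e + 3) + 2 * (e + 3) * j + (e + 3) with hNc
  have hM1E : M1 = E + Nc := by omega
  set N2 := ⌈p⌉₊ * M1 + (e + 3) with hN2
  set M2 := E + N2 with hM2
  obtain ⟨C, hC⟩ := pw e hp hA0 M1 (by omega)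
  set I0 := ∫⁻ y : X (e + 1), Phi (E + M2) y with hI0
  have hI0t : I0 ≠ ∞ := I_ne_top _ (by omega)
  have hI00 : I0 ≠ 0 := lintegral_Phi_ne_zero _
  set I2 := ∫⁻ y : X (e + 1), Phi N2 y with hI2
  have hI2t : I2 ≠ ∞ := I_ne_top _ (by omega)
  set I3 := (∫⁻ y : X (e + 1), Phi M1 y) ^ (p - 1) * ∫⁻ y : X (e + 1), Phi Nc y with hI3
  have hI3t : I3 ≠ ∞ := ENNReal.mul_ne_top (ENNReal.rpow_ne_top_of_nonneg (by linarith) (I_ne_top _ (by omega))) (I_ne_top _ (by omega))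
  set a := ENNReal.ofReal (1 + 2 * A) ^ E with ha
  have hat : a ≠ ∞ := ENNReal.pow_ne_top ENNReal.ofReal_ne_top
  set Cc : ℝ≥0∞ := (I0 ^ (2 / p))⁻¹ * C * (I2 ^ (2 / p) + I3 ^ (2 / p)) * a with hCc
  have hI0p : I0 ^ (2 / p) ≠ 0 := by simp [ENNReal.rpow_eq_zero_iff, hI00, hI0t]
  have hI0pt : I0 ^ (2 / p) ≠ ∞ := ENNReal.rpow_ne_top_of_nonneg h2p hI0t
  have hCct : Cc ≠ ∞ := by
    refine ENNReal.mul_ne_top (ENNReal.mul_ne_top (ENNReal.mul_ne_top (ENNReal.inv_ne_top.2 hI0p) ENNReal.coe_ne_top) ?_) hat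
    exact ENNReal.add_ne_top.2 ⟨ENNReal.rpow_ne_top_of_nonneg h2p hI2t, ENNReal.rpow_ne_top_of_nonneg h2p hI3t⟩
  refine ⟨M2, Cc.toNNReal, ?_⟩
  rw [ENNReal.coe_toNNReal hCct]
  intro NQ k r w hNQ hk hNQk hr hw hw2 X' hX' hD0
  have hNQ0 : 0 < NQ := by omega
  have hk0 : 0 < k := by omega
  have hN1 : 0 < NQ * k := Nat.mul_pos hNQ0 hk0
  obtain ⟨C3, hC3⟩ := cq_sq (e + 1) A M (by omega) (NQ * k) hN1
  set NN := (2 * (NQ * k) * ⌈A⌉₊ + 1) ^ (e + 1) with hNN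
  have hcs : (I0 ^ (2 / p))⁻¹ * (C * NN ^ 4 * C3) ≠ ∞ := by
    refine ENNReal.mul_ne_top (ENNReal.inv_ne_top.2 hI0p) (ENNReal.mul_ne_top (ENNReal.mul_ne_top ENNReal.coe_ne_top ?_) ENNReal.coe_ne_top)
    exact ENNReal.pow_ne_top (ENNReal.natCast_ne_top _)
  refine ⟨((I0 ^ (2 / p))⁻¹ * (C * NN ^ 4 * C3)).toNNReal, ?_⟩
  rw [ENNReal.coe_toNNReal hcs]
  intro B s D1 D2 hs hsN hD1 hD2 Ω hΩ ι S0 c F hF N hN hsN'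
  have hpw := hC B M2 NQ k NN s r w X' (by omega) hNQ hk hNQk hs.le hsN hr hw hw2 (Nat.one_le_pow _ _ (by omega)) hX' hD0 ι S0 c F hF (gc_card hF _)
  have hmcq : ∀ q, Measurable (cq M1 (NQ * k) F q) := fun q => measurable_avg _ _ (ES_meas (FS_mem0 hF q) 1)
  have hmAA : ∀ Q, Measurable (AA p M2 (NQ ^ 2) (FS F Q)) := fun Q => (measurable_avg _ _ (ES_meas (FS_mem0 hF Q) p)).pow_const _
  have hmpi : ∀ τ : Fin (e + 1 + 1) → Finset ι, Measurable fun x => ∏ i, (cq M1 (NQ * k) F (τ i) x ^ (2 : ℝ)) ^ (p / (2 * (e + 1 + 1 : ℕ))) := fun τ =>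
    Finset.measurable_prod _ fun i _ => ((hmcq _).pow_const _).pow_const _
  have htri := tri3 hp hΩ.1 (Finset.measurable_sum _ fun Q _ => hmAA Q) ((Finset.measurable_sum _ fun q _ => (hmcq q).pow_const p).pow_const (2 / p))
    ((Finset.measurable_sum _ fun τ _ => hmpi τ).pow_const (2 / p)) _ _ hpw
  have hK1 : s * NQ ≤ 1 := by
    refine le_trans ?_ hsN
    push_cast
    have : (1 : ℝ) ≤ k := by exact_mod_cast hk0
    have h3 : 0 ≤ s * NQ := by positivity
    nlinarith
  have hs1 : s ≤ 1 := by
    refine le_trans ?_ hsN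
    have : (1 : ℝ) ≤ (NQ * k : ℕ) := by exact_mod_cast hN1
    nlinarith
  have hK : s ^ 2 * (NQ ^ 2 : ℕ) ≤ 1 := by
    push_cast; rw [← mul_pow]; exact pow_le_one₀ (by positivity) hK1
  have hK' : s ^ 2 * (NQ * k : ℕ) ≤ 1 := by
    rw [sq, mul_assoc]; exact mul_le_one₀ hs1 (by positivity) hsN
  have hdA : ((e + 1 : ℕ) : ℝ) ≤ A := by push_cast; exact hA
  have hinv : ∀ z : ℝ≥0∞, (z ^ (2 / p)) ^ (p / 2) = z := by
    intro z; rw [← ENNReal.rpow_mul, div_mul_div_cancel₀ hp0.ne', div_self two_ne_zero, ENNReal.rpow_one]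
  set R := ∑ θ ∈ S0, nq p Ω (F θ) with hR
  -- term 1
  have ht1 : (∫⁻ x, (∑ Q ∈ gc c NQ S0, AA p M2 (NQ ^ 2) (FS F Q) x) ^ (p / 2) * Ω x) ^ (2 / p) ≤ I2 ^ (2 / p) * (a * D1 * R) := by
    have hmk := minkowski' (volume : Measure (X (e + 1))) (gc c NQ S0) (u := fun Q x => AA p M2 (NQ ^ 2) (FS F Q) x ^ (p / 2))
      (fun Q => (hmAA Q).pow_const _) hΩ.1 (r := p / 2) (by linarith)
    have e0 : ∀ z : ℝ≥0∞, (z ^ (p / 2)) ^ (1 / (p / 2)) = z := by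
      intro z; rw [← ENNReal.rpow_mul, mul_one_div_cancel (by positivity), ENNReal.rpow_one]
    have e1 : 1 / (p / 2) = 2 / p := by field_simp
    simp_rw [e0] at hmk
    have hmk2 := ENNReal.rpow_le_rpow hmk h2p
    rw [e1] at hmk2
    rw [e1] at e0
    rw [e0] at hmk2
    refine hmk2.trans ((Finset.sum_le_sum fun Q hQ => int_AA_le hp hΩ N2 hK (FS_mem0 hF Q)).trans ?_)
    rw [← Finset.mul_sum]
    exact mul_le_mul_right (sum_rescale hp hdA hNQ0 hD1 hΩ hF) _
  -- term 2
  have ht2 : (∫⁻ x, ((∑ q ∈ gc c (NQ * k) S0, cq M1 (NQ * k) F q x ^ p) ^ (2 / p)) ^ (p / 2) * Ω x) ^ (2 / p) ≤ I3 ^ (2 / p) * (a * D2 * R) := by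
    simp_rw [hinv, Finset.sum_mul]
    have hm2 : ∀ q ∈ gc c (NQ * k) S0, Measurable fun x => cq M1 (NQ * k) F q x ^ p * Ω x := fun q _ => ((hmcq q).pow_const p).mul hΩ.1
    rw [lintegral_finsetSum _ hm2]
    refine (rsum_le (by positivity) h2p1 _ _).trans ?_
    refine le_trans ?_ (mul_le_mul_right (sum_rescale hp hdA hN1 hD2 hΩ hF) _)
    rw [Finset.mul_sum]
    refine Finset.sum_le_sum fun q hq => ?_
    unfold nq
    rw [← ENNReal.mul_rpow_of_nonneg _ _ h2p]
    refine ENNReal.rpow_le_rpow ?_ h2p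
    have := cq_pow_int hp (N := Nc) (by omega) hΩ hK' (FS_mem0 hF q)
    rw [← mul_assoc, ← hM1E] at this
    exact this
  -- term 3
  have ht3 : (∫⁻ x, ((∑ τ ∈ TT c (NQ * k) S0 (KT (e + 1) A (w / 2)), ∏ i, (cq M1 (NQ * k) F (τ i) x ^ (2 : ℝ)) ^ (p / (2 * (e + 1 + 1 : ℕ)))) ^ (2 / p)) ^ (p / 2) * Ω x) ^ (2 / p)
      ≤ C3 * N ^ (e + 1) * ∑ τ ∈ TT c (NQ * k) S0 (KT (e + 1) A (w / 2)), Bq p Ω c F τ N M := by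
    simp_rw [hinv, Finset.sum_mul]
    have hm3 : ∀ τ ∈ TT c (NQ * k) S0 (KT (e + 1) A (w / 2)), Measurable fun x => (∏ i, (cq M1 (NQ * k) F (τ i) x ^ (2 : ℝ)) ^ (p / (2 * (e + 1 + 1 : ℕ)))) * Ω x := fun τ _ => (hmpi τ).mul hΩ.1
    rw [lintegral_finsetSum _ hm3]
    refine (rsum_le (by positivity) h2p1 _ _).trans ?_
    rw [Finset.mul_sum]
    refine Finset.sum_le_sum fun τ hτ => ?_
    have hτS : ∀ i, τ i ⊆ S0 := fun i => cells_sub (Fintype.mem_piFinset.1 (Finset.mem_filter.1 hτ).1 i)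
    exact mi_le (Nat.succ_pos _) hp0 (ENNReal.mul_ne_top ENNReal.coe_ne_top (ENNReal.pow_ne_top (ENNReal.natCast_ne_top _)))
      (fun i x => hC3 N B s hN hs.le hsN' ι S0 c F hF (τ i) (hτS i) x)
  have hlow := le_int_AA hp hΩ M2 hK (FS_mem0 hF S0)
  have hall := hlow.trans (htri.trans (add_le_add (mul_le_mul_right (add_le_add ht1 ht2) _) (mul_le_mul_right ht3 _)))
  have h9 : nq p Ω (FS F S0) = (I0 ^ (2 / p))⁻¹ * (I0 ^ (2 / p) * nq p Ω (FS F S0)) := by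
    rw [← mul_assoc, ENNReal.inv_mul_cancel hI0p hI0pt, one_mul]
  rw [h9]
  refine (mul_le_mul_right hall _).trans ?_
  set Z := ∑ τ ∈ TT c (NQ * k) S0 (KT (e + 1) A (w / 2)), Bq p Ω c F τ N M
  set i0 := (I0 ^ (2 / p))⁻¹
  set i2 := I2 ^ (2 / p)
  set i3 := I3 ^ (2 / p)
  calc i0 * (C * X' * (i2 * (a * D1 * R) + i3 * (a * D2 * R)) + C * NN ^ 4 * (C3 * N ^ (e + 1) * Z))
      ≤ i0 * (C * X' * ((i2 + i3) * (a * D1 * R) + (i2 + i3) * (a * D2 * R)) + C * NN ^ 4 * (C3 * N ^ (e + 1) * Z)) := by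
        gcongr
        · exact le_self_add
        · exact le_add_self
    _ = _ := by rw [hCc]; ring

end

end Dcp

end


section
open MeasureTheory Real
open scoped RealInnerProductSpace ENNReal NNReal

set_option linter.all false
namespace Dcp

section
variable {d : ℕ}
open Classical

def Adm (d : ℕ) (p : ℝ) (E B : ℕ) (A η : ℝ) : Prop :=
  ∃ C : ℝ≥0, ∀ s : ℝ, 0 < s → s ≤ 1 → Dec d p E B A s (C * ENNReal.ofReal (s ^ (-η)))

lemma Adm.mono {p : ℝ} {E B : ℕ} {A A' η η' : ℝ} (h : Adm d p E B A' η) (hA : A ≤ A') (hη : η ≤ η') : Adm d p E B A η' := by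
  obtain ⟨C, hC⟩ := h
  refine ⟨C, fun s hs hs1 => (hC s hs hs1).mono hA le_rfl ?_⟩
  gcongr 1
  exact ENNReal.ofReal_le_ofReal (Real.rpow_le_rpow_of_exponent_ge hs hs1 (by linarith))

lemma nq_card {p : ℝ} (hp : 2 ≤ p) {Ω : X d → ℝ≥0∞} (hΩ : Measurable Ω) {ι : Type} (S : Finset ι) (F : ι → X d → ℂ)
    (hF : ∀ θ, F θ ∈ ES Set.univ) : nq p Ω (∑ θ ∈ S, F θ) ≤ S.card * ∑ θ ∈ S, nq p Ω (F θ) := by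
  have hp0 : 0 < p := by linarith
  have hmk := minkowski' (volume : Measure (X d)) S (u := fun θ x => ‖F θ x‖ₑ ^ p) (fun θ => ES_meas (hF θ) p) hΩ (r := p / 2) (by linarith)
  have e1 : 1 / (p / 2) = 2 / p := by field_simp
  have e0 : ∀ z : ℝ≥0∞, (z ^ (p / 2)) ^ (2 / p) = z := by
    intro z; rw [← ENNReal.rpow_mul, div_mul_div_cancel₀ two_ne_zero, div_self hp0.ne', ENNReal.rpow_one]
  have e2 : ∀ z : ℝ≥0∞, (z ^ p) ^ (2 / p) = z ^ (2 : ℝ) := by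
    intro z; rw [← ENNReal.rpow_mul, mul_div_cancel₀ _ hp0.ne']
  have e3 : ∀ z : ℝ≥0∞, z ^ p = (z ^ (2 : ℝ)) ^ (p / 2) := by
    intro z; rw [← ENNReal.rpow_mul]; congr 1; ring
  rw [e1] at hmk
  simp_rw [e2] at hmk
  have hpt : ∀ x, ‖(∑ θ ∈ S, F θ) x‖ₑ ^ p * Ω x ≤ (S.card : ℝ≥0∞) ^ (p / 2) * ((∑ θ ∈ S, ‖F θ x‖ₑ ^ (2 : ℝ)) ^ (p / 2) * Ω x) := by
    intro x
    rw [← mul_assoc, ← ENNReal.mul_rpow_of_nonneg _ _ (by positivity), e3]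
    refine mul_le_mul_left (ENNReal.rpow_le_rpow ?_ (by positivity)) _
    have h1 := ENNReal.rpow_sum_le_const_mul_sum_rpow S (fun θ => ‖F θ x‖ₑ) (p := 2) one_le_two
    rw [show (2 : ℝ) - 1 = 1 by norm_num, ENNReal.rpow_one] at h1
    refine le_trans (ENNReal.rpow_le_rpow ?_ (by norm_num)) h1
    rw [Finset.sum_apply]
    exact enorm_sum_le _ _
  have h1 := lintegral_mono (μ := (volume : Measure (X d))) hpt
  rw [lintegral_const_mul' _ _ (ENNReal.rpow_ne_top_of_nonneg (by positivity) (ENNReal.natCast_ne_top _))] at h1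
  have h2 := ENNReal.rpow_le_rpow (h1.trans (mul_le_mul_right hmk _)) (show 0 ≤ 2 / p by positivity)
  rw [ENNReal.mul_rpow_of_nonneg _ _ (by positivity), e0, e0] at h2
  exact h2

lemma Fam_card {ι : Type} {A s : ℝ} {B : ℕ} {S : Finset ι} {c : ι → V d} {F : ι → X d → ℂ} (h : Fam A s B S c F) (hs : 0 < s) (hs1 : s ≤ 1) :
    (S.card : ℝ) ≤ (B * (2 * (d + 2) * ⌈A⌉₊ + 1) ^ d) * s ^ (-(d : ℝ)) := by
  set N := ⌈(d : ℝ) / s⌉₊ + 1 with hN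
  have hN0 : 0 < N := by omega
  have hd0 : (0 : ℝ) ≤ d := Nat.cast_nonneg d
  have hNr : (d : ℝ) / s ≤ N := by
    rw [hN]; push_cast; have := Nat.le_ceil ((d : ℝ) / s); linarith
  have hN2 : (N : ℝ) ≤ (d + 2) / s := by
    rw [hN]; push_cast; have := Nat.ceil_lt_add_one (show 0 ≤ (d : ℝ) / s by positivity)
    have h1 : 1 ≤ 1 / s := one_le_one_div hs hs1
    have h2 : ((d : ℝ) + 2) / s = d / s + 2 * (1 / s) := by ring
    linarith
  have hcard : ∀ J ∈ gc c N S, J.card ≤ B := by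
    intro J hJ
    obtain ⟨θ0, hθ0⟩ := cells_nonempty hJ
    have h1 : (J : Set ι) ⊆ {θ | θ ∈ S ∧ ‖c θ - c θ0‖ ≤ s} := by
      intro θ hθ
      refine ⟨cells_sub hJ hθ, ?_⟩
      have h2 := gc_close hN0 hJ hθ hθ0
      have hN0' : (0 : ℝ) < N := by exact_mod_cast hN0
      rw [div_le_iff₀ hs] at hNr
      have : (N : ℝ) * ‖c θ - c θ0‖ ≤ N * s := h2.trans hNr
      exact le_of_mul_le_mul_left this hN0'
    rw [← Set.ncard_coe_finset]
    exact (Set.ncard_le_ncard h1 (S.finite_toSet.subset fun θ hθ => hθ.1)).trans (h.2.1 _)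
  have h3 : S.card ≤ (gc c N S).card * B := by
    have := cells_sum (fun θ => lab N (c θ)) S (fun _ => (1 : ℕ))
    simp only [Finset.sum_const, smul_eq_mul, mul_one] at this
    rw [← this]
    exact Finset.sum_le_card_nsmul _ _ _ hcard
  have h4 : S.card ≤ (2 * N * ⌈A⌉₊ + 1) ^ d * B := h3.trans (Nat.mul_le_mul_right _ (gc_card h N))
  have h5 : (S.card : ℝ) ≤ (2 * N * ⌈A⌉₊ + 1) ^ d * B := by exact_mod_cast h4
  refine h5.trans ?_
  rw [Real.rpow_neg hs.le, Real.rpow_natCast, ← inv_pow, mul_assoc (B : ℝ), ← mul_pow, mul_comm]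
  refine mul_le_mul_of_nonneg_left (pow_le_pow_left₀ (by positivity) ?_ _) (by positivity)
  have h1 : 1 ≤ s⁻¹ := (one_le_inv₀ hs).2 hs1
  have hA : (0 : ℝ) ≤ ⌈A⌉₊ := Nat.cast_nonneg _
  rw [div_eq_mul_inv] at hN2
  nlinarith

lemma triv (d : ℕ) {p : ℝ} (hp : 2 ≤ p) (E B : ℕ) (A : ℝ) : Adm d p E B A d := by
  refine ⟨(B * (2 * (d + 2) * ⌈A⌉₊ + 1) ^ d : ℕ), fun s hs hs1 Ω hΩ ι S c F hF => ?_⟩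
  refine (nq_card hp hΩ.1 S F hF.2.2.2).trans (mul_le_mul_left ?_ _)
  have h1 := Fam_card hF hs hs1
  have h2 : ((S.card : ℕ) : ℝ≥0∞) = ENNReal.ofReal S.card := by simp
  rw [h2]
  refine (ENNReal.ofReal_le_ofReal h1).trans ?_
  rw [ENNReal.ofReal_mul (by positivity)]
  refine mul_le_mul_left (le_of_eq ?_) _
  rw [← ENNReal.ofReal_coe_nnreal]
  congr 1
  push_cast; ring

lemma Lam_ne_top (d : ℕ) {p : ℝ} (hp : 2 ≤ p) (E : ℕ) (K : ℝ) (Mx : ℕ) : Lam d p E K Mx ≠ ∞ := by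
  unfold Lam
  refine ENNReal.rpow_ne_top_of_nonneg (by positivity) (ENNReal.mul_ne_top (ENNReal.pow_ne_top (br_ne_top _)) (ENNReal.pow_ne_top (ENNReal.mul_ne_top ?_ ?_)))
  · exact ENNReal.rpow_ne_top_of_nonneg (by positivity) (ENNReal.mul_ne_top (ENNReal.pow_ne_top (br_ne_top _)) ENNReal.ofReal_ne_top)
  · exact ENNReal.rpow_ne_top_of_nonneg (by positivity) (ENNReal.pow_ne_top (by simp))

lemma num {s η L : ℝ} {N0 m N j D : ℕ} (hs : 0 < s) (hs1 : s ≤ 1) (hN0 : 1 ≤ N0) (hN : N = N0 ^ m) (hm : 1 ≤ s * ((N0 : ℝ) ^ (m + 1)) ^ (2 ^ j))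
    (hη : 0 ≤ η) (hL0 : 0 ≤ L) (hL : L ≤ (N0 : ℝ) ^ (η / 4)) (hj : 4 * (D : ℝ) ≤ j * η) :
    (N : ℝ) ^ D * L ^ (m * j) * (s ^ (-η) * (N : ℝ) ^ (-((1 + j / 2) * η))) ≤ (N0 : ℝ) ^ η * s ^ (-(η * (1 - 1 / 2 ^ j))) := by
  have hN0' : (1 : ℝ) ≤ N0 := by exact_mod_cast hN0
  have hN0p : (0 : ℝ) < N0 := by linarith
  have hNe : (N : ℝ) = (N0 : ℝ) ^ m := by rw [hN]; push_cast; rfl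
  have hN1 : (1 : ℝ) ≤ N := by rw [hNe]; exact one_le_pow₀ hN0'
  have hNp : (0 : ℝ) < N := by linarith
  have h1 : L ^ (m * j) ≤ (N : ℝ) ^ (j * η / 4) := by
    refine (pow_le_pow_left₀ hL0 hL _).trans (le_of_eq ?_)
    rw [hNe, ← Real.rpow_natCast, ← Real.rpow_natCast, ← Real.rpow_mul hN0p.le, ← Real.rpow_mul hN0p.le]
    congr 1; push_cast; ring
  have h2 : (N : ℝ) ^ D * L ^ (m * j) * (s ^ (-η) * (N : ℝ) ^ (-((1 + j / 2) * η))) ≤ s ^ (-η) * (N : ℝ) ^ (-η) := by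
    calc (N : ℝ) ^ D * L ^ (m * j) * (s ^ (-η) * (N : ℝ) ^ (-((1 + j / 2) * η)))
        ≤ (N : ℝ) ^ (D : ℝ) * (N : ℝ) ^ (j * η / 4) * (s ^ (-η) * (N : ℝ) ^ (-((1 + j / 2) * η))) := by
          rw [Real.rpow_natCast]; gcongr
      _ = s ^ (-η) * ((N : ℝ) ^ ((D : ℝ) + j * η / 4 + -((1 + j / 2) * η))) := by
          rw [Real.rpow_add hNp, Real.rpow_add hNp]; ring
      _ ≤ _ := by
          refine mul_le_mul_of_nonneg_left (Real.rpow_le_rpow_of_exponent_le hN1 ?_) (by positivity)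
          nlinarith
  refine h2.trans ?_
  have h3 : s ^ (-(1 / 2 ^ j : ℝ)) ≤ N0 * N := by
    have h4 : s⁻¹ ≤ ((N0 : ℝ) * N) ^ (2 ^ j) := by
      rw [hNe, ← pow_succ']
      rw [inv_le_iff_one_le_mul₀ hs]; linarith
    have h5 := Real.rpow_le_rpow (by positivity) h4 (show (0 : ℝ) ≤ 1 / 2 ^ j by positivity)
    rw [Real.inv_rpow hs.le, ← Real.rpow_neg hs.le] at h5
    refine h5.trans (le_of_eq ?_)
    rw [← Real.rpow_natCast, ← Real.rpow_mul (by positivity)]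
    push_cast
    rw [mul_one_div_cancel (by positivity), Real.rpow_one]
  have h6 : (N : ℝ) ^ (-η) ≤ (N0 : ℝ) ^ η * s ^ (η / 2 ^ j) := by
    have h7 := Real.rpow_le_rpow (by positivity) h3 hη
    rw [← Real.rpow_mul hs.le, Real.mul_rpow hN0p.le hNp.le] at h7
    rw [Real.rpow_neg hNp.le, inv_le_iff_one_le_mul₀ (by positivity)]
    have h8 : s ^ (-(1 / 2 ^ j : ℝ) * η) * s ^ (η / 2 ^ j) = 1 := by
      rw [← Real.rpow_add hs]
      rw [show (-(1 / 2 ^ j : ℝ) * η) + η / 2 ^ j = 0 by ring, Real.rpow_zero]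
    have h9 := mul_le_mul_of_nonneg_right h7 (show 0 ≤ s ^ (η / 2 ^ j) by positivity)
    rw [h8] at h9
    linarith
  calc s ^ (-η) * (N : ℝ) ^ (-η) ≤ s ^ (-η) * ((N0 : ℝ) ^ η * s ^ (η / 2 ^ j)) := by gcongr
    _ = (N0 : ℝ) ^ η * (s ^ (-η) * s ^ (η / 2 ^ j)) := by ring
    _ = _ := by rw [← Real.rpow_add hs]; congr 2; ring

lemma exN {s : ℝ} (hs : 0 < s) (hs1 : s ≤ 1) {N0 : ℕ} (hN0 : 2 ≤ N0) (j : ℕ) : ∃ m : ℕ, s * (((N0 ^ m : ℕ) : ℝ)) ^ (2 ^ j) ≤ 1 ∧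
    1 ≤ s * ((N0 : ℝ) ^ (m + 1)) ^ (2 ^ j) := by
  have hN0' : (2 : ℝ) ≤ N0 := by exact_mod_cast hN0
  have hex : ∃ m : ℕ, 1 < s * ((N0 : ℝ) ^ m) ^ (2 ^ j) := by
    obtain ⟨m, hm⟩ := pow_unbounded_of_one_lt (1 / s) (show (1 : ℝ) < N0 by linarith)
    refine ⟨m, ?_⟩
    rw [div_lt_iff₀ hs] at hm
    have h1 : (N0 : ℝ) ^ m ≤ ((N0 : ℝ) ^ m) ^ (2 ^ j) := le_self_pow₀ (one_le_pow₀ (by linarith)) (by positivity)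
    nlinarith
  set m := Nat.find hex with hm
  have h0 : m ≠ 0 := by
    intro h
    have := Nat.find_spec hex
    rw [← hm, h] at this
    simp at this; linarith
  obtain ⟨l, hl⟩ := Nat.exists_eq_succ_of_ne_zero h0
  refine ⟨l, ?_, ?_⟩
  · have := Nat.find_min hex (m := l) (by omega)
    push Not at this
    push_cast; exact this
  · have := Nat.find_spec hex
    rw [← hm, hl] at this
    exact this.le

end

end Dcp

end


section
open MeasureTheory Real
open scoped RealInnerProductSpace ENNReal NNReal

set_option linter.all false
namespace Dcp

section
variable {d : ℕ}
open Classical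

lemma ex_large {a : ℝ} (ha : 0 < a) (C : ℝ) : ∃ n0 : ℕ, ∀ n : ℕ, n0 ≤ n → C ≤ (n : ℝ) ^ a :=
  Filter.eventually_atTop.1 (((tendsto_rpow_atTop ha).comp tendsto_natCast_atTop_atTop).eventually_ge_atTop C)

/-- broad estimate at one scale -/
lemma broad (e : ℕ) {p : ℝ} (hp : 2 ≤ p) (hpd : p * (e + 1 : ℕ) ≤ 2 * ((e + 1 : ℕ) + 2)) (E B : ℕ) {A : ℝ} (hA : (e : ℝ) + 1 ≤ A) (j : ℕ) {η : ℝ} (hη : 0 < η)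
    (hj : 4 * ((e + 1 : ℕ) : ℝ) ≤ j * η) (hadm : Adm (e + 1) p E B A η) (K : ℝ) :
    ∃ N00 : ℕ, ∀ N1 : ℕ, N00 ≤ N1 → ∃ Cb : ℝ≥0, ∀ s : ℝ, 0 < s → s ≤ 1 → ∃ N : ℕ, 0 < N ∧ s * N ≤ 1 ∧
      ∀ Ω : X (e + 1) → ℝ≥0∞, Wt E (s ^ 2) Ω →
      ∀ (ι : Type) (S0 : Finset ι) (c : ι → V (e + 1)) (F : ι → X (e + 1) → ℂ), Fam A s B S0 c F →
      N ^ (e + 1) * ∑ τ ∈ TT c N1 S0 K, Bq p Ω c F τ N (E + (e + 3) + 2 * (e + 3) * j) ≤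
        Cb * ENNReal.ofReal (s ^ (-(η * (1 - 1 / 2 ^ j)))) * ∑ θ ∈ S0, nq p Ω (F θ) := by
  obtain ⟨C0, hC0⟩ := hadm
  set Mx := E + (e + 3) + 2 * (e + 3) * j with hMx
  have hdA : ((e + 1 : ℕ) : ℝ) ≤ A := by push_cast; exact hA
  obtain ⟨Ci, hCi⟩ := iterB (e + 1) hp hpd E B A hdA K Mx j le_rfl
  set L := (Lam (e + 1) p E K Mx).toReal with hL
  have hLt := Lam_ne_top (e + 1) hp E K Mx
  obtain ⟨n0, hn0⟩ := ex_large (show 0 < η / 4 by positivity) L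
  set N0 := n0 + 2 + ⌈2 * (1 + 2 * K)⌉₊ with hN0
  have hN0K : 2 * (1 + 2 * K) ≤ N0 := (Nat.le_ceil _).trans (by exact_mod_cast (by omega))
  refine ⟨N0 * (e + 1), fun N1 hN1 => ?_⟩
  have hN1p : 0 < N1 := lt_of_lt_of_le (by positivity) hN1
  set T : ℕ := ((2 * N1 * ⌈A⌉₊ + 1) ^ (e + 1)) ^ (e + 1 + 1) with hT
  refine ⟨T * Ci * C0 * (Real.toNNReal ((N0 : ℝ) ^ η)), fun s hs hs1 => ?_⟩
  obtain ⟨m, hm1, hm2⟩ := exN hs hs1 (show 2 ≤ N0 by omega) j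
  have hNp : 0 < N0 ^ m := Nat.pow_pos (by omega)
  refine ⟨N0 ^ m, hNp, ?_, fun Ω hΩ ι S0 c F hF => ?_⟩
  · refine le_trans ?_ hm1
    have h1 : (1 : ℝ) ≤ (N0 ^ m : ℕ) := by exact_mod_cast hNp
    exact mul_le_mul_of_nonneg_left (le_self_pow₀ h1 (by positivity)) hs.le
  set R := ∑ θ ∈ S0, nq p Ω (F θ) with hR
  have hb : ∀ τ ∈ TT c N1 S0 K, Bq p Ω c F τ (N0 ^ m) Mx ≤ Ci * Lam (e + 1) p E K Mx ^ (m * j) *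
      (ENNReal.ofReal (s ^ (-η) * ((N0 ^ m : ℕ) : ℝ) ^ (-((1 + j / 2) * η))) * (C0 * R)) := by
    intro τ hτ
    obtain ⟨ht1, ht2⟩ := TT_trans hN1p hN1 hτ
    exact hCi N0 m (N0 ^ m) s (by omega) hN0K rfl hs hm1 Ω hΩ ι S0 c F hF τ ht2 ht1 C0 η (fun t h1 h2 => hC0 t (hs.trans_le h1) h2)
  have hsum := Finset.sum_le_card_nsmul _ _ _ hb
  rw [nsmul_eq_mul] at hsum
  have hTc : ((TT c N1 S0 K).card : ℝ≥0∞) ≤ T := by exact_mod_cast TT_card hF N1 K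
  have hnum := num (D := e + 1) hs hs1 (show 1 ≤ N0 by omega) rfl hm2 hη.le ENNReal.toReal_nonneg (hn0 N0 (by omega)) hj
  have hnum' := ENNReal.ofReal_le_ofReal hnum
  rw [ENNReal.ofReal_mul (by positivity), ENNReal.ofReal_mul (by positivity), ENNReal.ofReal_mul (show 0 ≤ (N0 : ℝ) ^ η by positivity), ENNReal.ofReal_pow ENNReal.toReal_nonneg,
    ENNReal.ofReal_toReal hLt, ENNReal.ofReal_pow (by positivity), ENNReal.ofReal_natCast] at hnum'
  have hcn : (((N0 : ℝ) ^ η).toNNReal : ℝ≥0∞) = ENNReal.ofReal ((N0 : ℝ) ^ η) := rfl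
  calc ((N0 ^ m : ℕ) : ℝ≥0∞) ^ (e + 1) * ∑ τ ∈ TT c N1 S0 K, Bq p Ω c F τ (N0 ^ m) Mx
      ≤ ((N0 ^ m : ℕ) : ℝ≥0∞) ^ (e + 1) * (T * (Ci * Lam (e + 1) p E K Mx ^ (m * j) *
      (ENNReal.ofReal (s ^ (-η) * ((N0 ^ m : ℕ) : ℝ) ^ (-((1 + j / 2) * η))) * (C0 * R)))) := by
        refine mul_le_mul_right (hsum.trans (mul_le_mul_left hTc _)) _
    _ = (T * Ci * C0) * (((N0 ^ m : ℕ) : ℝ≥0∞) ^ (e + 1) * Lam (e + 1) p E K Mx ^ (m * j) *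
      ENNReal.ofReal (s ^ (-η) * ((N0 ^ m : ℕ) : ℝ) ^ (-((1 + j / 2) * η)))) * R := by ring
    _ ≤ (T * Ci * C0) * (ENNReal.ofReal ((N0 : ℝ) ^ η) * ENNReal.ofReal (s ^ (-(η * (1 - 1 / 2 ^ j))))) * R := by
        refine mul_le_mul_left (mul_le_mul_right hnum' _) _
    _ = _ := by push_cast; rw [hcn]; ring

set_option maxHeartbeats 1000000 in
lemma step (e : ℕ) {p : ℝ} (hp : 2 ≤ p) (hpd : p * (e + 1 : ℕ) ≤ 2 * ((e + 1 : ℕ) + 2)) (E B : ℕ) {A : ℝ} (hA : (e : ℝ) + 1 ≤ A) (j : ℕ) {η : ℝ} (hη : 0 < η)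
    (hj : 4 * ((e + 1 : ℕ) : ℝ) ≤ j * η) (hadm : Adm (e + 1) p E B A η) (hlow : ∀ E B ε, 0 < ε → Adm e p E B A ε) :
    Adm (e + 1) p E B A (η * (1 - 1 / 2 ^ j)) := by
  have hj0 : j ≠ 0 := by
    rintro rfl; push_cast at hj; have : (0 : ℝ) ≤ e := Nat.cast_nonneg e; linarith
  set η' := η * (1 - 1 / 2 ^ j) with hη'
  have hη'0 : 0 < η' := by
    refine mul_pos hη (sub_pos.2 ?_)
    rw [div_lt_one (by positivity)]
    exact one_lt_pow₀ one_lt_two hj0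
  obtain ⟨M2, C, hbn⟩ := bn e hp E hA j
  obtain ⟨Ce, hCe⟩ := hlow M2 ((2 * (12 * (e + 2) + 1) + 1) ^ (e + 1)) (η' / 2) (by positivity)
  obtain ⟨Ct, hCt⟩ := triv (e + 1) hp E B A
  obtain ⟨n1, hn1⟩ := ex_large (show 0 < η' / 2 by positivity) (4 * C * (Ce + 1))
  set NQ := n1 + 2 * (e + 2) with hNQ
  have hNQp : (0 : ℝ) < NQ := by exact_mod_cast (by omega : 0 < NQ)
  set r : ℝ := (e + 2) / NQ with hr
  have hr0 : 0 < r := by positivity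
  have hr1 : 2 * r ≤ 1 := by
    rw [hr, mul_div_assoc', div_le_one hNQp]
    exact_mod_cast (by omega : 2 * (e + 2) ≤ NQ)
  set w : ℝ := r ^ 2 / (2 * A + 4) with hw
  have hA0 : 0 < A := by have : (0 : ℝ) ≤ e := Nat.cast_nonneg e; linarith
  have hw0 : 0 < w := by positivity
  obtain ⟨N00, hN00⟩ := broad e hp hpd E B hA j hη hj hadm (KT (e + 1) A (w / 2))
  set k0 := ⌈((e : ℝ) + 2) / (w / 2)⌉₊ with hk0
  set k := (e + 2) + NQ + N00 + k0 with hk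
  have hkw : ((e : ℝ) + 2) / (w / 2) ≤ k := (Nat.le_ceil _).trans (by rw [← hk0]; exact_mod_cast (by omega : k0 ≤ k))
  clear_value k0
  have hkN : k ≤ NQ * k := Nat.le_mul_of_pos_left _ (by omega)
  have hw2 : ((e + 2) : ℝ) / (NQ * k : ℕ) ≤ w / 2 := by
    have h1 : (k : ℝ) ≤ (NQ * k : ℕ) := by exact_mod_cast hkN
    have h2 : (0 : ℝ) < k := by exact_mod_cast (by omega : 0 < k)
    rw [div_le_iff₀ (by linarith), mul_comm, ← div_le_iff₀ (by positivity)]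
    exact hkw.trans h1
  obtain ⟨Cb, hCb⟩ := hN00 (NQ * k) (by omega)
  set X' : ℝ≥0∞ := ((Ce + 1 : ℝ≥0) : ℝ≥0∞) * ENNReal.ofReal ((NQ : ℝ) ^ (η' / 2)) with hX'
  have hX1 : 1 ≤ X' := by
    rw [hX', ← one_mul (1 : ℝ≥0∞)]
    refine mul_le_mul' (by simp) ?_
    rw [← ENNReal.ofReal_one]
    refine ENNReal.ofReal_le_ofReal (Real.one_le_rpow ?_ (by positivity))
    exact_mod_cast (by omega : 1 ≤ NQ)
  have hDe : Dec e p M2 ((2 * (12 * (e + 2) + 1) + 1) ^ (e + 1)) A (2 * r) X' := by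
    refine (hCe (2 * r) (by positivity) hr1).mono le_rfl le_rfl ?_
    refine mul_le_mul' (by exact_mod_cast le_self_add) (ENNReal.ofReal_le_ofReal ?_)
    rw [Real.rpow_neg (by positivity), ← Real.inv_rpow (by positivity)]
    refine Real.rpow_le_rpow (by positivity) ?_ (by positivity)
    rw [inv_le_iff_one_le_mul₀ (by positivity), hr]
    have he : (0 : ℝ) ≤ e := Nat.cast_nonneg e
    field_simp
    linarith
  obtain ⟨Cσ, hCσ⟩ := hbn NQ k r w (by omega) (by omega) (by omega) rfl rfl hw2 X' hX1 hDe
  set N1 := NQ * k with hN1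
  have hN1r : (1 : ℝ) ≤ N1 := by exact_mod_cast (by omega : 1 ≤ N1)
  set Cf : ℝ≥0 := Ct * Real.toNNReal ((N1 : ℝ) ^ ((e + 1 : ℕ) : ℝ)) + 2 * (Cσ * Cb) with hCf
  have hbig : ∀ s : ℝ, 0 < s → s ≤ 1 → 1 ≤ s * N1 → Dec (e + 1) p E B A s (Cf * ENNReal.ofReal (s ^ (-η'))) := by
    intro s hs hs1 hsN
    refine (hCt s hs hs1).mono le_rfl le_rfl ?_
    have h1 : s ^ (-((e + 1 : ℕ) : ℝ)) ≤ (N1 : ℝ) ^ ((e + 1 : ℕ) : ℝ) * s ^ (-η') := by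
      rw [Real.rpow_neg hs.le, ← Real.inv_rpow hs.le]
      have h2 : 1 ≤ s ^ (-η') := Real.one_le_rpow_of_pos_of_le_one_of_nonpos hs hs1 (by linarith)
      have h3 : s⁻¹ ^ ((e + 1 : ℕ) : ℝ) ≤ (N1 : ℝ) ^ ((e + 1 : ℕ) : ℝ) := by
        refine Real.rpow_le_rpow (by positivity) ?_ (by positivity)
        rw [inv_le_iff_one_le_mul₀ hs]; linarith
      refine h3.trans (le_mul_of_one_le_right (by positivity) h2)
    calc (Ct : ℝ≥0∞) * ENNReal.ofReal (s ^ (-((e + 1 : ℕ) : ℝ))) ≤ Ct * (ENNReal.ofReal ((N1 : ℝ) ^ ((e + 1 : ℕ) : ℝ)) * ENNReal.ofReal (s ^ (-η'))) := by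
          rw [← ENNReal.ofReal_mul (by positivity)]; exact mul_le_mul_right (ENNReal.ofReal_le_ofReal h1) _
      _ = ((Ct * Real.toNNReal ((N1 : ℝ) ^ ((e + 1 : ℕ) : ℝ)) : ℝ≥0) : ℝ≥0∞) * ENNReal.ofReal (s ^ (-η')) := by
          rw [← mul_assoc]; rfl
      _ ≤ _ := by
          refine mul_le_mul_left ?_ _
          rw [hCf]; exact_mod_cast le_self_add
  have hmain : ∀ m : ℕ, ∀ s : ℝ, 0 < s → s ≤ 1 → 1 ≤ 2 ^ m * (s * N1) → Dec (e + 1) p E B A s (Cf * ENNReal.ofReal (s ^ (-η'))) := by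
    intro m
    induction m with
    | zero => intro s hs hs1 h; exact hbig s hs hs1 (by simpa using h)
    | succ m ih =>
      intro s hs hs1 h
      by_cases hsN : 1 ≤ s * N1
      · exact hbig s hs hs1 hsN
      push Not at hsN
      have hN1e : (N1 : ℝ) = NQ * k := by rw [hN1]; push_cast; rfl
      have hk1 : (1 : ℝ) ≤ k := by exact_mod_cast (by omega : 1 ≤ k)
      have hNQ2 : (2 : ℝ) ≤ NQ := by exact_mod_cast (by omega : 2 ≤ NQ)
      have hNQN1 : (NQ : ℝ) ≤ N1 := by rw [hN1e]; exact le_mul_of_one_le_right hNQp.le hk1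
      have hmN : s * NQ ≤ s * N1 := mul_le_mul_of_nonneg_left hNQN1 hs.le
      have hsQ : s * NQ ≤ 1 := hmN.trans hsN.le
      have hD1 := ih (s * NQ) (by positivity) hsQ (by
        rw [pow_succ] at h
        have : (2 : ℝ) ^ m * 2 * (s * N1) ≤ 2 ^ m * (s * NQ * N1) := by
          have h0 : (0 : ℝ) < 2 ^ m * (s * N1) := by positivity
          have h1 := mul_le_mul_of_nonneg_left hNQ2 h0.le
          linarith
        linarith)
      have hD2 := ih (s * N1) (by positivity) hsN.le (by
        rw [pow_succ] at h
        have : (2 : ℝ) ^ m * 2 * (s * N1) ≤ 2 ^ m * (s * N1 * N1) := by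
          have h0 : (0 : ℝ) < 2 ^ m * (s * N1) := by positivity
          have h1 := mul_le_mul_of_nonneg_left (hNQ2.trans hNQN1) h0.le
          linarith
        linarith)
      have hle1 : (s * NQ) ^ (-η') = s ^ (-η') * (NQ : ℝ) ^ (-η') := Real.mul_rpow hs.le hNQp.le
      have hle2 : (s * N1) ^ (-η') ≤ s ^ (-η') * (NQ : ℝ) ^ (-η') := by
        rw [← hle1]; exact Real.rpow_le_rpow_of_nonpos (by positivity) hmN (by linarith)
      set D : ℝ≥0∞ := Cf * ENNReal.ofReal (s ^ (-η') * (NQ : ℝ) ^ (-η')) with hD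
      have hD1' := hD1.mono (B := B) (A := A) le_rfl le_rfl (show _ ≤ D by rw [hle1])
      have hD2' := hD2.mono (B := B) (A := A) le_rfl le_rfl (show _ ≤ D from mul_le_mul_right (ENNReal.ofReal_le_ofReal hle2) _)
      obtain ⟨N, hNp, hsN', hbr⟩ := hCb s hs hs1
      intro Ω hΩ ι S0 c F hF
      have hA1 := hCσ B s D D hs hsN.le hD1' hD2' Ω hΩ ι S0 c F hF N hNp hsN'
      have hA2 := hbr Ω hΩ ι S0 c F hF
      set R := ∑ θ ∈ S0, nq p Ω (F θ) with hR
      change nq p Ω (FS F S0) ≤ _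
      have hhalf : (C : ℝ≥0∞) * X' * (D + D) ≤ Cf * ENNReal.ofReal (s ^ (-η')) * 2⁻¹ := by
        have h1 : 4 * C * (Ce + 1) * ((NQ : ℝ) ^ (η' / 2) * (NQ : ℝ) ^ (-η')) ≤ 1 := by
          have h2 := hn1 NQ (by omega)
          rw [← Real.rpow_add hNQp, show η' / 2 + -η' = -(η' / 2) by ring, Real.rpow_neg hNQp.le]
          rw [mul_inv_le_iff₀ (by positivity)]; linarith
        have h3 := ENNReal.ofReal_le_ofReal h1
        rw [ENNReal.ofReal_mul (by positivity), ENNReal.ofReal_mul (by positivity), ENNReal.ofReal_one, ENNReal.ofReal_mul (by positivity),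
          ENNReal.ofReal_mul (by positivity), ENNReal.ofReal_ofNat, ENNReal.ofReal_add (by positivity) (by positivity), ENNReal.ofReal_coe_nnreal, ENNReal.ofReal_coe_nnreal, ENNReal.ofReal_one] at h3
        rw [hD, hX', ENNReal.ofReal_mul (by positivity)]
        push_cast
        have h4 : (4 : ℝ≥0∞) = 2 * 2 := by norm_num
        have h5 : (2 : ℝ≥0∞) * 2⁻¹ = 1 := ENNReal.mul_inv_cancel (by simp) (by simp)
        set z1 := ENNReal.ofReal ((NQ : ℝ) ^ (η' / 2))
        set z2 := ENNReal.ofReal ((NQ : ℝ) ^ (-η'))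
        set z3 := ENNReal.ofReal (s ^ (-η'))
        calc (C : ℝ≥0∞) * ((Ce + 1) * z1) * (Cf * (z3 * z2) + Cf * (z3 * z2))
            = 2 * (C * (Ce + 1) * (z1 * z2)) * (Cf * z3) := by ring
          _ = 2 * (C * (Ce + 1) * (z1 * z2)) * (2 * 2⁻¹) * (Cf * z3) := by rw [h5, mul_one]
          _ = (4 * C * (Ce + 1) * (z1 * z2)) * (Cf * z3 * 2⁻¹) := by rw [h4]; ring
          _ ≤ 1 * (Cf * z3 * 2⁻¹) := mul_le_mul_left h3 _
          _ = _ := one_mul _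
      have hbroad : (Cσ : ℝ≥0∞) * (Cb * ENNReal.ofReal (s ^ (-η')) * R) ≤ Cf * ENNReal.ofReal (s ^ (-η')) * 2⁻¹ * R := by
        have h5 : (2 : ℝ≥0∞) * 2⁻¹ = 1 := ENNReal.mul_inv_cancel (by simp) (by simp)
        have h6 : (2 : ℝ≥0∞) * (Cσ * Cb) ≤ Cf := by rw [hCf]; exact_mod_cast le_add_self
        calc (Cσ : ℝ≥0∞) * (Cb * ENNReal.ofReal (s ^ (-η')) * R) = (Cσ * Cb) * ENNReal.ofReal (s ^ (-η')) * R * (2 * 2⁻¹) := by rw [h5]; ring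
          _ = (2 * (Cσ * Cb)) * (ENNReal.ofReal (s ^ (-η')) * 2⁻¹ * R) := by ring
          _ ≤ Cf * (ENNReal.ofReal (s ^ (-η')) * 2⁻¹ * R) := mul_le_mul_left h6 _
          _ = _ := by ring
      refine hA1.trans ?_
      rw [mul_assoc (Cσ : ℝ≥0∞)]
      refine (add_le_add (mul_le_mul_left hhalf R) ((mul_le_mul_right hA2 _).trans hbroad)).trans (le_of_eq ?_)
      rw [← two_mul]
      have h5 : (2 : ℝ≥0∞) * 2⁻¹ = 1 := ENNReal.mul_inv_cancel (by simp) (by simp)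
      calc (2 : ℝ≥0∞) * (Cf * ENNReal.ofReal (s ^ (-η')) * 2⁻¹ * R) = (2 * 2⁻¹) * (Cf * ENNReal.ofReal (s ^ (-η')) * R) := by ring
        _ = _ := by rw [h5, one_mul]
  refine ⟨Cf, fun s hs hs1 => ?_⟩
  obtain ⟨m, hm⟩ := pow_unbounded_of_one_lt (1 / (s * N1)) (show (1 : ℝ) < 2 by norm_num)
  refine hmain m s hs hs1 ?_
  rw [div_lt_iff₀ (by positivity)] at hm
  exact hm.le

theorem thm (d : ℕ) : ∀ {p : ℝ}, 2 ≤ p → p * d ≤ 2 * (d + 2) → ∀ (E B : ℕ) (A ε : ℝ), 0 < ε → Adm d p E B A ε := by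
  induction d with
  | zero =>
    intro p hp hpd E B A ε hε
    exact (triv 0 hp E B A).mono le_rfl (by push_cast; exact hε.le)
  | succ e ih =>
    intro p hp hpd E B A ε hε
    have he : (0 : ℝ) ≤ e := Nat.cast_nonneg e
    have hpe : p * e ≤ 2 * (e + 2) := by
      push_cast at hpd
      nlinarith
    set A' := max A (e + 1) with hA'
    suffices h : Adm (e + 1) p E B A' ε from h.mono (le_max_left _ _) le_rfl
    have hA1 : (e : ℝ) + 1 ≤ A' := le_max_right _ _
    obtain ⟨j, hj⟩ := exists_nat_ge (4 * ((e + 1 : ℕ) : ℝ) / ε)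
    rw [div_le_iff₀ hε] at hj
    have hj0 : j ≠ 0 := by
      rintro rfl; push_cast at hj; linarith
    set q : ℝ := 1 - 1 / 2 ^ j with hq
    have hq1 : q < 1 := by rw [hq]; have : (0 : ℝ) < 1 / 2 ^ j := by positivity
                           linarith
    have hq0 : 0 ≤ q := by
      rw [hq, sub_nonneg, div_le_one (by positivity)]; exact one_le_pow₀ one_le_two
    have hall : ∀ n : ℕ, Adm (e + 1) p E B A' (max ε ((e + 1 : ℕ) * q ^ n)) := by
      intro n
      induction n with
      | zero => exact (triv (e + 1) hp E B A').mono le_rfl (by simp)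
      | succ n ihn =>
        by_cases hc : ((e + 1 : ℕ) : ℝ) * q ^ n ≤ ε
        · rw [max_eq_left hc] at ihn
          exact ihn.mono le_rfl (le_max_left _ _)
        · push Not at hc
          rw [max_eq_right hc.le] at ihn
          have hj' : 4 * ((e + 1 : ℕ) : ℝ) ≤ j * (((e + 1 : ℕ) : ℝ) * q ^ n) := hj.trans (mul_le_mul_of_nonneg_left hc.le (Nat.cast_nonneg j))
          have := step e hp hpd E B hA1 j (hε.trans hc) hj' ihn (fun E B ε hε => ih hp hpe E B A' ε hε)
          refine this.mono le_rfl ?_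
          refine le_trans (le_of_eq ?_) (le_max_right _ _)
          rw [pow_succ]; ring
    have hlim : Filter.Tendsto (fun n => ((e + 1 : ℕ) : ℝ) * q ^ n) Filter.atTop (nhds (((e + 1 : ℕ) : ℝ) * 0)) :=
      (tendsto_pow_atTop_nhds_zero_of_lt_one hq0 hq1).const_mul _
    rw [mul_zero] at hlim
    obtain ⟨n, hn⟩ := (hlim.eventually_le_const hε).exists
    have := hall n
    rwa [max_eq_left hn] at this

end

end Dcp

end


section
open MeasureTheory Real
open scoped RealInnerProductSpace ENNReal NNReal

set_option linter.all false
namespace Dcp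

section
variable {d : ℕ}
open Classical

def TR (d : ℕ) : X d ≃L[ℝ] Rsp d :=
  LinearEquiv.toContinuousLinearEquiv
  { toFun := fun x => WithLp.toLp 2 (Sum.elim (fun i => x.1 i) (fun _ => x.2))
    map_add' := by
      intro x y; ext i; rcases i with i | i <;> simp
    map_smul' := by
      intro c x; ext i; rcases i with i | i <;> simp
    invFun := fun z => (WithLp.toLp 2 (fun i => z (Sum.inl i)), z (Sum.inr ()))
    left_inv := by
      intro x; ext1 <;> simp
    right_inv := by
      intro z; ext i; rcases i with i | i <;> simp }

lemma TR_inl (x : X d) (i : Fin d) : TR d x (Sum.inl i) = x.1 i := rfl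
lemma TR_inr (x : X d) : TR d x (Sum.inr ()) = x.2 := rfl

lemma TR_inner (x ω : X d) : ⟪TR d x, TR d ω⟫ = ph x ω := by
  unfold ph
  rw [PiLp.inner_apply, PiLp.inner_apply, Fintype.sum_sum_type]
  simp [TR_inl, TR_inr]
  ring

lemma TR_norm (x : X d) : ‖TR d x‖ ≤ 2 * ‖x‖ := by
  have h1 : ‖TR d x‖ ^ 2 = ‖x.1‖ ^ 2 + x.2 ^ 2 := by
    rw [← real_inner_self_eq_norm_sq, TR_inner, ph, real_inner_self_eq_norm_sq]; ring
  have h2 : ‖x.1‖ ≤ ‖x‖ := norm_fst_le x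
  have h3 : |x.2| ≤ ‖x‖ := norm_snd_le x
  have h4 : x.2 ^ 2 ≤ ‖x‖ ^ 2 := by rw [← sq_abs]; exact pow_le_pow_left₀ (abs_nonneg _) h3 2
  have h5 : ‖x.1‖ ^ 2 ≤ ‖x‖ ^ 2 := pow_le_pow_left₀ (norm_nonneg _) h2 2
  have h6 : ‖TR d x‖ ^ 2 ≤ (2 * ‖x‖) ^ 2 := by nlinarith [sq_nonneg ‖x‖]
  exact le_of_sq_le_sq h6 (by positivity)

/-- the weight -/
def Wg (d P : ℕ) (c : Rsp d) (R : ℝ) (x : X d) : ℝ≥0∞ := ENNReal.ofReal ((1 + dist (TR d x) c / R) ^ (-(10 * (P : ℝ))))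

lemma Wg_wt (P : ℕ) (c : Rsp d) {R κ : ℝ} (hR : 0 < R) (hκ : 2 / R ≤ κ) : Wt (10 * P) κ (Wg d P c R) := by
  refine ⟨?_, fun x y => ?_⟩
  · refine Measurable.ennreal_ofReal ?_
    refine Measurable.pow_const ?_ _
    exact (((((TR d).continuous.dist continuous_const).div_const R).const_add 1)).measurable
  · unfold Wg br
    have hg : 1 ≤ 1 + dist (TR d x) c / R := by have : 0 ≤ dist (TR d x) c / R := by positivity
                                                linarith
    have hg' : 1 ≤ 1 + dist (TR d (x + y)) c / R := by have : 0 ≤ dist (TR d (x + y)) c / R := by positivity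
                                                       linarith
    have hκ0 : 0 ≤ κ := le_trans (by positivity) hκ
    have hb : 0 < 1 + κ * ‖y‖ := by positivity
    rw [← ENNReal.ofReal_pow hb.le, ← ENNReal.ofReal_mul (by positivity)]
    refine ENNReal.ofReal_le_ofReal ?_
    have h1 : dist (TR d x) c ≤ dist (TR d (x + y)) c + 2 * ‖y‖ := by
      refine (dist_triangle _ (TR d (x + y)) _).trans ?_
      rw [add_comm]
      refine add_le_add_right ?_ _
      rw [dist_eq_norm, ← map_sub]
      refine (TR_norm _).trans ?_
      simp
    have h2 : 1 + dist (TR d x) c / R ≤ (1 + dist (TR d (x + y)) c / R) * (1 + κ * ‖y‖) := by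
      have h3 : dist (TR d x) c / R ≤ dist (TR d (x + y)) c / R + 2 / R * ‖y‖ := by
        rw [div_mul_eq_mul_div, ← add_div]; gcongr
      have h4 : 2 / R * ‖y‖ ≤ κ * ‖y‖ := by gcongr
      have h5 : 0 ≤ dist (TR d (x + y)) c / R * (κ * ‖y‖) := by positivity
      nlinarith
    rw [Real.rpow_neg (by positivity), Real.rpow_neg (by positivity)]
    have e1 : (10 * (P : ℝ)) = ((10 * P : ℕ) : ℝ) := by push_cast; ring
    rw [e1, Real.rpow_natCast, Real.rpow_natCast, ← div_eq_mul_inv, inv_eq_one_div, div_le_div_iff₀ (by positivity) (by positivity), one_mul, ← mul_pow]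
    rw [mul_comm] at h2
    exact pow_le_pow_left₀ (by positivity) h2 _

lemma cap_count (d : ℕ) {δ : ℝ} (hδ : 0 < δ) (S : Finset (Fin d → ℤ)) (c : (Fin d → ℤ) → V d) (hc : ∀ k i, c k i = k i * (√δ / 2)) (v : V d) :
    {k | k ∈ S ∧ ‖c k - v‖ ≤ (d + 2) * √δ}.ncard ≤ (4 * (d + 2) + 2) ^ d := by
  have hq : 0 < √δ := Real.sqrt_pos.2 hδ
  set m := 2 * (d + 2) with hm
  set f : Fin d → ℤ := fun i => ⌊v i / (√δ / 2)⌋ with hf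
  set P := Fintype.piFinset fun i => Finset.Icc (f i - m) (f i + m + 1) with hP
  have hPc : P.card = (4 * (d + 2) + 2) ^ d := by
    rw [hP, Fintype.card_piFinset]
    have : ∀ i, (Finset.Icc (f i - m) (f i + m + 1)).card = 4 * (d + 2) + 2 := by
      intro i; rw [Int.card_Icc]; omega
    simp [this]
  rw [← hPc, ← Set.ncard_coe_finset]
  refine Set.ncard_le_ncard ?_ P.finite_toSet
  rintro k ⟨-, hk⟩
  rw [Finset.mem_coe, hP, Fintype.mem_piFinset]
  intro i
  have h1 := (coord_le (c k - v) i).trans hk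
  have h2 : (c k - v) i = (k i - v i / (√δ / 2)) * (√δ / 2) := by
    rw [PiLp.sub_apply, hc]; field_simp
  rw [h2, abs_mul, abs_of_pos (show 0 < √δ / 2 by positivity)] at h1
  have h3 : |(k i : ℝ) - v i / (√δ / 2)| ≤ m := by
    rw [hm]; push_cast
    by_contra hcon
    push Not at hcon
    nlinarith
  have h4 := abs_le.1 h3
  have h5 := Int.floor_le (v i / (√δ / 2))
  have h6 := Int.lt_floor_add_one (v i / (√δ / 2))
  rw [Finset.mem_Icc]
  constructor
  · have : (f i : ℝ) - m ≤ k i := by rw [hf]; linarith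
    exact_mod_cast this
  · have : (k i : ℝ) ≤ f i + m + 1 := by simp only [hf]; linarith
    exact_mod_cast this

end

end Dcp

end


section
open MeasureTheory Real
open scoped RealInnerProductSpace ENNReal NNReal

set_option linter.all false
namespace Dcp

section
open Classical

lemma core (n : ℕ) (hn : 2 ≤ n) {p : ℝ} (hpe : p = 2 * ((n : ℝ) + 1) / ((n : ℝ) - 1)) {ε : ℝ} (hε : 0 < ε) :
    ∃ C : ℝ≥0, ∀ δ : ℝ, 0 < δ → δ < 1 → ∀ Λ : Finset (Rsp (n - 1)), ∀ κ : Rsp (n - 1) → (Fin (n - 1) → ℤ),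
      (∀ ξ ∈ Λ, centerOK n δ (κ ξ) ∧ ξ ∈ parabCap n δ (κ ξ)) → ∀ a : Rsp (n - 1) → ℂ, ∀ R : ℝ, δ⁻¹ ≤ R → ∀ c : Rsp (n - 1),
      wNorm n p (fun x => ∑ ξ ∈ Λ, a ξ * ee ⟪x, ξ⟫) c R ^ 2 ≤ C * ENNReal.ofReal (δ ^ (-(2 * ε))) *
        ∑ k ∈ Λ.image κ, wNorm n p (fun x => ∑ ξ ∈ Λ.filter (fun ξ => κ ξ = k), a ξ * ee ⟪x, ξ⟫) c R ^ 2 := by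
  have hnr : (2 : ℝ) ≤ n := by exact_mod_cast hn
  have hdn : ((n - 1 : ℕ) : ℝ) = n - 1 := by rw [Nat.cast_sub (by omega)]; simp
  have hn1 : (0 : ℝ) < n - 1 := by linarith
  have hp : 2 ≤ p := by rw [hpe, le_div_iff₀ hn1]; linarith
  have hp0 : 0 < p := by linarith
  set d := n - 1 with hd
  have hpd : p * d ≤ 2 * (d + 2) := by
    rw [hdn, hpe, div_mul_cancel₀ _ hn1.ne']; linarith
  obtain ⟨C1, hC1⟩ := thm d hp hpd (10 * n) ((4 * (d + 2) + 2) ^ d) d (4 * ε) (by positivity)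
  set M : ℕ := (2 * 1 * (d + 2) + 1) ^ d with hM
  obtain ⟨c0, hc0, hc0t, hcv⟩ := change_var (TR d)
  refine ⟨C1 + M, ?_⟩
  intro δ hδ hδ1 Λ κ hΛ a R hR c
  have hR0 : 0 < R := lt_of_lt_of_le (by positivity) hR
  set q := √δ with hq
  have hq0 : 0 < q := Real.sqrt_pos.2 hδ
  have hqs : q ^ 2 = δ := Real.sq_sqrt hδ.le
  set s : ℝ := (d + 2) * q with hs
  have hs0 : 0 < s := by positivity
  have hd0 : (0 : ℝ) ≤ d := Nat.cast_nonneg d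
  set S := Λ.image κ with hS
  set Ω := Wg d n c R with hΩ
  set F : (Fin d → ℤ) → X d → ℂ := fun k x => ∑ ξ ∈ Λ.filter (fun ξ => κ ξ = k), a ξ * ee ⟪TR d x, ξ⟫ with hF
  set ce : (Fin d → ℤ) → V d := fun k => WithLp.toLp 2 (fun i => k i * (q / 2)) with hce
  have hwt : Wt (10 * n) (s ^ 2) Ω := by
    refine Wg_wt n c hR0 ?_
    have h1 : 2 / R ≤ 2 * δ := by
      rw [div_le_iff₀ hR0]
      have := mul_le_mul_of_nonneg_left hR hδ.le
      rw [mul_inv_cancel₀ hδ.ne'] at this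
      linarith
    rw [hs, mul_pow, hqs]
    have h2 : (2 : ℝ) ≤ ((d : ℝ) + 2) ^ 2 := by nlinarith
    exact h1.trans (mul_le_mul_of_nonneg_right h2 hδ.le)
  -- relation between norms
  have hrel : ∀ G : Rsp d → ℂ, nq p Ω (fun x => G (TR d x)) = c0 ^ (2 / p) * wNorm n p G c R ^ 2 := by
    intro G
    unfold nq wNorm
    have := hcv (fun x => (‖G x‖₊ : ℝ≥0∞) ^ p * ENNReal.ofReal ((1 + dist x c / R) ^ (-(10 * (n : ℝ)))))
    rw [hΩ]
    change (∫⁻ x, (‖G (TR d x)‖₊ : ℝ≥0∞) ^ p * ENNReal.ofReal ((1 + dist (TR d x) c / R) ^ (-(10 * (n : ℝ))))) ^ (2 / p) = _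
    rw [this, ENNReal.mul_rpow_of_nonneg _ _ (by positivity)]
    congr 1
    rw [← ENNReal.rpow_natCast, ← ENNReal.rpow_mul]
    congr 1
    push_cast; ring
  have hmem : ∀ (U : Set (X d)) (J : Finset (Rsp d)), (∀ ξ ∈ J, (TR d).symm ξ ∈ U) → (fun x => ∑ ξ ∈ J, a ξ * ee ⟪TR d x, ξ⟫) ∈ ES U := by
    intro U J hJ
    have : (fun x => ∑ ξ ∈ J, a ξ * ee ⟪TR d x, ξ⟫) = ∑ ξ ∈ J, a ξ • chr ((TR d).symm ξ) := by
      ext x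
      rw [Finset.sum_apply]
      refine Finset.sum_congr rfl fun ξ _ => ?_
      rw [Pi.smul_apply, smul_eq_mul]
      unfold chr
      rw [← TR_inner, ContinuousLinearEquiv.apply_symm_apply]
    rw [this]
    exact Submodule.sum_mem _ fun ξ hξ => Submodule.smul_mem _ _ (Submodule.subset_span ⟨_, hJ ξ hξ, rfl⟩)
  have hFu : ∀ θ, F θ ∈ ES Set.univ := fun θ => hmem _ _ fun _ _ => Set.mem_univ _
  have hsum : ∑ θ ∈ S, F θ = fun x => ∑ ξ ∈ Λ, a ξ * ee ⟪TR d x, ξ⟫ := by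
    ext x
    rw [Finset.sum_apply]
    exact Finset.sum_fiberwise_of_maps_to (fun ξ hξ => Finset.mem_image_of_mem κ hξ) _
  have hSok : ∀ θ ∈ S, centerOK n δ θ := by
    intro θ hθ
    obtain ⟨ξ, hξ, rfl⟩ := Finset.mem_image.1 hθ
    exact (hΛ ξ hξ).1
  have hδe : 1 ≤ δ ^ (-(2 * ε)) := Real.one_le_rpow_of_pos_of_le_one_of_nonpos hδ hδ1.le (by linarith)
  have key : nq p Ω (∑ θ ∈ S, F θ) ≤ ((C1 + M : ℝ≥0) : ℝ≥0∞) * ENNReal.ofReal (δ ^ (-(2 * ε))) * ∑ θ ∈ S, nq p Ω (F θ) := by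
    by_cases hs1 : s ≤ 1
    · have hfam : Fam (d : ℝ) s ((4 * (d + 2) + 2) ^ d) S ce F := by
        refine ⟨fun θ hθ => ?_, fun v => cap_count d hδ S ce (fun _ _ => rfl) v, fun θ hθ => hmem _ _ fun ξ hξ => ?_, hFu⟩
        · have := norm_le_of_coord (ce θ) (r := 1 / 2) (by norm_num) (fun i => hSok θ hθ i)
          linarith
        · obtain ⟨hξΛ, rfl⟩ := Finset.mem_filter.1 hξ
          obtain ⟨-, h1, h2⟩ := hΛ ξ hξΛ
          obtain ⟨ω, rfl⟩ := (TR d).surjective ξ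
          rw [ContinuousLinearEquiv.symm_apply_apply]
          refine ⟨?_, ?_⟩
          · have := norm_le_of_coord (ω.1 - ce (κ (TR d ω))) (r := q / 2) (by positivity) (fun i => h1 i)
            refine this.trans ?_
            rw [hs]; nlinarith
          · have h3 : ω.2 = ‖ω.1‖ ^ 2 := by
              rw [EuclideanSpace.norm_sq_eq]
              simp only [Real.norm_eq_abs, sq_abs]
              exact h2
            rw [h3, sub_self, abs_zero]; positivity
      refine (hC1 s hs0 hs1 Ω hwt _ S ce F hfam).trans (mul_le_mul_left (mul_le_mul' ?_ (ENNReal.ofReal_le_ofReal ?_)) _)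
      · exact_mod_cast le_self_add
      · have h1 : s ^ (-(4 * ε)) ≤ q ^ (-(4 * ε)) := by
          refine Real.rpow_le_rpow_of_nonpos hq0 ?_ (by linarith)
          rw [hs]; nlinarith
        refine h1.trans (le_of_eq ?_)
        rw [← hqs, ← Real.rpow_natCast, ← Real.rpow_mul hq0.le]
        congr 1; push_cast; ring
    · push Not at hs1
      refine (nq_card hp hwt.1 S F hFu).trans (mul_le_mul_left ?_ _)
      have hcard : S.card ≤ M := by
        rw [hM, ← labBox_card]
        refine Finset.card_le_card fun θ hθ => ?_
        simp only [labBox, Fintype.mem_piFinset, Finset.mem_Icc]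
        intro i
        have h1 := hSok θ hθ i
        rw [abs_mul, abs_of_pos (show 0 < √δ / 2 by positivity)] at h1
        have h2 : |(θ i : ℝ)| ≤ (d + 2 : ℕ) := by
          by_contra hcon
          push Not at hcon
          push_cast at hcon
          nlinarith
        have h3 := abs_le.1 h2
        constructor
        · have := h3.1; push_cast; push_cast at this
          have h4 : (((-(1 * (d + 2)) : ℤ)) : ℝ) ≤ (θ i : ℝ) := by push_cast; linarith
          exact_mod_cast h4
        · have := h3.2; push_cast; push_cast at this
          have h4 : (θ i : ℝ) ≤ (((1 * (d + 2)) : ℤ) : ℝ) := by push_cast; linarith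
          exact_mod_cast h4
      calc (S.card : ℝ≥0∞) ≤ ((C1 + M : ℝ≥0) : ℝ≥0∞) * 1 := by
            rw [mul_one]; push_cast
            refine le_trans ?_ le_add_self
            exact_mod_cast hcard
        _ ≤ _ := by
            refine mul_le_mul_right ?_ _
            rw [← ENNReal.ofReal_one]; exact ENNReal.ofReal_le_ofReal hδe
  rw [hsum, hrel (fun x => ∑ ξ ∈ Λ, a ξ * ee ⟪x, ξ⟫)] at key
  have hterm : ∀ θ, nq p Ω (F θ) = c0 ^ (2 / p) * wNorm n p (fun x => ∑ ξ ∈ Λ.filter (fun ξ => κ ξ = θ), a ξ * ee ⟪x, ξ⟫) c R ^ 2 := fun θ =>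
    hrel (fun x => ∑ ξ ∈ Λ.filter (fun ξ => κ ξ = θ), a ξ * ee ⟪x, ξ⟫)
  simp_rw [hterm] at key
  rw [← Finset.mul_sum, mul_left_comm] at key
  have hcp0 : c0 ^ (2 / p) ≠ 0 := by simp [ENNReal.rpow_eq_zero_iff, hc0, hc0t]
  have hcpt : c0 ^ (2 / p) ≠ ∞ := ENNReal.rpow_ne_top_of_nonneg (by positivity) hc0t
  exact (ENNReal.mul_le_mul_iff_right hcp0 hcpt).1 key

end

end Dcp

end


theorem decoupling_points_in_caps (n : ℕ) (hn : 2 ≤ n) :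
    ∀ ε > (0 : ℝ), ∃ C > (0 : ℝ), ∀ δ : ℝ, 0 < δ → δ < 1 →
      ∀ Λ : Finset (Rsp (n - 1)), ∀ κ : Rsp (n - 1) → (Fin (n - 1) → ℤ),
        (∀ ξ ∈ Λ, centerOK n δ (κ ξ) ∧ ξ ∈ parabCap n δ (κ ξ)) →
        ∀ a : Rsp (n - 1) → ℂ, ∀ R : ℝ, δ⁻¹ ≤ R → ∀ c : Rsp (n - 1),
          (∫⁻ x in Metric.ball c R,
              (‖∑ ξ ∈ Λ, a ξ * ee ⟪x, ξ⟫‖₊ : ℝ≥0∞) ^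
                (2 * ((n : ℝ) + 1) / ((n : ℝ) - 1))) ^
              (((n : ℝ) - 1) / (2 * ((n : ℝ) + 1))) ≤
            ENNReal.ofReal (C * δ ^ (-ε)) *
              (∑' k : {k : Fin (n - 1) → ℤ // centerOK n δ k},
                wNorm n (2 * ((n : ℝ) + 1) / ((n : ℝ) - 1))
                  (fun x => ∑ ξ ∈ Λ.filter (fun ξ => κ ξ = k.1), a ξ * ee ⟪x, ξ⟫) c R ^ 2) ^
                (1 / 2 : ℝ) := by
  intro ε hε
  have hnr : (2 : ℝ) ≤ n := by exact_mod_cast hn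
  have hn1 : (0 : ℝ) < n - 1 := by linarith
  have hexp : ((n : ℝ) - 1) / (2 * ((n : ℝ) + 1)) = 1 / (2 * ((n : ℝ) + 1) / ((n : ℝ) - 1)) := by rw [one_div_div]
  rw [hexp]
  obtain ⟨p, hpe⟩ : ∃ p : ℝ, p = 2 * ((n : ℝ) + 1) / ((n : ℝ) - 1) := ⟨_, rfl⟩
  obtain ⟨C1, hC1⟩ := Dcp.core n hn hpe hε
  rw [← hpe]
  have hp : 2 ≤ p := by rw [hpe, le_div_iff₀ hn1]; linarith
  have hp0 : 0 < p := by linarith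
  refine ⟨2 ^ (10 * n) * (C1 + 1), by positivity, ?_⟩
  intro δ hδ hδ1 Λ κ hΛ a R hR c
  have hR0 : 0 < R := lt_of_lt_of_le (by positivity) hR
  have hcore := hC1 δ hδ hδ1 Λ κ hΛ a R hR c
  set G : Rsp (n - 1) → ℂ := fun x => ∑ ξ ∈ Λ, a ξ * ee ⟪x, ξ⟫ with hG
  set f : (Fin (n - 1) → ℤ) → ENNReal := fun k => wNorm n p (fun x => ∑ ξ ∈ Λ.filter (fun ξ => κ ξ = k), a ξ * ee ⟪x, ξ⟫) c R ^ 2 with hf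
  set Sg : ENNReal := ∑' k : {k : Fin (n - 1) → ℤ // centerOK n δ k}, f k.1 with hSg
  change (∫⁻ x in Metric.ball c R, (‖G x‖₊ : ℝ≥0∞) ^ p) ^ (1 / p) ≤ ENNReal.ofReal (2 ^ (10 * n) * (C1 + 1) * δ ^ (-ε)) * Sg ^ (1 / 2 : ℝ)
  -- ball versus weight
  have hball : (∫⁻ x in Metric.ball c R, (‖G x‖₊ : ℝ≥0∞) ^ p) ^ (1 / p) ≤ 2 ^ (10 * n) * wNorm n p G c R := by
    have h1 : (∫⁻ x in Metric.ball c R, (‖G x‖₊ : ℝ≥0∞) ^ p) ≤ 2 ^ (10 * n) * ∫⁻ x, (‖G x‖₊ : ℝ≥0∞) ^ p *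
      ENNReal.ofReal ((1 + dist x c / R) ^ (-(10 * (n : ℝ)))) := by
      rw [← lintegral_const_mul' _ _ (ENNReal.pow_ne_top (by simp))]
      refine le_trans (setLIntegral_mono' Metric.isOpen_ball.measurableSet fun x hx => ?_) (setLIntegral_le_lintegral _ _)
      have h2 : dist x c / R ≤ 1 := (div_le_one hR0).2 (Metric.mem_ball.1 hx).le
      have h3 : (1 : ℝ) ≤ 2 ^ (10 * n) * (1 + dist x c / R) ^ (-(10 * (n : ℝ))) := by
        have e1 : (10 * (n : ℝ)) = ((10 * n : ℕ) : ℝ) := by push_cast; ring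
        have h0 : 0 ≤ dist x c / R := by positivity
        rw [Real.rpow_neg (by positivity), e1, Real.rpow_natCast, ← div_eq_mul_inv, le_div_iff₀ (by positivity), one_mul]
        exact pow_le_pow_left₀ (by positivity) (by linarith) _
      have h4 := ENNReal.ofReal_le_ofReal h3
      rw [ENNReal.ofReal_one, ENNReal.ofReal_mul (by positivity), ENNReal.ofReal_pow (by norm_num), ENNReal.ofReal_ofNat] at h4
      calc (‖G x‖₊ : ℝ≥0∞) ^ p = (‖G x‖₊ : ℝ≥0∞) ^ p * 1 := (mul_one _).symm
        _ ≤ (‖G x‖₊ : ℝ≥0∞) ^ p * (2 ^ (10 * n) * ENNReal.ofReal ((1 + dist x c / R) ^ (-(10 * (n : ℝ))))) := mul_le_mul_right h4 _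
        _ = _ := by ring
    refine (ENNReal.rpow_le_rpow h1 (by positivity)).trans ?_
    rw [ENNReal.mul_rpow_of_nonneg _ _ (by positivity)]
    unfold wNorm
    refine mul_le_mul_left ?_ _
    have h5 : (1 : ℝ≥0∞) ≤ 2 ^ (10 * n) := one_le_pow₀ (by norm_num)
    calc ((2 : ℝ≥0∞) ^ (10 * n)) ^ (1 / p) ≤ ((2 : ℝ≥0∞) ^ (10 * n)) ^ (1 : ℝ) :=
          ENNReal.rpow_le_rpow_of_exponent_le h5 (by rw [div_le_one hp0]; linarith)
      _ = _ := ENNReal.rpow_one _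
  have hfin : ∑ k ∈ Λ.image κ, f k ≤ Sg := by
    classical
    have h1 : ∀ k ∈ Λ.image κ, centerOK n δ k := by
      intro θ hθ
      obtain ⟨ξ, hξ, rfl⟩ := Finset.mem_image.1 hθ
      exact (hΛ ξ hξ).1
    have h2 := Finset.sum_subtype_eq_sum_filter (s := Λ.image κ) (p := fun k => centerOK n δ k) f
    rw [Finset.filter_true_of_mem h1] at h2
    rw [← h2]
    exact ENNReal.sum_le_tsum _
  have hw : wNorm n p G c R ≤ ENNReal.ofReal ((C1 + 1) * δ ^ (-ε)) * Sg ^ (1 / 2 : ℝ) := by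
    have h1 : wNorm n p G c R ^ 2 ≤ (ENNReal.ofReal ((C1 + 1) * δ ^ (-ε))) ^ 2 * Sg := by
      refine hcore.trans (mul_le_mul' ?_ (le_trans (le_of_eq ?_) hfin))
      · rw [← ENNReal.ofReal_pow (by positivity), ← ENNReal.ofReal_coe_nnreal, ← ENNReal.ofReal_mul (by positivity)]
        refine ENNReal.ofReal_le_ofReal ?_
        rw [mul_pow, ← Real.rpow_natCast (δ ^ (-ε)), ← Real.rpow_mul hδ.le]
        have e1 : -ε * ((2 : ℕ) : ℝ) = -(2 * ε) := by push_cast; ring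
        rw [e1]
        refine mul_le_mul_of_nonneg_right ?_ (by positivity)
        have : (0 : ℝ) ≤ C1 := C1.2
        nlinarith
      · congr!
    have h2 := ENNReal.rpow_le_rpow h1 (show (0 : ℝ) ≤ 1 / 2 by norm_num)
    have h3 : ∀ z : ENNReal, (z ^ 2) ^ (1 / 2 : ℝ) = z := by
      intro z; rw [← ENNReal.rpow_natCast, ← ENNReal.rpow_mul]; norm_num
    rw [ENNReal.mul_rpow_of_nonneg _ _ (by norm_num), h3, h3] at h2
    exact h2
  refine hball.trans ((mul_le_mul_right hw _).trans (le_of_eq ?_))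
  rw [← mul_assoc, mul_assoc ((2 : ℝ) ^ (10 * n)), ENNReal.ofReal_mul (show (0 : ℝ) ≤ 2 ^ (10 * n) by positivity), ENNReal.ofReal_pow (by norm_num), ENNReal.ofReal_ofNat]

end
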